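/- arXiv:1107.2719 — 5 statements merged into one kernel-verified Lean document; each statement's English description precedes it below -/
import Mathlib

section
/- Let m, d, k be integers with m ≥ 4, 1 ≤ d ≤ m−1, d ≠ m/2, and with k ≥ 3 if d < m/2 and k ≥ 4 if d > m/2. Let B = {0,1,…,m−1} \ {d}, let L = {m−d, 2m−d, …, km−d}, let a* = (k+1)m − 2d, and let A* = B ∪ L ∪ (a* − B), where a* − B = {a* − b : b ∈ B}. Then the set A = A* ∪ {m} satisfies |A+A| > |A−A|, i.e., A is an MSTD set. -/
open Finset
open scoped Pointwise

lemma aux_diffB (m d t : ℤ) (hm : 4 ≤ m) (ht : 1 ≤ t) (ht2 : t ≤ m - 1) (h : t ≠ m - 1 ∨ d ≠ m - 1)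
    (hd1 : 1 ≤ d) :
    ∃ y, (0 ≤ y + t ∧ y + t ≤ m - 1 ∧ y + t ≠ d) ∧ (0 ≤ y ∧ y ≤ m - 1 ∧ y ≠ d) := by
  by_cases h1 : t = d
  · by_cases h2 : d = 1
    · exact ⟨2, by omega, by omega⟩
    · exact ⟨1, by omega, by omega⟩
  · exact ⟨0, by omega, by omega⟩

/-- Nathanson's construction of MSTD sets: with `B = {0,…,m-1} \ {d}`,
`L = {m-d, 2m-d, …, km-d}`, `a* = (k+1)m - 2d`, and `A* = B ∪ L ∪ (a* - B)`,
the set `A = A* ∪ {m}` is an MSTD set. -/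
theorem nathanson_mstd (m d k : ℤ) (hm : 4 ≤ m) (hd1 : 1 ≤ d) (hd2 : d ≤ m - 1)
    (hdm : 2 * d ≠ m) (hk3 : 2 * d < m → 3 ≤ k) (hk4 : m < 2 * d → 4 ≤ k)
    (B L A : Finset ℤ) (astar : ℤ)
    (hB : B = Finset.Icc 0 (m - 1) \ {d})
    (hL : L = (Finset.Icc 1 k).image fun i => i * m - d)
    (hastar : astar = (k + 1) * m - 2 * d)
    (hA : A = (B ∪ L ∪ B.image fun b => astar - b) ∪ {m}) :
    (A - A).card < (A + A).card := by
  have hk : 3 ≤ k := by omega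
  have ha : astar = k * m + m - 2 * d := by rw [hastar]; ring
  have hkm : k * m ≥ 3 * m := by nlinarith
  have hkm' : m < 2 * d → k * m ≥ 4 * m := fun h => by have := hk4 h; nlinarith
  obtain ⟨S, hS⟩ : ∃ S, S = B ∪ L ∪ B.image fun b => astar - b := ⟨_, rfl⟩
  rw [← hS] at hA
  have memS : ∀ x, x ∈ S ↔ (0 ≤ x ∧ x ≤ m - 1 ∧ x ≠ d) ∨ (∃ i, 1 ≤ i ∧ i ≤ k ∧ x = i * m - d) ∨
      (0 ≤ astar - x ∧ astar - x ≤ m - 1 ∧ astar - x ≠ d) := by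
    intro x
    rw [hS, hB, hL]
    simp only [mem_union, mem_sdiff, mem_Icc, mem_singleton, mem_image]
    constructor
    · rintro ((h | ⟨i, h, rfl⟩) | ⟨b, h, rfl⟩)
      · left; omega
      · right; left; exact ⟨i, h.1, h.2, rfl⟩
      · right; right; omega
    · rintro (h | ⟨i, h1, h2, rfl⟩ | h)
      · left; left; omega
      · left; right; exact ⟨i, ⟨h1, h2⟩, rfl⟩
      · right; exact ⟨astar - x, by omega, by omega⟩
  have inB : ∀ x, (0 ≤ x ∧ x ≤ m - 1 ∧ x ≠ d) → x ∈ S := fun x h => (memS x).2 (Or.inl h)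
  have inL : ∀ i, 1 ≤ i → i ≤ k → i * m - d ∈ S := fun i h h' =>
    (memS _).2 (Or.inr (Or.inl ⟨i, h, h', rfl⟩))
  have inR : ∀ x, (0 ≤ astar - x ∧ astar - x ≤ m - 1 ∧ astar - x ≠ d) → x ∈ S :=
    fun x h => (memS x).2 (Or.inr (Or.inr h))
  have symS : ∀ x, x ∈ S → astar - x ∈ S := by
    intro x hx
    rcases (memS x).1 hx with h | ⟨i, h1, h2, h⟩ | h
    · apply inR; simpa using h
    · have := inL (k + 1 - i) (by omega) (by omega)
      convert this using 1
      rw [h, ha]; ring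
    · exact inB _ h
  have z : (0 : ℤ) ∈ S := inB 0 (by omega)
  have l1 : m - d ∈ S := by simpa using inL 1 (by omega) (by omega)
  have l2 : 2 * m - d ∈ S := inL 2 (by omega) (by omega)
  have lk : k * m - d ∈ S := inL k (by omega) (by omega)
  have lk1 : k * m - m - d ∈ S := by
    have := inL (k-1) (by omega) (by omega)
    convert this using 1; ring
  -- small differences
  have small : ∀ t, 1 ≤ t → t ≤ m - 1 → ∃ u ∈ S, ∃ v ∈ S, t = u - v := by
    intro t h1 h2
    by_cases h : t ≠ m - 1 ∨ d ≠ m - 1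
    · obtain ⟨y, hy1, hy2⟩ := aux_diffB m d t hm h1 h2 h hd1
      exact ⟨_, inB _ hy1, _, inB _ hy2, by ring⟩
    · exact ⟨_, l2, 2, inB 2 (by omega), by omega⟩
  have key : ∀ x ∈ S, ∃ u ∈ S, ∃ v ∈ S, x - m = u - v := by
    intro x hx
    rcases (memS x).1 hx with h | ⟨i, h1, h2, h⟩ | h
    · by_cases h0 : x = 0
      · exact ⟨_, l1, _, l2, by omega⟩
      · obtain ⟨u, hu, v, hv, e⟩ := small (m - x) (by omega) (by omega)
        exact ⟨v, hv, u, hu, by omega⟩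
    · by_cases hi : i = 1
      · obtain ⟨u, hu, v, hv, e⟩ := small d (by omega) (by omega)
        subst hi
        exact ⟨v, hv, u, hu, by omega⟩
      · refine ⟨_, inL (i-1) (by omega) (by omega), 0, z, ?_⟩
        rw [h]; ring
    · by_cases h0 : astar - x = 0
      · by_cases h3 : d = 1 ∨ d = m - 1
        · exact ⟨astar - 2, inR _ (by omega), m - 2, inB _ (by omega), by omega⟩
        · exact ⟨astar - 1, inR _ (by omega), m - 1, inB _ (by omega), by omega⟩
      · by_cases h3 : d + (astar - x) ≤ m - 1
        · exact ⟨_, lk, d + (astar - x), inB _ (by omega), by omega⟩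
        · exact ⟨_, lk1, d + (astar - x) - m, inB _ (by omega), by omega⟩
  have memA : ∀ x, x ∈ A ↔ x ∈ S ∨ x = m := by intro x; rw [hA, mem_union, mem_singleton]
  have hsub : A - A ⊆ (S + S).image (fun x => x - astar) := by
    have fin : ∀ w, (∃ u ∈ S, ∃ v ∈ S, w = u - v) → w ∈ (S + S).image (fun x => x - astar) := by
      rintro w ⟨u, hu, v, hv, rfl⟩
      exact mem_image.2 ⟨u + (astar - v), add_mem_add hu (symS v hv), by ring⟩
    intro w hw
    obtain ⟨x, hx, y, hy, rfl⟩ := mem_sub.1 hw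
    apply fin
    rcases (memA x).1 hx with hx | rfl <;> rcases (memA y).1 hy with hy | rfl
    · exact ⟨x, hx, y, hy, rfl⟩
    · exact key x hx
    · obtain ⟨u, hu, v, hv, e⟩ := key y hy
      exact ⟨v, hv, u, hu, by omega⟩
    · exact ⟨0, z, 0, z, by ring⟩
  have hnot : 2 * m ∉ S + S := by
    have BL : ∀ x i, (0 ≤ x ∧ x ≤ m - 1 ∧ x ≠ d) → x + (i * m - d) = 2 * m → False := by
      intro x i h e
      have e' : x - d = (2 - i) * m := by linarith
      rcases lt_trichotomy (2 - i) 0 with h0 | h0 | h0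
      · have : (2 - i) * m ≤ -m := by nlinarith
        omega
      · rw [h0] at e'; omega
      · have : (2 - i) * m ≥ m := by nlinarith
        omega
    have Li : ∀ i : ℤ, 1 ≤ i → i * m ≥ m := fun i h => by nlinarith
    intro hh
    obtain ⟨x, hx, y, hy, e⟩ := mem_add.1 hh
    rcases (memS x).1 hx with h | ⟨i, h1, h2, h⟩ | h <;>
    rcases (memS y).1 hy with h' | ⟨j, h1', h2', h'⟩ | h'
    · omega
    · subst h'; exact BL x j h e
    · omega
    · subst h; exact BL y i h' (by omega)
    · have e' : 2 * d = (i + j - 2) * m := by rw [h, h'] at e; linarith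
      rcases lt_trichotomy (i + j - 2) 1 with h0 | h0 | h0
      · have : (i + j - 2) * m ≤ 0 := by nlinarith
        omega
      · rw [h0] at e'; omega
      · have : (i + j - 2) * m ≥ 2 * m := by nlinarith
        omega
    · have := Li i h1
      omega
    · omega
    · have := Li j h1'
      omega
    · omega
  have hlt : S + S ⊂ A + A := by
    rw [ssubset_iff_of_subset]
    · exact ⟨2 * m, mem_add.2 ⟨m, (memA m).2 (Or.inr rfl), m, (memA m).2 (Or.inr rfl), by ring⟩, hnot⟩
    · have : S ⊆ A := fun x hx => (memA x).2 (Or.inl hx)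
      exact add_subset_add this this
  calc (A - A).card ≤ _ := card_le_card hsub
    _ ≤ (S + S).card := card_image_le
    _ < _ := card_lt_card hlt
end

section
/- There is no MSTD set of integers of size seven: every finite set A ⊆ ℤ with |A| = 7 satisfies |A+A| ≤ |A−A|. -/
open Finset
open scoped Pointwise

namespace MSTD7

/-- Indices of the seven elements. -/
inductive Ix | i0 | i1 | i2 | i3 | i4 | i5 | i6
  deriving DecidableEq

instance : Fintype Ix := ⟨{.i0, .i1, .i2, .i3, .i4, .i5, .i6}, by intro x; cases x <;> simp⟩

open Ix

/-- A column of coefficients. -/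
structure Col where
  (r0 r1 r2 r3 r4 r5 r6 : ℕ)

noncomputable def Col.get (c : Col) (i : Ix) : ℕ :=
  Ix.rec c.r0 c.r1 c.r2 c.r3 c.r4 c.r5 c.r6 i

/-- The relation `i + l = j + k`, with its bit. -/
structure Rel where
  (i j k l : Ix) (bit : ℕ)

noncomputable def Rel.plus (r : Rel) (c : Col) : ℕ := Nat.add (c.get r.i) (c.get r.l)
noncomputable def Rel.minus (r : Rel) (c : Col) : ℕ := Nat.add (c.get r.j) (c.get r.k)

/-- If-then-else with fast kernel reduction. -/
noncomputable def sel {β : Type} (b : Bool) (t e : β) : β := Bool.rec e t b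

/-- All columns balanced. -/
noncomputable def isZero (r : Rel) (V : List Col) : Bool :=
  List.rec true (fun c _ ih => sel (Nat.beq (r.plus c) (r.minus c)) ih false) V

/-- All columns have `plus ≤ minus`. -/
noncomputable def allLe (r : Rel) (V : List Col) : Bool :=
  List.rec true (fun c _ ih => sel (Nat.ble (r.plus c) (r.minus c)) ih false) V

/-- All columns have `minus ≤ plus`. -/
noncomputable def allGe (r : Rel) (V : List Col) : Bool :=
  List.rec true (fun c _ ih => sel (Nat.ble (r.minus c) (r.plus c)) ih false) V

/-- Some column is unbalanced and all unbalanced ones are on the same side (`x`), all balanced (`z`),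
or neither (`y`). -/
noncomputable def status {β : Type} (r : Rel) (V : List Col) (z x y : β) : β :=
  List.rec z (fun c cs ih =>
    (fun p m => sel (Nat.beq p m) ih
      (sel (Nat.ble p m) (sel (allLe r cs) x y) (sel (allGe r cs) x y))) (r.plus c) (r.minus c)) V

noncomputable def mx (a b : ℕ) : ℕ := sel (Nat.ble a b) b a

noncomputable def Col.max (c : Col) : ℕ :=
  mx c.r0 (mx c.r1 (mx c.r2 (mx c.r3 (mx c.r4 (mx c.r5 c.r6)))))

noncomputable def Col.neg (c : Col) : Col :=
  (fun M => ⟨Nat.sub M c.r0, Nat.sub M c.r1, Nat.sub M c.r2, Nat.sub M c.r3, Nat.sub M c.r4,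
    Nat.sub M c.r5, Nat.sub M c.r6⟩) c.max

noncomputable def Col.comb (a : ℕ) (d : Col) (b : ℕ) (p : Col) : Col :=
  ⟨Nat.add (Nat.mul a d.r0) (Nat.mul b p.r0), Nat.add (Nat.mul a d.r1) (Nat.mul b p.r1),
   Nat.add (Nat.mul a d.r2) (Nat.mul b p.r2), Nat.add (Nat.mul a d.r3) (Nat.mul b p.r3),
   Nat.add (Nat.mul a d.r4) (Nat.mul b p.r4), Nat.add (Nat.mul a d.r5) (Nat.mul b p.r5),
   Nat.add (Nat.mul a d.r6) (Nat.mul b p.r6)⟩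

/-- Eliminate with a pivot whose unbalance has absolute value `a`; `q` is the column to be added to
those with positive unbalance, `q'` to those with negative unbalance. -/
noncomputable def elimWith (r : Rel) (a : ℕ) (q q' : Col) (V : List Col) : List Col :=
  List.rec [] (fun d _ ih =>
    sel (Nat.ble (r.plus d) (r.minus d)) (Col.comb a d (Nat.sub (r.minus d) (r.plus d)) q')
      (Col.comb a d (Nat.sub (r.plus d) (r.minus d)) q) :: ih) V

noncomputable def elim (r : Rel) (V : List Col) : List Col :=
  List.rec [] (fun p cs ih =>
    sel (Nat.beq (r.plus p) (r.minus p)) (p :: ih)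
      (sel (Nat.ble (r.plus p) (r.minus p))
        (elimWith r (Nat.sub (r.minus p) (r.plus p)) p p.neg cs)
        (elimWith r (Nat.sub (r.plus p) (r.minus p)) p.neg p cs))) V

/-- Evaluate the argument before continuing. -/
noncomputable def force {β : Type} (n : ℕ) (K : ℕ → β) : β :=
  Nat.rec (K (nat_lit 0)) (fun m _ => K (Nat.succ m)) n

noncomputable def forceCol {β : Type} (c : Col) (K : Col → β) : β :=
  force c.r0 fun x0 => force c.r1 fun x1 => force c.r2 fun x2 => force c.r3 fun x3 =>
  force c.r4 fun x4 => force c.r5 fun x5 => force c.r6 fun x6 => K ⟨x0, x1, x2, x3, x4, x5, x6⟩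

noncomputable def forceList (V : List Col) : (List Col → Bool) → Bool :=
  List.rec (fun K => K []) (fun c _ ih => fun K => forceCol c fun c' => ih fun W => K (c' :: W)) V

/-- Is some gap forced to be nonpositive? -/
noncomputable def badGap (gs : List Rel) (V : List Col) : Bool :=
  List.rec false (fun g _ ih => sel (allLe g V) true ih) gs

noncomputable def scan (V : List Col) (K : ℕ → ℕ → Bool) (rs : List Rel) : ℕ → ℕ → Bool :=
  List.rec K (fun r _ ih => fun T U =>
    sel (Nat.beq (Nat.land U r.bit) (nat_lit 0))
      (sel (isZero r V) true (ih T U))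
      (status r V (ih (Nat.lor T r.bit) U) (ih T (Nat.xor U r.bit)) (ih T U))) rs

noncomputable def cn (L : List ℕ) (U : ℕ) : ℕ :=
  List.rec (nat_lit 0)
    (fun m _ ih => sel (Nat.beq (Nat.land m U) (nat_lit 0)) ih (Nat.succ ih)) L

def gaps : List Rel :=
  [⟨i1, i0, i0, i0, 0⟩, ⟨i2, i1, i0, i0, 0⟩, ⟨i3, i2, i0, i0, 0⟩, ⟨i4, i3, i0, i0, 0⟩,
   ⟨i5, i4, i0, i0, 0⟩, ⟨i6, i5, i0, i0, 0⟩]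

noncomputable def node (RELS : List Rel) (D S : List ℕ) (rs : List Rel) :
    List Col → ℕ → ℕ → ℕ → Bool :=
  List.rec (fun _ _ _ _ => false) (fun r _ ih => fun V s T U =>
    sel (Nat.beq (Nat.land (Nat.xor U T) r.bit) (nat_lit 0)) (ih V s T U)
      (sel (forceList (elim r V) fun W => sel (badGap gaps W) true
          (scan W (fun T U => force T fun T => force U fun U =>
            force (Nat.add (nat_lit 16) (cn S T)) fun s =>
              sel (Nat.ble s (Nat.mul (nat_lit 2) (cn D U))) (ih W s T U) true)
            RELS (nat_lit 0) U))
        (force (Nat.xor U r.bit) fun U =>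
          sel (Nat.ble s (Nat.mul (nat_lit 2) (cn D U))) (ih V s T U) true)
        false)) rs

def initV : List Col :=
  [⟨0, 1, 1, 1, 1, 1, 1⟩, ⟨0, 0, 1, 1, 1, 1, 1⟩, ⟨0, 0, 0, 1, 1, 1, 1⟩, ⟨0, 0, 0, 0, 1, 1, 1⟩,
   ⟨0, 0, 0, 0, 0, 1, 1⟩, ⟨0, 0, 0, 0, 0, 0, 1⟩]

def RELS : List Rel :=
  [⟨i1, i2, i5, i6, nat_lit 1⟩, ⟨i1, i2, i2, i6, nat_lit 2⟩, ⟨i0, i2, i3, i6, nat_lit 4⟩, ⟨i1, i3, i5, i6, nat_lit 8⟩,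
   ⟨i0, i1, i2, i4, nat_lit 16⟩, ⟨i0, i1, i1, i5, nat_lit 32⟩, ⟨i0, i1, i3, i4, nat_lit 64⟩, ⟨i1, i2, i4, i6, nat_lit 128⟩,
   ⟨i0, i1, i2, i5, nat_lit 256⟩, ⟨i0, i2, i2, i6, nat_lit 512⟩, ⟨i0, i1, i1, i2, nat_lit 1024⟩, ⟨i0, i1, i2, i6, nat_lit 2048⟩,
   ⟨i0, i1, i1, i3, nat_lit 4096⟩, ⟨i0, i1, i5, i6, nat_lit 8192⟩, ⟨i1, i2, i3, i4, nat_lit 16384⟩,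
   ⟨i0, i1, i4, i6, nat_lit 32768⟩, ⟨i0, i2, i2, i4, nat_lit 65536⟩, ⟨i1, i2, i2, i4, nat_lit 131072⟩,
   ⟨i0, i1, i2, i3, nat_lit 262144⟩, ⟨i1, i2, i3, i6, nat_lit 524288⟩, ⟨i0, i1, i3, i6, nat_lit 1048576⟩,
   ⟨i1, i2, i2, i3, nat_lit 2097152⟩, ⟨i0, i2, i2, i3, nat_lit 4194304⟩, ⟨i2, i3, i5, i6, nat_lit 8388608⟩,
   ⟨i0, i2, i5, i6, nat_lit 16777216⟩, ⟨i0, i1, i3, i5, nat_lit 33554432⟩, ⟨i0, i1, i4, i5, nat_lit 67108864⟩,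
   ⟨i0, i2, i4, i6, nat_lit 134217728⟩, ⟨i0, i1, i1, i4, nat_lit 268435456⟩, ⟨i2, i3, i4, i6, nat_lit 536870912⟩,
   ⟨i0, i1, i1, i6, nat_lit 1073741824⟩, ⟨i0, i2, i3, i4, nat_lit 2147483648⟩, ⟨i1, i3, i4, i6, nat_lit 4294967296⟩,
   ⟨i0, i3, i4, i6, nat_lit 8589934592⟩, ⟨i2, i3, i3, i6, nat_lit 17179869184⟩, ⟨i1, i3, i3, i6, nat_lit 34359738368⟩,
   ⟨i0, i3, i5, i6, nat_lit 68719476736⟩, ⟨i0, i3, i3, i6, nat_lit 137438953472⟩, ⟨i0, i2, i3, i5, nat_lit 274877906944⟩,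
   ⟨i1, i2, i3, i5, nat_lit 549755813888⟩, ⟨i1, i2, i4, i5, nat_lit 1099511627776⟩,
   ⟨i1, i2, i2, i5, nat_lit 2199023255552⟩, ⟨i0, i2, i4, i5, nat_lit 4398046511104⟩,
   ⟨i0, i2, i2, i5, nat_lit 8796093022208⟩, ⟨i0, i4, i5, i6, nat_lit 17592186044416⟩,
   ⟨i2, i3, i3, i4, nat_lit 35184372088832⟩, ⟨i0, i3, i3, i4, nat_lit 70368744177664⟩,
   ⟨i1, i3, i3, i4, nat_lit 140737488355328⟩, ⟨i2, i3, i4, i5, nat_lit 281474976710656⟩,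
   ⟨i1, i3, i4, i5, nat_lit 562949953421312⟩, ⟨i0, i3, i4, i5, nat_lit 1125899906842624⟩,
   ⟨i1, i3, i3, i5, nat_lit 2251799813685248⟩, ⟨i2, i3, i3, i5, nat_lit 4503599627370496⟩,
   ⟨i0, i3, i3, i5, nat_lit 9007199254740992⟩, ⟨i0, i4, i4, i6, nat_lit 18014398509481984⟩,
   ⟨i2, i4, i4, i5, nat_lit 36028797018963968⟩, ⟨i1, i4, i4, i5, nat_lit 72057594037927936⟩,
   ⟨i0, i4, i4, i5, nat_lit 144115188075855872⟩, ⟨i3, i4, i4, i6, nat_lit 288230376151711744⟩,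
   ⟨i3, i4, i4, i5, nat_lit 576460752303423488⟩, ⟨i1, i4, i4, i6, nat_lit 1152921504606846976⟩,
   ⟨i1, i4, i5, i6, nat_lit 2305843009213693952⟩, ⟨i0, i5, i5, i6, nat_lit 4611686018427387904⟩,
   ⟨i2, i4, i5, i6, nat_lit 9223372036854775808⟩, ⟨i2, i4, i4, i6, nat_lit 18446744073709551616⟩,
   ⟨i1, i5, i5, i6, nat_lit 36893488147419103232⟩, ⟨i3, i4, i5, i6, nat_lit 73786976294838206464⟩,
   ⟨i2, i5, i5, i6, nat_lit 147573952589676412928⟩, ⟨i4, i5, i5, i6, nat_lit 295147905179352825856⟩,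
   ⟨i3, i5, i5, i6, nat_lit 590295810358705651712⟩]
def prsS : List (Ix × Ix) :=
  [(i0, i2), (i0, i3), (i0, i4), (i0, i5), (i0, i6), (i1, i3), (i1, i4), (i1, i5), (i1, i6),
   (i2, i4), (i2, i5), (i2, i6), (i3, i5), (i3, i6), (i4, i6)]
def prsD : List (Ix × Ix) :=
  [(i1, i2), (i1, i3), (i1, i4), (i1, i5), (i1, i6), (i2, i3), (i2, i4), (i2, i5), (i2, i6),
   (i3, i4), (i3, i5), (i3, i6), (i4, i5), (i4, i6), (i5, i6)]
def mS : List ℕ :=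
  [nat_lit 1024, nat_lit 4460544, nat_lit 70371160162384, nat_lit 154261756355543328, nat_lit 4629718225097107972, nat_lit 2097152,
   nat_lit 140737488502784, nat_lit 74876192095731712, nat_lit 40352252699894874251, nat_lit 35184372088832, nat_lit 40813871623045120,
   nat_lit 175244068717965869056, nat_lit 576460752303423488, nat_lit 664371017029695569920, nat_lit 295147905179352825856]
def mD : List ℕ :=
  [nat_lit 1024, nat_lit 266240, nat_lit 268435536, nat_lit 100663584, nat_lit 1074833408, nat_lit 6553600, nat_lit 2147696656, nat_lit 17317308137728,
   nat_lit 151521927, nat_lit 246292752121920, nat_lit 17733748200046592, nat_lit 271129772044, nat_lit 830638153898393600,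
   nat_lit 105222119299626336384, nat_lit 1159839051295418753033]
theorem search_ok : node RELS mD mS RELS initV 16 0 1180591620717411303423 = true := by
  decide +kernel

theorem sel_true {β : Type} (t e : β) : sel true t e = t := rfl
theorem sel_false {β : Type} (t e : β) : sel false t e = e := rfl

theorem force_eq {β : Type} (n : ℕ) (K : ℕ → β) : force n K = K n := by
  cases n <;> rfl

theorem forceCol_eq {β : Type} (c : Col) (K : Col → β) : forceCol c K = K c := by
  simp only [forceCol, force_eq]

theorem forceList_eq (V : List Col) : ∀ K, forceList V K = K V := by
  induction V with
  | nil => intro K; rfl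
  | cons c cs ih =>
    intro K
    have h : forceList (c :: cs) K = forceCol c fun c' => forceList cs fun W => K (c' :: W) := rfl
    rw [h, forceCol_eq, ih]

/-- The value of the relation at a point. -/
def F (r : Rel) (x : Ix → ℚ) : ℚ := x r.i + x r.l - x r.j - x r.k

/-- `x` is a positive combination of the columns, up to translation. -/
def Rep : List Col → (Ix → ℚ) → Prop
  | [], x => ∀ i, x i = x i0
  | c :: cs, x => ∃ t : ℚ, 0 < t ∧ Rep cs (fun i => x i - t * (c.get i : ℚ))

/-- The unbalance of a column. -/
noncomputable def ub (r : Rel) (c : Col) : ℚ := (r.plus c : ℚ) - (r.minus c : ℚ)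

theorem ub_eq (r : Rel) (c : Col) : ub r c = F r (fun i => (c.get i : ℚ)) := by
  have h1 : r.plus c = c.get r.i + c.get r.l := rfl
  have h2 : r.minus c = c.get r.j + c.get r.k := rfl
  simp only [ub, F, h1, h2]; push_cast; ring

theorem F_sub (r : Rel) (x : Ix → ℚ) (t : ℚ) (c : Col) :
    F r (fun i => x i - t * (c.get i : ℚ)) = F r x - t * ub r c := by
  rw [ub_eq]; simp only [F]; ring

theorem F_const (r : Rel) (x : Ix → ℚ) (h : ∀ i, x i = x i0) : F r x = 0 := by
  simp only [F, h r.i, h r.j, h r.k, h r.l]; ring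

theorem allLe_sound (r : Rel) (V : List Col) : ∀ x, allLe r V = true → Rep V x → F r x ≤ 0 := by
  induction V with
  | nil => intro x _ h; exact (F_const r x h).le
  | cons c cs ih =>
    intro x h ⟨t, ht, hr⟩
    have e : allLe r (c :: cs) = sel (Nat.ble (r.plus c) (r.minus c)) (allLe r cs) false := rfl
    rw [e] at h
    cases hb : Nat.ble (r.plus c) (r.minus c) with
    | false => rw [hb, sel_false] at h; cases h
    | true =>
      rw [hb, sel_true] at h
      have h1 := ih _ h hr
      rw [F_sub] at h1
      have h2 : (r.plus c : ℚ) ≤ r.minus c := by exact_mod_cast Nat.le_of_ble_eq_true hb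
      have h3 : ub r c ≤ 0 := by simp only [ub]; linarith
      nlinarith

theorem allGe_sound (r : Rel) (V : List Col) : ∀ x, allGe r V = true → Rep V x → 0 ≤ F r x := by
  induction V with
  | nil => intro x _ h; exact (F_const r x h).ge
  | cons c cs ih =>
    intro x h ⟨t, ht, hr⟩
    have e : allGe r (c :: cs) = sel (Nat.ble (r.minus c) (r.plus c)) (allGe r cs) false := rfl
    rw [e] at h
    cases hb : Nat.ble (r.minus c) (r.plus c) with
    | false => rw [hb, sel_false] at h; cases h
    | true =>
      rw [hb, sel_true] at h
      have h1 := ih _ h hr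
      rw [F_sub] at h1
      have h2 : (r.minus c : ℚ) ≤ r.plus c := by exact_mod_cast Nat.le_of_ble_eq_true hb
      have h3 : 0 ≤ ub r c := by simp only [ub]; linarith
      nlinarith

theorem ub_zero {r : Rel} {c : Col} (h : Nat.beq (r.plus c) (r.minus c) = true) : ub r c = 0 := by
  simp only [ub, Nat.eq_of_beq_eq_true h]; ring

theorem isZero_sound (r : Rel) (V : List Col) : ∀ x, isZero r V = true → Rep V x → F r x = 0 := by
  induction V with
  | nil => intro x _ h; exact (F_const r x h)
  | cons c cs ih =>
    intro x h ⟨t, ht, hr⟩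
    have e : isZero r (c :: cs) = sel (Nat.beq (r.plus c) (r.minus c)) (isZero r cs) false := rfl
    rw [e] at h
    cases hb : Nat.beq (r.plus c) (r.minus c) with
    | false => rw [hb, sel_false] at h; cases h
    | true =>
      rw [hb, sel_true] at h
      have h1 := ih _ h hr
      rw [F_sub, ub_zero hb] at h1
      linarith

theorem status_sound {β : Type} (r : Rel) (z w y : β) (V : List Col) : ∀ x, Rep V x →
    (status r V z w y = z ∧ F r x = 0) ∨ (status r V z w y = w ∧ F r x ≠ 0) ∨
      status r V z w y = y := by
  induction V with
  | nil => intro x h; exact Or.inl ⟨rfl, F_const r x h⟩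
  | cons c cs ih =>
    intro x ⟨t, ht, hr⟩
    have e : status r (c :: cs) z w y = sel (Nat.beq (r.plus c) (r.minus c)) (status r cs z w y)
      (sel (Nat.ble (r.plus c) (r.minus c)) (sel (allLe r cs) w y) (sel (allGe r cs) w y)) := rfl
    rw [e]
    cases hb : Nat.beq (r.plus c) (r.minus c) with
    | true =>
      rw [sel_true]
      have h1 := ih _ hr
      rw [F_sub, ub_zero hb, mul_zero, sub_zero] at h1
      exact h1
    | false =>
      have hne : r.plus c ≠ r.minus c := Nat.ne_of_beq_eq_false hb
      rw [sel_false]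
      right
      cases hl : Nat.ble (r.plus c) (r.minus c) with
      | true =>
        rw [sel_true]
        cases ha : allLe r cs with
        | false => right; rfl
        | true =>
          left; refine ⟨rfl, ?_⟩
          have h1 := allLe_sound r cs _ ha hr
          rw [F_sub] at h1
          have h2 : (r.plus c : ℚ) < r.minus c := by
            exact_mod_cast lt_of_le_of_ne (Nat.le_of_ble_eq_true hl) hne
          have h3 : ub r c < 0 := by simp only [ub]; linarith
          have := mul_neg_of_pos_of_neg ht h3
          intro h; linarith
      | false =>
        rw [sel_false]
        cases ha : allGe r cs with
        | false => right; rfl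
        | true =>
          left; refine ⟨rfl, ?_⟩
          have h1 := allGe_sound r cs _ ha hr
          rw [F_sub] at h1
          have h2 : (r.minus c : ℚ) < r.plus c := by
            have : ¬ (r.plus c ≤ r.minus c) := fun h => by
              rw [Nat.ble_eq_true_of_le h] at hl; cases hl
            exact_mod_cast not_le.mp this
          have h3 : 0 < ub r c := by simp only [ub]; linarith
          have := mul_pos ht h3
          intro h; linarith

theorem mx_le (a b : ℕ) : a ≤ mx a b ∧ b ≤ mx a b := by
  unfold mx
  cases h : Nat.ble a b with
  | true => exact ⟨Nat.le_of_ble_eq_true h, le_rfl⟩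
  | false =>
    have : ¬ (a ≤ b) := fun h' => by rw [Nat.ble_eq_true_of_le h'] at h; cases h
    exact ⟨le_rfl, (not_le.mp this).le⟩

theorem get_le_max (c : Col) (i : Ix) : c.get i ≤ c.max := by
  have h5 := mx_le c.r5 c.r6
  have h4 := mx_le c.r4 (mx c.r5 c.r6)
  have h3 := mx_le c.r3 (mx c.r4 (mx c.r5 c.r6))
  have h2 := mx_le c.r2 (mx c.r3 (mx c.r4 (mx c.r5 c.r6)))
  have h1 := mx_le c.r1 (mx c.r2 (mx c.r3 (mx c.r4 (mx c.r5 c.r6))))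
  have h0 := mx_le c.r0 (mx c.r1 (mx c.r2 (mx c.r3 (mx c.r4 (mx c.r5 c.r6)))))
  cases i <;> simp only [Col.get, Col.max] <;> omega

theorem neg_get (c : Col) (i : Ix) : (c.neg.get i : ℚ) = (c.max : ℚ) - (c.get i : ℚ) := by
  have e : c.neg.get i = c.max - c.get i := by cases i <;> rfl
  rw [e, Nat.cast_sub (get_le_max c i)]

theorem comb_get (a : ℕ) (d : Col) (b : ℕ) (p : Col) (i : Ix) :
    ((Col.comb a d b p).get i : ℚ) = a * d.get i + b * p.get i := by
  have e : (Col.comb a d b p).get i = a * d.get i + b * p.get i := by cases i <;> rfl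
  rw [e]; push_cast; ring

theorem elimWith_sound (r : Rel) (a : ℕ) (p q q' : Col) (φ σ k k' : ℚ) (ha : 0 < a)
    (hσ : σ * σ = 1) (hφ : φ = a * σ)
    (hq : ∀ i, (q.get i : ℚ) = k - σ * p.get i) (hq' : ∀ i, (q'.get i : ℚ) = k' + σ * p.get i)
    (V : List Col) : ∀ (y z : Ix → ℚ) (k0 : ℚ), Rep V y →
      (∀ i, z i = y i - F r y * σ / a * p.get i + k0) → Rep (elimWith r a q q' V) z := by
  have ha' : (0 : ℚ) < a := by exact_mod_cast ha
  induction V with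
  | nil =>
    intro y z k0 hy hz i
    rw [hz i, hz i0, hy i, F_const r y hy]; ring
  | cons d cs ih =>
    intro y z k0 ⟨s, hs, hr⟩ hz
    have e : elimWith r a q q' (d :: cs) = sel (Nat.ble (r.plus d) (r.minus d))
        (Col.comb a d (Nat.sub (r.minus d) (r.plus d)) q')
        (Col.comb a d (Nat.sub (r.plus d) (r.minus d)) q) :: elimWith r a q q' cs := rfl
    rw [e]
    refine ⟨s / a, div_pos hs ha', ?_⟩
    cases hl : Nat.ble (r.plus d) (r.minus d) with
    | true =>
      have hle := Nat.le_of_ble_eq_true hl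
      have hu : ((Nat.sub (r.minus d) (r.plus d) : ℕ) : ℚ) = - ub r d := by
        have : ((r.minus d - r.plus d : ℕ) : ℚ) = _ := Nat.cast_sub hle
        simp only [ub]; rw [Nat.sub_eq, this]; ring
      refine ih _ _ (k0 + s * ub r d * k' / a) hr ?_
      intro i
      rw [sel_true, comb_get, hu, hq', hz, F_sub]
      field_simp
      ring
    | false =>
      have hle : r.minus d ≤ r.plus d := by
        have : ¬ (r.plus d ≤ r.minus d) := fun h => by
          rw [Nat.ble_eq_true_of_le h] at hl; cases hl
        exact (not_le.mp this).le
      have hu : ((Nat.sub (r.plus d) (r.minus d) : ℕ) : ℚ) = ub r d := by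
        have : ((r.plus d - r.minus d : ℕ) : ℚ) = _ := Nat.cast_sub hle
        simp only [ub]; rw [Nat.sub_eq, this]
      refine ih _ _ (k0 - s * ub r d * k / a) hr ?_
      intro i
      rw [sel_false, comb_get, hu, hq, hz, F_sub]
      field_simp
      ring

theorem elim_sound (r : Rel) (V : List Col) : ∀ x, Rep V x → F r x = 0 → Rep (elim r V) x := by
  induction V with
  | nil => intro x h _; exact h
  | cons p cs ih =>
    intro x ⟨t, ht, hr⟩ hF
    have e : elim r (p :: cs) = sel (Nat.beq (r.plus p) (r.minus p)) (p :: elim r cs)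
      (sel (Nat.ble (r.plus p) (r.minus p))
        (elimWith r (Nat.sub (r.minus p) (r.plus p)) p p.neg cs)
        (elimWith r (Nat.sub (r.plus p) (r.minus p)) p.neg p cs)) := rfl
    rw [e]
    cases hb : Nat.beq (r.plus p) (r.minus p) with
    | true =>
      rw [sel_true]
      refine ⟨t, ht, ih _ hr ?_⟩
      rw [F_sub, ub_zero hb, hF]; ring
    | false =>
      have hne : r.plus p ≠ r.minus p := Nat.ne_of_beq_eq_false hb
      rw [sel_false]
      cases hl : Nat.ble (r.plus p) (r.minus p) with
      | true =>
        rw [sel_true]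
        have hlt : r.plus p < r.minus p := lt_of_le_of_ne (Nat.le_of_ble_eq_true hl) hne
        have hpos : 0 < Nat.sub (r.minus p) (r.plus p) := Nat.sub_pos_of_lt hlt
        have hu : ((Nat.sub (r.minus p) (r.plus p) : ℕ) : ℚ) = - ub r p := by
          have : ((r.minus p - r.plus p : ℕ) : ℚ) = _ := Nat.cast_sub hlt.le
          simp only [ub]; rw [Nat.sub_eq, this]; ring
        have hp' : (0 : ℚ) < (Nat.sub (r.minus p) (r.plus p) : ℕ) := by exact_mod_cast hpos
        refine elimWith_sound r _ p p p.neg (ub r p) (-1) 0 p.max hpos (by norm_num)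
          (by rw [hu]; ring) (by intro i; ring) (by intro i; rw [neg_get]; ring) cs _ x 0 hr ?_
        intro i
        rw [F_sub, hF, hu]
        have : ub r p ≠ 0 := by intro h; rw [h] at hu; simp at hu; omega
        field_simp
        ring
      | false =>
        rw [sel_false]
        have hlt : r.minus p < r.plus p := by
          have : ¬ (r.plus p ≤ r.minus p) := fun h => by
            rw [Nat.ble_eq_true_of_le h] at hl; cases hl
          exact not_le.mp this
        have hpos : 0 < Nat.sub (r.plus p) (r.minus p) := Nat.sub_pos_of_lt hlt
        have hu : ((Nat.sub (r.plus p) (r.minus p) : ℕ) : ℚ) = ub r p := by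
          have : ((r.plus p - r.minus p : ℕ) : ℚ) = _ := Nat.cast_sub hlt.le
          simp only [ub]; rw [Nat.sub_eq, this]
        refine elimWith_sound r _ p p.neg p (ub r p) 1 p.max 0 hpos (by norm_num)
          (by rw [hu]; ring) (by intro i; rw [neg_get]; ring) (by intro i; ring) cs _ x 0 hr ?_
        intro i
        rw [F_sub, hF, hu]
        have : ub r p ≠ 0 := by intro h; rw [h] at hu; simp at hu; omega
        field_simp
        ring

theorem badGap_sound (gs : List Rel) (V : List Col) (x : Ix → ℚ) (hr : Rep V x)
    (hg : ∀ g ∈ gs, 0 < F g x) : badGap gs V = false := by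
  induction gs with
  | nil => rfl
  | cons g gs ih =>
    have e : badGap (g :: gs) V = sel (allLe g V) true (badGap gs V) := rfl
    rw [e]
    cases h : allLe g V with
    | true =>
      have h1 := allLe_sound g V x h hr
      have h2 := hg g (by simp)
      linarith
    | false => rw [sel_false]; exact ih fun g' h' => hg g' (by simp [h'])

/-- Well-formed list of relations. -/
def Good (R : List Rel) : Prop :=
  (∀ r ∈ R, ∃ t, r.bit = 2 ^ t) ∧ ∀ r ∈ R, ∀ r' ∈ R, r.bit = r'.bit → r = r'

def OkU (R : List Rel) (U : ℕ) (x : Ix → ℚ) : Prop :=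
  ∀ r ∈ R, F r x = 0 → ∀ t, r.bit = 2 ^ t → U.testBit t = true

def OkT (R : List Rel) (T : ℕ) (x : Ix → ℚ) : Prop :=
  ∀ t, T.testBit t = true → ∃ r ∈ R, r.bit = 2 ^ t ∧ F r x = 0

def Hit (R : List Rel) (x : Ix → ℚ) (m : ℕ) : Prop :=
  ∃ r ∈ R, ∃ t, r.bit = 2 ^ t ∧ m.testBit t = true ∧ F r x = 0

open Classical in
/-- Number of masks that are hit. -/
noncomputable def cx (R : List Rel) (x : Ix → ℚ) (L : List ℕ) : ℕ :=
  L.countP fun m => decide (Hit R x m)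

theorem okT_lor {R : List Rel} {T : ℕ} {x : Ix → ℚ} (hG : Good R) (h : OkT R T x) {r : Rel}
    (hr : r ∈ R) (hF : F r x = 0) : OkT R (Nat.lor T r.bit) x := by
  obtain ⟨t, ht⟩ := hG.1 r hr
  intro t' h'
  have h2 : (T ||| r.bit).testBit t' = true := h'
  rw [Nat.testBit_or, Bool.or_eq_true] at h2
  rcases h2 with h2 | h2
  · exact h t' h2
  · rw [ht, Nat.testBit_two_pow, decide_eq_true_eq] at h2
    subst h2
    exact ⟨r, hr, ht, hF⟩

theorem okU_xor {R : List Rel} {U : ℕ} {x : Ix → ℚ} (hG : Good R) (h : OkU R U x) {r : Rel}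
    (hr : r ∈ R) (hF : F r x ≠ 0) : OkU R (Nat.xor U r.bit) x := by
  obtain ⟨t, ht⟩ := hG.1 r hr
  intro r' hr' hF' t' ht'
  have hne : t ≠ t' := by
    rintro rfl
    exact hF (hG.2 r hr r' hr' (ht.trans ht'.symm) ▸ hF')
  change (U ^^^ r.bit).testBit t' = true
  rw [Nat.testBit_xor, h r' hr' hF' t' ht', ht, Nat.testBit_two_pow]
  simp [hne]

theorem cn_T {R : List Rel} {T : ℕ} {x : Ix → ℚ} (h : OkT R T x) (L : List ℕ) :
    cn L T ≤ cx R x L := by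
  induction L with
  | nil => exact Nat.zero_le _
  | cons m L ih =>
    have e : cn (m :: L) T =
      sel (Nat.beq (Nat.land m T) (nat_lit 0)) (cn L T) (Nat.succ (cn L T)) := rfl
    rw [e]
    simp only [cx, List.countP_cons] at ih ⊢
    cases hb : Nat.beq (Nat.land m T) (nat_lit 0) with
    | true => rw [sel_true]; omega
    | false =>
      rw [sel_false]
      have hne : m &&& T ≠ 0 := Nat.ne_of_beq_eq_false hb
      obtain ⟨t, ht⟩ := Nat.exists_testBit_of_ne_zero hne
      rw [Nat.testBit_and, Bool.and_eq_true] at ht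
      obtain ⟨r, hr, h1, h2⟩ := h t ht.2
      have : Hit R x m := ⟨r, hr, t, h1, ht.1, h2⟩
      simp only [this, decide_true, if_true]
      omega

theorem cn_U {R : List Rel} {U : ℕ} {x : Ix → ℚ} (h : OkU R U x) (L : List ℕ) :
    cx R x L ≤ cn L U := by
  induction L with
  | nil => exact Nat.zero_le _
  | cons m L ih =>
    have e : cn (m :: L) U =
      sel (Nat.beq (Nat.land m U) (nat_lit 0)) (cn L U) (Nat.succ (cn L U)) := rfl
    rw [e]
    simp only [cx, List.countP_cons] at ih ⊢
    cases hb : Nat.beq (Nat.land m U) (nat_lit 0) with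
    | false => rw [sel_false]; split <;> omega
    | true =>
      rw [sel_true]
      have h0 : m &&& U = 0 := Nat.eq_of_beq_eq_true hb
      have : ¬ Hit R x m := by
        rintro ⟨r, hr, t, h1, h2, h3⟩
        have h4 := h r hr h3 t h1
        have h5 : (m &&& U).testBit t = true := by rw [Nat.testBit_and, h2, h4]; rfl
        rw [h0] at h5; simp at h5
      simp only [this, decide_false]
      simpa using ih

theorem scan_sound {R : List Rel} (hG : Good R) (V : List Col) (K : ℕ → ℕ → Bool) (x : Ix → ℚ)
    (hx : Rep V x) (rs : List Rel) : (∀ r ∈ rs, r ∈ R) → ∀ T U, scan V K rs T U = true →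
    OkT R T x → OkU R U x → ∃ T' U', K T' U' = true ∧ OkT R T' x ∧ OkU R U' x := by
  induction rs with
  | nil => intro _ T U h hT hU; exact ⟨T, U, h, hT, hU⟩
  | cons r rs ih =>
    intro hR T U h hT hU
    have hr : r ∈ R := hR r (by simp)
    have ih' := ih fun r' h' => hR r' (by simp [h'])
    have e : scan V K (r :: rs) T U = sel (Nat.beq (Nat.land U r.bit) (nat_lit 0))
      (sel (isZero r V) true (scan V K rs T U))
      (status r V (scan V K rs (Nat.lor T r.bit) U) (scan V K rs T (Nat.xor U r.bit))
        (scan V K rs T U)) := rfl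
    rw [e] at h
    cases hb : Nat.beq (Nat.land U r.bit) (nat_lit 0) with
    | true =>
      rw [hb, sel_true] at h
      cases hz : isZero r V with
      | false => rw [hz, sel_false] at h; exact ih' T U h hT hU
      | true =>
        exfalso
        have hF := isZero_sound r V x hz hx
        obtain ⟨t, ht⟩ := hG.1 r hr
        have h4 := hU r hr hF t ht
        have h0 : U &&& r.bit = 0 := Nat.eq_of_beq_eq_true hb
        have h5 : (U &&& r.bit).testBit t = true := by
          rw [Nat.testBit_and, h4, ht, Nat.testBit_two_pow]; simp
        rw [h0] at h5; simp at h5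
    | false =>
      rw [hb, sel_false] at h
      rcases status_sound r (scan V K rs (Nat.lor T r.bit) U) (scan V K rs T (Nat.xor U r.bit))
        (scan V K rs T U) V x hx with ⟨h1, h2⟩ | ⟨h1, h2⟩ | h1
      · rw [h1] at h; exact ih' _ _ h (okT_lor hG hT hr h2) hU
      · rw [h1] at h; exact ih' _ _ h hT (okU_xor hG hU hr h2)
      · rw [h1] at h; exact ih' _ _ h hT hU

theorem node_sound {R : List Rel} (hG : Good R) (D S : List ℕ) (x : Ix → ℚ)
    (hg : ∀ g ∈ gaps, 0 < F g x) (rs : List Rel) : (∀ r ∈ rs, r ∈ R) → ∀ V s T U,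
    node R D S rs V s T U = true → Rep V x → OkT R T x → OkU R U x → s ≤ 16 + cx R x S →
    2 * cx R x D < 16 + cx R x S := by
  induction rs with
  | nil => intro _ V s T U h; cases h
  | cons r rs ih =>
    intro hR V s T U h hx hT hU hs
    have hr : r ∈ R := hR r (by simp)
    have ih' := ih fun r' h' => hR r' (by simp [h'])
    have e : node R D S (r :: rs) V s T U =
      sel (Nat.beq (Nat.land (Nat.xor U T) r.bit) (nat_lit 0)) (node R D S rs V s T U)
      (sel (forceList (elim r V) fun W => sel (badGap gaps W) true
          (scan W (fun T U => force T fun T => force U fun U =>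
            force (Nat.add (nat_lit 16) (cn S T)) fun s =>
              sel (Nat.ble s (Nat.mul (nat_lit 2) (cn D U))) (node R D S rs W s T U) true)
            R (nat_lit 0) U))
        (force (Nat.xor U r.bit) fun U =>
          sel (Nat.ble s (Nat.mul (nat_lit 2) (cn D U))) (node R D S rs V s T U) true)
        false) := rfl
    rw [e] at h
    cases hb : Nat.beq (Nat.land (Nat.xor U T) r.bit) (nat_lit 0) with
    | true => rw [hb, sel_true] at h; exact ih' V s T U h hx hT hU hs
    | false =>
      rw [hb, sel_false] at h
      simp only [forceList_eq, force_eq] at h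
      by_cases hF : F r x = 0
      · have hW := elim_sound r V x hx hF
        rw [badGap_sound gaps _ x hW hg, sel_false] at h
        cases hsc : scan (elim r V) (fun T U =>
            sel (Nat.ble (Nat.add (nat_lit 16) (cn S T)) (Nat.mul (nat_lit 2) (cn D U)))
              (node R D S rs (elim r V) (Nat.add (nat_lit 16) (cn S T)) T U) true)
            R (nat_lit 0) U with
        | false => rw [hsc, sel_false] at h; cases h
        | true =>
          have hT0 : OkT R (nat_lit 0) x := by
            intro t ht
            have ht' : Nat.testBit 0 t = true := ht
            simp at ht'
          obtain ⟨T', U', hK, hT', hU'⟩ := scan_sound hG _ _ x hW R (fun _ h => h) _ _ hsc hT0 hU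
          have h1 := cn_T hT' S
          have h2 := cn_U hU' D
          cases hc : Nat.ble (Nat.add (nat_lit 16) (cn S T')) (Nat.mul (nat_lit 2) (cn D U')) with
          | true =>
            rw [hc, sel_true] at hK
            exact ih' _ _ _ _ hK hW hT' hU' (by change 16 + cn S T' ≤ _; omega)
          | false =>
            have : ¬ (16 + cn S T' ≤ 2 * cn D U') := fun h' => by
              have := Nat.ble_eq_true_of_le h'
              rw [show Nat.ble (Nat.add (nat_lit 16) (cn S T')) (Nat.mul (nat_lit 2) (cn D U')) =
                true from this] at hc
              cases hc
            omega
      · have hU' := okU_xor hG hU hr hF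
        have h2 := cn_U hU' D
        have h3 : sel (Nat.ble s (Nat.mul (nat_lit 2) (cn D (Nat.xor U r.bit))))
            (node R D S rs V s T (Nat.xor U r.bit)) true = true := by
          revert h
          generalize sel (badGap gaps (elim r V)) _ _ = b
          cases b with
          | true => rw [sel_true]; exact id
          | false => rw [sel_false]; intro h; cases h
        cases hc : Nat.ble s (Nat.mul (nat_lit 2) (cn D (Nat.xor U r.bit))) with
        | true =>
          rw [hc, sel_true] at h3
          exact ih' _ _ _ _ h3 hx hT hU' hs
        | false =>
          have : ¬ (s ≤ 2 * cn D (Nat.xor U r.bit)) := fun h' => by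
            have := Nat.ble_eq_true_of_le h'
            rw [show Nat.ble s (Nat.mul (nat_lit 2) (cn D (Nat.xor U r.bit))) =
                true from this] at hc
            cases hc
          omega

/-- Position of an index. -/
def Ix.v : Ix → ℕ
  | i0 => 0 | i1 => 1 | i2 => 2 | i3 => 3 | i4 => 4 | i5 => 5 | i6 => 6

def SLost (a : Ix → ℤ) (p : Ix × Ix) : Prop :=
  ∃ j k : Ix, p.1.v < j.v ∧ j.v ≤ k.v ∧ k.v < p.2.v ∧ a p.1 + a p.2 = a j + a k

def DLost (a : Ix → ℤ) (p : Ix × Ix) : Prop :=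
  ∃ i j : Ix, i.v < p.1.v ∧ i.v < j.v ∧ j.v < p.2.v ∧ p.1.v < p.2.v ∧ a i + a p.2 = a j + a p.1

theorem Ix.v_inj {i j : Ix} (h : i.v = j.v) : i = j := by
  revert i j; decide

open Classical in
theorem sums_le (a : Ix → ℤ) :
    ((Finset.univ.image a + Finset.univ.image a).card) +
      (Finset.univ.filter (SLost a)).card ≤ 28 := by
  set P : Finset (Ix × Ix) := Finset.univ.filter (fun p => p.1.v ≤ p.2.v) with hP
  have hPc : P.card = 28 := by rw [hP]; decide +kernel
  set L := Finset.univ.filter (SLost a) with hL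
  have hLP : L ⊆ P := by
    intro p hp
    simp only [hL, hP, Finset.mem_filter, Finset.mem_univ, true_and] at hp ⊢
    obtain ⟨j, k, h1, h2, h3, _⟩ := hp
    omega
  have hsub : Finset.univ.image a + Finset.univ.image a ⊆
      (P \ L).image (fun p => a p.1 + a p.2) := by
    intro z hz
    obtain ⟨u, hu, w, hw, rfl⟩ := Finset.mem_add.mp hz
    obtain ⟨i, _, rfl⟩ := Finset.mem_image.mp hu
    obtain ⟨j, _, rfl⟩ := Finset.mem_image.mp hw
    have hne : (P.filter (fun p => a p.1 + a p.2 = a i + a j)).Nonempty := by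
      rcases le_total i.v j.v with h | h
      · exact ⟨(i, j), by simp [hP, h]⟩
      · exact ⟨(j, i), by simp [hP, h, add_comm]⟩
    obtain ⟨p, hp, hmin⟩ := Finset.exists_min_image _ (fun p : Ix × Ix => p.2.v - p.1.v) hne
    rw [Finset.mem_filter] at hp
    refine Finset.mem_image.mpr ⟨p, Finset.mem_sdiff.mpr ⟨hp.1, ?_⟩, hp.2⟩
    intro hpL
    simp only [hL, Finset.mem_filter, Finset.mem_univ, true_and] at hpL
    obtain ⟨j', k', h1, h2, h3, h4⟩ := hpL
    have := hmin (j', k') (by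
      simp only [hP, Finset.mem_filter, Finset.mem_univ, true_and]
      exact ⟨h2, by rw [← h4]; exact hp.2⟩)
    simp only at this
    omega
  have h1 := (Finset.card_le_card hsub).trans Finset.card_image_le
  rw [Finset.card_sdiff_of_subset hLP] at h1
  have h2 := Finset.card_le_card hLP
  omega

open Classical in
theorem le_diffs (a : Ix → ℤ) (ha : ∀ i j : Ix, i.v < j.v → a i < a j) :
    43 ≤ ((Finset.univ.image a - Finset.univ.image a).card) +
      2 * (Finset.univ.filter (DLost a)).card := by
  set P : Finset (Ix × Ix) := Finset.univ.filter (fun p => p.1.v < p.2.v) with hP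
  have hPc : P.card = 21 := by rw [hP]; decide +kernel
  set L := Finset.univ.filter (DLost a) with hL
  have hLP : L ⊆ P := by
    intro p hp
    simp only [hL, hP, Finset.mem_filter, Finset.mem_univ, true_and] at hp ⊢
    obtain ⟨j, k, h1, h2, h3, h4, _⟩ := hp
    exact h4
  set f : Ix × Ix → ℤ := fun p => a p.2 - a p.1 with hf
  have hpos : ∀ p ∈ P, 0 < f p := by
    intro p hp
    simp only [hP, Finset.mem_filter, Finset.mem_univ, true_and] at hp
    have := ha _ _ hp
    simp only [hf]; omega
  have key : ∀ p ∈ P, ∀ q ∈ P, f p = f q → p.1.v < q.1.v → q ∈ L := by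
    intro p hp q hq h hlt
    have hq1 := hq
    simp only [hP, Finset.mem_filter, Finset.mem_univ, true_and] at hp hq
    simp only [hL, Finset.mem_filter, Finset.mem_univ, true_and]
    simp only [hf] at h
    have h1 := ha _ _ hlt
    refine ⟨p.1, p.2, hlt, hp, ?_, hq, by omega⟩
    by_contra hcon
    rcases Nat.lt_or_eq_of_le (not_lt.mp hcon) with h2 | h2
    · have := ha _ _ h2; omega
    · rw [Ix.v_inj h2] at h; omega
  have hinj : Set.InjOn f ((P \ L : Finset (Ix × Ix)) : Set (Ix × Ix)) := by
    intro p hp q hq h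
    rw [Finset.mem_coe, Finset.mem_sdiff] at hp hq
    rcases lt_trichotomy p.1.v q.1.v with h1 | h1 | h1
    · exact absurd (key p hp.1 q hq.1 h h1) hq.2
    · have e1 := Ix.v_inj h1
      simp only [hf] at h
      rw [e1] at h
      have h2 : a p.2 = a q.2 := by omega
      have e2 : p.2 = q.2 := by
        apply Ix.v_inj
        rcases lt_trichotomy p.2.v q.2.v with h3 | h3 | h3
        · have := ha _ _ h3; omega
        · exact h3
        · have := ha _ _ h3; omega
      exact Prod.ext e1 e2
    · exact absurd (key q hq.1 p hp.1 h.symm h1) hp.2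
  have hmem : ∀ i j, a i - a j ∈ Finset.univ.image a - Finset.univ.image a := fun i j =>
    Finset.sub_mem_sub (Finset.mem_image_of_mem _ (Finset.mem_univ _))
      (Finset.mem_image_of_mem _ (Finset.mem_univ _))
  set N := (P \ L).image f with hN
  have hNpos : ∀ z ∈ N, 0 < z := by
    intro z hz
    obtain ⟨p, hp, rfl⟩ := Finset.mem_image.mp hz
    exact hpos p (Finset.mem_sdiff.mp hp).1
  have hNc : N.card = 21 - L.card := by
    rw [hN, Finset.card_image_of_injOn hinj, Finset.card_sdiff_of_subset hLP, hPc]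
  have hN'c : (N.image (fun z => -z)).card = 21 - L.card := by
    rw [Finset.card_image_of_injective _ neg_injective, hNc]
  have hd1 : Disjoint N (N.image (fun z => -z)) := by
    rw [Finset.disjoint_left]
    intro z hz hz'
    obtain ⟨w, hw, rfl⟩ := Finset.mem_image.mp hz'
    have := hNpos _ hz
    have := hNpos _ hw
    omega
  have h0 : (0 : ℤ) ∉ N ∪ N.image (fun z => -z) := by
    intro h
    rcases Finset.mem_union.mp h with h | h
    · exact absurd (hNpos _ h) (lt_irrefl _)
    · obtain ⟨w, hw, h⟩ := Finset.mem_image.mp h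
      have := hNpos _ hw
      omega
  have hsub : insert 0 (N ∪ N.image (fun z => -z)) ⊆
      Finset.univ.image a - Finset.univ.image a := by
    intro z hz
    rcases Finset.mem_insert.mp hz with rfl | hz
    · have := hmem i0 i0
      rwa [sub_self] at this
    · rcases Finset.mem_union.mp hz with h | h
      · obtain ⟨p, _, rfl⟩ := Finset.mem_image.mp h
        exact hmem _ _
      · obtain ⟨w, hw, rfl⟩ := Finset.mem_image.mp h
        obtain ⟨p, _, rfl⟩ := Finset.mem_image.mp hw
        have := hmem p.1 p.2
        simp only [hf, neg_sub]
        exact this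
  have h1 := Finset.card_le_card hsub
  rw [Finset.card_insert_of_notMem h0, Finset.card_union_of_disjoint hd1, hNc, hN'c] at h1
  omega

theorem bits_eq : RELS.map Rel.bit = (List.range 70).map (fun t => 2 ^ t) := by decide +kernel

theorem bit_lt {r : Rel} (hr : r ∈ RELS) : ∃ t < 70, r.bit = 2 ^ t := by
  have h : r.bit ∈ RELS.map Rel.bit := List.mem_map_of_mem hr
  rw [bits_eq] at h
  obtain ⟨t, ht, h⟩ := List.mem_map.mp h
  exact ⟨t, List.mem_range.mp ht, h.symm⟩

theorem good_RELS : Good RELS := by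
  refine ⟨fun r hr => ?_, fun r hr r' hr' h => ?_⟩
  · obtain ⟨t, _, h⟩ := bit_lt hr
    exact ⟨t, h⟩
  · have hn : (RELS.map Rel.bit).Nodup := by
      rw [bits_eq]
      exact List.nodup_range.map (Nat.pow_right_injective le_rfl)
    exact List.inj_on_of_nodup_map hn hr hr' h

theorem sound_S : ∀ q ∈ prsS.zip mS, ∀ r ∈ RELS, q.2 &&& r.bit ≠ 0 →
    (r.i = q.1.1 ∧ r.l = q.1.2) ∧ (r.i.v < r.j.v ∧ r.j.v ≤ r.k.v ∧ r.k.v < r.l.v) := by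
  decide +kernel

theorem sound_D : ∀ q ∈ prsD.zip mD, ∀ r ∈ RELS, r.l = q.1.2 → (r.j = q.1.1 ∨ r.k = q.1.1) →
    q.2 &&& r.bit ≠ 0 := by
  decide +kernel

theorem all_RELS : ∀ i j k l : Ix, i.v < j.v → j.v ≤ k.v → k.v < l.v →
    ∃ r ∈ RELS, r.i = i ∧ r.j = j ∧ r.k = k ∧ r.l = l := by
  have h : ∀ i j k l : Ix, i.v < j.v → j.v ≤ k.v → k.v < l.v →
      (i, j, k, l) ∈ RELS.map (fun r => (r.i, r.j, r.k, r.l)) := by decide +kernel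
  intro i j k l h1 h2 h3
  obtain ⟨r, hr, e⟩ := List.mem_map.mp (h i j k l h1 h2 h3)
  simp only [Prod.mk.injEq] at e
  exact ⟨r, hr, e⟩

theorem all_prsD : ∀ i k l : Ix, i.v < k.v → k.v < l.v → (k, l) ∈ prsD := by
  decide +kernel

theorem nodup_S : prsS.Nodup := by decide +kernel
theorem len_S : prsS.length = mS.length := by decide +kernel
theorem len_D : prsD.length = mD.length := by decide +kernel

theorem countP_zip_le {α β : Type} (p : α → Bool) (q : β → Bool) :
    ∀ (l : List α) (m : List β), l.length = m.length →
      (∀ z ∈ l.zip m, q z.2 = true → p z.1 = true) → m.countP q ≤ l.countP p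
  | [], [], _, _ => le_rfl
  | [], _ :: _, h, _ => by simp at h
  | _ :: _, [], h, _ => by simp at h
  | a :: l, b :: m, h, hz => by
    have ih := countP_zip_le p q l m (by simpa using h) fun z h' => hz z (by simp [h'])
    have h1 := hz (a, b) (by simp)
    simp only [List.countP_cons]
    by_cases hq : q b = true
    · simp only [hq, h1 hq, if_true]; omega
    · rw [if_neg hq]
      split <;> omega

theorem countP_zip_ge {α β : Type} (p : α → Bool) (q : β → Bool) :
    ∀ (l : List α) (m : List β), l.length = m.length →
      (∀ z ∈ l.zip m, p z.1 = true → q z.2 = true) → l.countP p ≤ m.countP q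
  | [], [], _, _ => le_rfl
  | [], _ :: _, h, _ => by simp at h
  | _ :: _, [], h, _ => by simp at h
  | a :: l, b :: m, h, hz => by
    have ih := countP_zip_ge p q l m (by simpa using h) fun z h' => hz z (by simp [h'])
    have h1 := hz (a, b) (by simp)
    simp only [List.countP_cons]
    by_cases hq : p a = true
    · simp only [hq, h1 hq, if_true]; omega
    · rw [if_neg hq]
      split <;> omega

theorem testBit_iff_land (m t : ℕ) : m &&& 2 ^ t ≠ 0 ↔ m.testBit t = true := by
  constructor
  · intro h
    obtain ⟨s, hs⟩ := Nat.exists_testBit_of_ne_zero h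
    rw [Nat.testBit_and, Bool.and_eq_true, Nat.testBit_two_pow, decide_eq_true_eq] at hs
    rw [hs.2]; exact hs.1
  · intro h h0
    have h5 : (m &&& 2 ^ t).testBit t = true := by
      rw [Nat.testBit_and, h, Nat.testBit_two_pow]; simp
    rw [h0] at h5; simp at h5

theorem F_zero_iff (a : Ix → ℤ) (r : Rel) :
    F r (fun i => (a i : ℚ)) = 0 ↔ a r.i + a r.l = a r.j + a r.k := by
  simp only [F]
  constructor
  · intro h
    have : (a r.i : ℚ) + a r.l = a r.j + a r.k := by linarith
    exact_mod_cast this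
  · intro h
    have : (a r.i : ℚ) + a r.l = a r.j + a r.k := by exact_mod_cast h
    linarith

open Classical in
theorem cS_le (a : Ix → ℤ) :
    cx RELS (fun i => (a i : ℚ)) mS ≤ (Finset.univ.filter (SLost a)).card := by
  have h1 : cx RELS (fun i => (a i : ℚ)) mS ≤ prsS.countP (fun p => decide (SLost a p)) := by
    refine countP_zip_le _ _ _ _ len_S ?_
    intro z hz h
    rw [decide_eq_true_eq] at h ⊢
    obtain ⟨r, hr, t, h1, h2, h3⟩ := h
    rw [← testBit_iff_land, ← h1] at h2
    obtain ⟨⟨e1, e2⟩, h4, h5, h6⟩ := sound_S z hz r hr h2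
    rw [F_zero_iff] at h3
    exact ⟨r.j, r.k, e1 ▸ h4, h5, e2 ▸ h6, by rw [← e1, ← e2]; exact h3⟩
  refine h1.trans ?_
  rw [List.countP_eq_length_filter,
    ← List.toFinset_card_of_nodup (nodup_S.filter _)]
  refine Finset.card_le_card fun p hp => ?_
  rw [List.mem_toFinset, List.mem_filter, decide_eq_true_eq] at hp
  simp [hp.2]

open Classical in
theorem le_cD (a : Ix → ℤ) :
    (Finset.univ.filter (DLost a)).card ≤ cx RELS (fun i => (a i : ℚ)) mD := by
  have h1 : prsD.countP (fun p => decide (DLost a p)) ≤ cx RELS (fun i => (a i : ℚ)) mD := by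
    refine countP_zip_ge _ _ _ _ len_D ?_
    intro z hz h
    rw [decide_eq_true_eq] at h ⊢
    obtain ⟨i, j, h1, h2, h3, h4, h5⟩ := h
    have : ∃ r ∈ RELS, r.l = z.1.2 ∧ (r.j = z.1.1 ∨ r.k = z.1.1) ∧
        a r.i + a r.l = a r.j + a r.k := by
      rcases le_total j.v z.1.1.v with h | h
      · obtain ⟨r, hr, e1, e2, e3, e4⟩ := all_RELS i j z.1.1 z.1.2 h2 h h4
        exact ⟨r, hr, e4, Or.inr e3, by rw [e1, e2, e3, e4]; exact h5⟩
      · obtain ⟨r, hr, e1, e2, e3, e4⟩ := all_RELS i z.1.1 j z.1.2 h1 h h3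
        exact ⟨r, hr, e4, Or.inl e2, by rw [e1, e2, e3, e4, h5, add_comm]⟩
    obtain ⟨r, hr, e1, e2, e3⟩ := this
    have h6 := sound_D z hz r hr e1 e2
    obtain ⟨t, _, ht⟩ := bit_lt hr
    rw [ht, testBit_iff_land] at h6
    exact ⟨r, hr, t, ht, h6, (F_zero_iff a r).mpr e3⟩
  refine le_trans ?_ h1
  rw [List.countP_eq_length_filter]
  refine le_trans (Finset.card_le_card (t := (prsD.filter fun p => decide (DLost a p)).toFinset)
    fun p hp => ?_) (List.toFinset_card_le _)
  simp only [Finset.mem_filter, Finset.mem_univ, true_and] at hp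
  rw [List.mem_toFinset, List.mem_filter, decide_eq_true_eq]
  refine ⟨?_, hp⟩
  obtain ⟨i, j, h1, h2, h3, h4, h5⟩ := hp
  exact all_prsD i p.1 p.2 h1 h4

theorem rep_init (x : Ix → ℚ) (hx : ∀ i j : Ix, i.v < j.v → x i < x j) : Rep initV x := by
  refine ⟨x i1 - x i0, sub_pos.mpr (hx _ _ (by decide)), x i2 - x i1,
    sub_pos.mpr (hx _ _ (by decide)), x i3 - x i2, sub_pos.mpr (hx _ _ (by decide)),
    x i4 - x i3, sub_pos.mpr (hx _ _ (by decide)), x i5 - x i4,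
    sub_pos.mpr (hx _ _ (by decide)), x i6 - x i5, sub_pos.mpr (hx _ _ (by decide)), ?_⟩
  intro i
  cases i <;> simp [Col.get] <;> ring

theorem main (a : Ix → ℤ) (ha : ∀ i j : Ix, i.v < j.v → a i < a j) :
    (Finset.univ.image a + Finset.univ.image a).card ≤
      (Finset.univ.image a - Finset.univ.image a).card := by
  have hx : ∀ i j : Ix, i.v < j.v → (fun i => (a i : ℚ)) i < (fun i => (a i : ℚ)) j :=
    fun i j h => by
      show (a i : ℚ) < (a j : ℚ)
      exact_mod_cast ha i j h
  have hg : ∀ g ∈ gaps, 0 < F g (fun i => (a i : ℚ)) := by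
    have h : ∀ g ∈ gaps, g.k = g.l ∧ g.j.v < g.i.v := by decide +kernel
    intro g hgm
    obtain ⟨h1, h2⟩ := h g hgm
    have h3 := hx _ _ h2
    simp only [F, h1] at h3 ⊢
    linarith
  have h := node_sound good_RELS mD mS _ hg RELS (fun _ h => h) _ _ _ _ search_ok
    (rep_init _ hx) (by intro t ht; simp at ht) (by
      intro r hr _ t ht
      obtain ⟨t', ht', h⟩ := bit_lt hr
      have : t = t' := Nat.pow_right_injective le_rfl (ht.symm.trans h)
      subst this
      have e : (1180591620717411303423 : ℕ) = 2 ^ 70 - 1 := by norm_num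
      rw [e, Nat.testBit_two_pow_sub_one]
      simpa using ht') (Nat.le_add_right _ _)
  have h1 := cS_le a
  have h2 := le_cD a
  have h3 := sums_le a
  have h4 := le_diffs a ha
  omega

end MSTD7

/-- There is no MSTD set of integers of size seven: every finite set `A ⊆ ℤ` with
`|A| = 7` satisfies `|A+A| ≤ |A-A|`. -/
theorem no_mstd_set_of_card_seven (A : Finset ℤ) (hA : A.card = 7) :
    (A + A).card ≤ (A - A).card := by
  have hv : ∀ i : MSTD7.Ix, i.v < 7 := by decide
  have hs : ∀ n : Fin 7, ∃ i : MSTD7.Ix, i.v = n.val := by decide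
  have key := MSTD7.main (fun i => A.orderEmbOfFin hA ⟨i.v, hv i⟩) (fun i j h =>
    (A.orderEmbOfFin hA).strictMono h)
  have himg : Finset.univ.image (fun i : MSTD7.Ix => A.orderEmbOfFin hA ⟨i.v, hv i⟩) = A := by
    ext z
    rw [Finset.mem_image]
    constructor
    · rintro ⟨i, _, rfl⟩
      exact A.orderEmbOfFin_mem hA _
    · intro hz
      have : z ∈ Set.range (A.orderEmbOfFin hA) := by
        rw [Finset.range_orderEmbOfFin]; exact hz
      obtain ⟨n, rfl⟩ := this
      obtain ⟨i, hi⟩ := hs n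
      exact ⟨i, Finset.mem_univ _, by congr 1; exact Fin.ext hi⟩
  rw [himg] at key
  exact key
end

section
/- For every integer x there exists a finite set A ⊆ {0, 1, …, 17|x|} such that |A+A| − |A−A| = x. -/
open Finset
open scoped Pointwise

set_option linter.unusedTactic false
set_option linter.unreachableTactic false

def PEven (k n : ℤ) : Prop := 0 ≤ n ∧ n ≤ 12 * k + 5 ∧
  (n % 12 = 0 ∨ n % 12 = 1 ∨ n % 12 = 3 ∨ n % 12 = 4 ∨ n % 12 = 5 ∨ n % 12 = 8)

def POdd (k n : ℤ) : Prop := 0 ≤ n ∧ n ≤ 12 * k + 2 ∧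
  (n % 12 = 0 ∨ n % 12 = 2 ∨ n % 12 = 3 ∨ n % 12 = 4 ∨ n % 12 = 7 ∨ n % 12 = 11)

lemma even_sum (k n : ℤ) (hk : 1 ≤ k) (h0 : 0 ≤ n) (h1 : n ≤ 24 * k + 10) :
    ∃ a, PEven k a ∧ PEven k (n - a) := by
  unfold PEven
  obtain ⟨q, r, hn, hr0, hr1⟩ : ∃ q r : ℤ, n = 12 * q + r ∧ 0 ≤ r ∧ r < 12 :=
    ⟨n / 12, n % 12, by omega, by omega, by omega⟩
  subst hn
  have hq : q < k ∨ q = k ∨ (k < q ∧ q < 2 * k) ∨ q = 2 * k := by omega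
  rcases hq with hq | hq | hq | hq <;> interval_cases r <;>
  first
  | omega
  | exact ⟨0, by omega⟩
  | exact ⟨1, by omega⟩
  | exact ⟨3, by omega⟩
  | exact ⟨5, by omega⟩
  | exact ⟨8, by omega⟩
  | exact ⟨12 * k, by omega⟩
  | exact ⟨12 * k + 1, by omega⟩
  | exact ⟨12 * k + 3, by omega⟩
  | exact ⟨12 * k + 4, by omega⟩
  | exact ⟨12 * k + 5, by omega⟩
  | exact ⟨12 * k - 4, by omega⟩

lemma even_diff (k n : ℤ) (hk : 1 ≤ k) (h0 : 0 ≤ n) (h1 : n ≤ 12 * k + 5) (h6 : n % 12 ≠ 6) :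
    ∃ a, PEven k a ∧ PEven k (n + a) := by
  unfold PEven
  obtain ⟨q, r, hn, hr0, hr1⟩ : ∃ q r : ℤ, n = 12 * q + r ∧ 0 ≤ r ∧ r < 12 :=
    ⟨n / 12, n % 12, by omega, by omega, by omega⟩
  subst hn
  have hq : q < k ∨ q = k := by omega
  rcases hq with hq | hq <;> interval_cases r <;>
  first
  | omega
  | exact ⟨0, by omega⟩
  | exact ⟨1, by omega⟩
  | exact ⟨3, by omega⟩
  | exact ⟨4, by omega⟩
  | exact ⟨5, by omega⟩
  | exact ⟨8, by omega⟩

lemma odd_sum (k n : ℤ) (hk : 1 ≤ k) (h0 : 0 ≤ n) (h1 : n ≤ 24 * k + 4)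
    (e1 : n ≠ 1) (e2 : n ≠ 24 * k + 3) (e3 : n ≠ 24 * k - 4) :
    ∃ a, POdd k a ∧ POdd k (n - a) := by
  unfold POdd
  obtain ⟨q, r, hn, hr0, hr1⟩ : ∃ q r : ℤ, n = 12 * q + r ∧ 0 ≤ r ∧ r < 12 :=
    ⟨n / 12, n % 12, by omega, by omega, by omega⟩
  subst hn
  have hq : q = 0 ∨ (0 < q ∧ q < k) ∨ (q = k ∧ 0 < q) ∨ (k < q ∧ q < 2 * k - 1) ∨
    (q = 2 * k - 1 ∧ k < q) ∨ q = 2 * k := by omega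
  rcases hq with hq | hq | hq | hq | hq | hq <;> interval_cases r <;>
  first
  | omega
  | exact ⟨0, by omega⟩
  | exact ⟨2, by omega⟩
  | exact ⟨3, by omega⟩
  | exact ⟨4, by omega⟩
  | exact ⟨7, by omega⟩
  | exact ⟨11, by omega⟩
  | exact ⟨12 * k, by omega⟩
  | exact ⟨12 * k + 2, by omega⟩
  | exact ⟨12 * k - 1, by omega⟩
  | exact ⟨12 * k - 5, by omega⟩
  | exact ⟨12 * k - 8, by omega⟩
  | exact ⟨12 * k - 9, by omega⟩

lemma odd_diff (k n : ℤ) (hk : 1 ≤ k) (h0 : 0 ≤ n) (h1 : n ≤ 12 * k + 2) (h6 : n % 12 ≠ 6)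
    (e1 : n ≠ 12 * k + 1) : ∃ a, POdd k a ∧ POdd k (n + a) := by
  unfold POdd
  obtain ⟨q, r, hn, hr0, hr1⟩ : ∃ q r : ℤ, n = 12 * q + r ∧ 0 ≤ r ∧ r < 12 :=
    ⟨n / 12, n % 12, by omega, by omega, by omega⟩
  subst hn
  have hq : q < k - 1 ∨ q = k - 1 ∨ q = k := by omega
  rcases hq with hq | hq | hq <;> interval_cases r <;>
  first
  | omega
  | exact ⟨0, by omega⟩
  | exact ⟨2, by omega⟩
  | exact ⟨3, by omega⟩
  | exact ⟨4, by omega⟩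
  | exact ⟨7, by omega⟩
  | exact ⟨11, by omega⟩

lemma card_six (k N : ℤ) (hk : 1 ≤ k) (h1 : 12 * k - 6 ≤ N) (h2 : N < 12 * k + 6) :
    (((Icc (-N) N).filter (fun n => n % 12 ≠ 6)).card : ℤ) = 2 * N + 1 - 2 * k := by
  have h := Finset.card_filter_add_card_filter_not (s := Icc (-N) N) (fun n : ℤ => n % 12 = 6)
  have e : (Icc (-N) N).filter (fun n : ℤ => n % 12 = 6) =
      (Ico (-k) k).image (fun j => 12 * j + 6) := by
    ext n
    simp only [mem_filter, mem_Icc, mem_image, mem_Ico]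
    constructor
    · rintro ⟨_, _⟩
      exact ⟨n / 12, by omega, by omega⟩
    · rintro ⟨j, _, rfl⟩
      omega
  rw [e, card_image_of_injective _ (fun a b hab => by have h2 : 12 * a + 6 = 12 * b + 6 := hab; omega)] at h
  simp only [Int.card_Ico, Int.card_Icc] at h
  simp only [ne_eq]
  omega

open Classical in
lemma even_case (k : ℤ) (hk : 1 ≤ k) : ∃ A : Finset ℤ, A ⊆ Icc 0 (12 * k + 5) ∧
    ((A + A).card : ℤ) - ((A - A).card : ℤ) = 2 * k := by
  have hm : ∀ n, n ∈ (Icc 0 (12 * k + 5)).filter (PEven k) ↔ PEven k n := by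
    intro n
    simp only [mem_filter, mem_Icc, PEven]
    tauto
  refine ⟨(Icc 0 (12 * k + 5)).filter (PEven k), filter_subset _ _, ?_⟩
  generalize (Icc 0 (12 * k + 5)).filter (PEven k) = A at hm
  have hs : A + A = Icc 0 (24 * k + 10) := by
    ext n
    simp only [mem_add, hm, mem_Icc]
    constructor
    · rintro ⟨a, ha, b, hb, rfl⟩
      unfold PEven at ha hb
      omega
    · rintro ⟨h0, h1⟩
      obtain ⟨a, ha, hb⟩ := even_sum k n hk h0 h1
      exact ⟨a, ha, n - a, hb, by ring⟩
  have hd : A - A = (Icc (-(12 * k + 5)) (12 * k + 5)).filter (fun n => n % 12 ≠ 6) := by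
    ext n
    simp only [mem_sub, hm, mem_Icc, mem_filter]
    constructor
    · rintro ⟨a, ⟨a1, a2, a3⟩, b, ⟨b1, b2, b3⟩, rfl⟩
      refine ⟨by omega, ?_⟩
      rcases a3 with a3 | a3 | a3 | a3 | a3 | a3 <;> omega
    · rintro ⟨⟨h0, h1⟩, h6⟩
      rcases le_total 0 n with h | h
      · obtain ⟨a, ha, hb⟩ := even_diff k n hk h h1 h6
        exact ⟨n + a, hb, a, ha, by ring⟩
      · obtain ⟨a, ha, hb⟩ := even_diff k (-n) hk (by omega) (by omega) (by omega)
        exact ⟨a, ha, -n + a, hb, by ring⟩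
  rw [hs, hd, card_six k _ hk (by omega) (by omega), Int.card_Icc]
  omega

open Classical in
lemma odd_case (k : ℤ) (hk : 1 ≤ k) : ∃ A : Finset ℤ, A ⊆ Icc 0 (12 * k + 2) ∧
    ((A + A).card : ℤ) - ((A - A).card : ℤ) = 2 * k - 1 := by
  have hm : ∀ n, n ∈ (Icc 0 (12 * k + 2)).filter (POdd k) ↔ POdd k n := by
    intro n
    simp only [mem_filter, mem_Icc, POdd]
    tauto
  refine ⟨(Icc 0 (12 * k + 2)).filter (POdd k), filter_subset _ _, ?_⟩
  generalize (Icc 0 (12 * k + 2)).filter (POdd k) = A at hm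
  have hs : A + A = Icc 0 (24 * k + 4) \ {1, 24 * k + 3, 24 * k - 4} := by
    ext n
    simp only [mem_add, hm, mem_Icc, mem_sdiff, mem_insert, mem_singleton, not_or]
    constructor
    · rintro ⟨a, ⟨a1, a2, a3⟩, b, ⟨b1, b2, b3⟩, rfl⟩
      refine ⟨by omega, by omega, by omega, ?_⟩
      rcases a3 with a3 | a3 | a3 | a3 | a3 | a3 <;> omega
    · rintro ⟨⟨h0, h1⟩, e1, e2, e3⟩
      obtain ⟨a, ha, hb⟩ := odd_sum k n hk h0 h1 e1 e2 e3
      exact ⟨a, ha, n - a, hb, by ring⟩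
  have hd : A - A = (Icc (-(12 * k + 2)) (12 * k + 2)).filter (fun n => n % 12 ≠ 6) \
      {12 * k + 1, -(12 * k + 1)} := by
    ext n
    simp only [mem_sub, hm, mem_Icc, mem_filter, mem_sdiff, mem_insert, mem_singleton, not_or]
    constructor
    · rintro ⟨a, ⟨a1, a2, a3⟩, b, ⟨b1, b2, b3⟩, rfl⟩
      refine ⟨⟨by omega, ?_⟩, by omega, by omega⟩
      rcases a3 with a3 | a3 | a3 | a3 | a3 | a3 <;> omega
    · rintro ⟨⟨⟨h0, h1⟩, h6⟩, e1, e2⟩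
      rcases le_total 0 n with h | h
      · obtain ⟨a, ha, hb⟩ := odd_diff k n hk h h1 h6 e1
        exact ⟨n + a, hb, a, ha, by ring⟩
      · obtain ⟨a, ha, hb⟩ := odd_diff k (-n) hk (by omega) (by omega) (by omega) (by omega)
        exact ⟨a, ha, -n + a, hb, by ring⟩
  have c1 : ((A + A).card : ℤ) = 24 * k + 2 := by
    have h3 : ({1, 24 * k + 3, 24 * k - 4} : Finset ℤ).card = 3 :=
      card_eq_three.2 ⟨_, _, _, by omega, by omega, by omega, rfl⟩
    have := card_sdiff_add_card_eq_card
      (s := ({1, 24 * k + 3, 24 * k - 4} : Finset ℤ)) (t := Icc 0 (24 * k + 4)) (by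
        intro n
        simp only [mem_insert, mem_singleton, mem_Icc]
        omega)
    rw [← hs, h3, Int.card_Icc] at this
    omega
  have c2 : ((A - A).card : ℤ) = 22 * k + 3 := by
    have h3 : ({12 * k + 1, -(12 * k + 1)} : Finset ℤ).card = 2 :=
      card_pair (by omega)
    have := card_sdiff_add_card_eq_card
      (s := ({12 * k + 1, -(12 * k + 1)} : Finset ℤ))
      (t := (Icc (-(12 * k + 2)) (12 * k + 2)).filter (fun n => n % 12 ≠ 6)) (by
        intro n
        simp only [mem_insert, mem_singleton, mem_Icc, mem_filter]
        omega)
    have c := card_six k (12 * k + 2) hk (by omega) (by omega)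
    rw [← hd, h3] at this
    omega
  rw [c1, c2]
  ring

lemma neg_case (m : ℤ) (hm : 1 ≤ m) : ∃ A : Finset ℤ, A ⊆ Icc 0 (2 * m + 1) ∧
    ((A + A).card : ℤ) - ((A - A).card : ℤ) = -m := by
  refine ⟨insert (2 * m + 1) (Icc 0 m), ?_, ?_⟩
  · intro n
    simp only [mem_insert, mem_Icc]
    omega
  have hs : insert (2 * m + 1) (Icc 0 m) + insert (2 * m + 1) (Icc 0 m) =
      insert (4 * m + 2) (Icc 0 (3 * m + 1)) := by
    ext n
    simp only [mem_add, mem_insert, mem_Icc]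
    constructor
    · rintro ⟨a, ha, b, hb, rfl⟩
      omega
    · intro h
      by_cases h1 : n ≤ m
      · exact ⟨0, by omega, n, by omega, by omega⟩
      by_cases h2 : n ≤ 2 * m
      · exact ⟨m, by omega, n - m, by omega, by omega⟩
      exact ⟨2 * m + 1, by omega, n - (2 * m + 1), by omega, by omega⟩
  have hd : insert (2 * m + 1) (Icc 0 m) - insert (2 * m + 1) (Icc 0 m) =
      Icc (-(2 * m + 1)) (2 * m + 1) := by
    ext n
    simp only [mem_sub, mem_insert, mem_Icc]
    constructor
    · rintro ⟨a, ha, b, hb, rfl⟩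
      omega
    · intro h
      by_cases h1 : n < -m
      · exact ⟨2 * m + 1 + n, by omega, 2 * m + 1, by omega, by omega⟩
      by_cases h2 : n < 0
      · exact ⟨0, by omega, -n, by omega, by omega⟩
      by_cases h3 : n ≤ m
      · exact ⟨n, by omega, 0, by omega, by omega⟩
      exact ⟨2 * m + 1, by omega, 2 * m + 1 - n, by omega, by omega⟩
  rw [hs, hd, card_insert_of_notMem (by simp only [mem_Icc]; omega), Int.card_Icc, Int.card_Icc]
  omega

/-- For every integer `x` there exists a finite set `A ⊆ {0, 1, …, 17|x|}` such that
`|A+A| - |A-A| = x`. -/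
theorem exists_set_with_sum_minus_diff (x : ℤ) :
    ∃ A : Finset ℤ, A ⊆ Finset.Icc 0 (17 * |x|) ∧
      ((A + A).card : ℤ) - ((A - A).card : ℤ) = x := by
  rcases lt_trichotomy x 0 with h | rfl | h
  · obtain ⟨A, hA, hc⟩ := neg_case (-x) (by omega)
    refine ⟨A, hA.trans (Icc_subset_Icc le_rfl ?_), by omega⟩
    rw [abs_of_neg h]
    omega
  · exact ⟨∅, by simp, by simp⟩
  · rw [abs_of_pos h]
    rcases Int.even_or_odd' x with ⟨k, hk | hk⟩
    · obtain ⟨A, hA, hc⟩ := even_case k (by omega)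
      exact ⟨A, hA.trans (Icc_subset_Icc le_rfl (by omega)), by omega⟩
    · obtain ⟨A, hA, hc⟩ := odd_case (k + 1) (by omega)
      exact ⟨A, hA.trans (Icc_subset_Icc le_rfl (by omega)), by omega⟩
end

section
/- Let p : ℕ → (0,1) satisfy n^{−1} = o(p(n)) and p(n) = o(1). For each n, let A be a random subset of {0,1,…,n−1} chosen according to the binomial model with parameter p(n), i.e., each k ∈ {0,…,n−1} is included in A independently with probability p(n). Then the probability that A is difference-dominated, i.e., that |A−A| > |A+A|, tends to 1 as n → ∞. -/
open Finset Filter Asymptotics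
open scoped Pointwise Classical

/-- The probability, in the binomial model with parameter `p` on `{0,…,n-1}` (each element
included independently with probability `p`), of the event `P` of random subsets. -/
noncomputable def binomProb (n : ℕ) (p : ℝ) (P : Finset ℤ → Prop) : ℝ :=
  ∑ A ∈ (Finset.Icc (0 : ℤ) ((n : ℤ) - 1)).powerset,
    if P A then p ^ A.card * (1 - p) ^ (n - A.card) else 0
/-- expectation on the binomial cube -/
noncomputable def Ex (s : Finset ℤ) (p : ℝ) (f : Finset ℤ → ℝ) : ℝ :=
  ∑ A ∈ s.powerset, p ^ A.card * (1 - p) ^ (s.card - A.card) * f A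

lemma Ex_congr {s : Finset ℤ} {p : ℝ} {f g : Finset ℤ → ℝ} (h : ∀ A, A ⊆ s → f A = g A) :
    Ex s p f = Ex s p g := by
  unfold Ex
  refine Finset.sum_congr rfl fun A hA => ?_
  rw [h A (Finset.mem_powerset.1 hA)]

lemma Ex_mono {s : Finset ℤ} {p : ℝ} (h0 : 0 ≤ p) (h1 : p ≤ 1) {f g : Finset ℤ → ℝ}
    (h : ∀ A, A ⊆ s → f A ≤ g A) : Ex s p f ≤ Ex s p g := by
  unfold Ex
  refine Finset.sum_le_sum fun A hA => ?_
  have : 0 ≤ 1 - p := by linarith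
  exact mul_le_mul_of_nonneg_left (h A (Finset.mem_powerset.1 hA)) (by positivity)

lemma Ex_add (s : Finset ℤ) (p : ℝ) (f g : Finset ℤ → ℝ) :
    Ex s p (fun A => f A + g A) = Ex s p f + Ex s p g := by
  unfold Ex
  rw [← Finset.sum_add_distrib]
  exact Finset.sum_congr rfl fun A _ => by ring

lemma Ex_mul (s : Finset ℤ) (p c : ℝ) (f : Finset ℤ → ℝ) :
    Ex s p (fun A => c * f A) = c * Ex s p f := by
  unfold Ex
  rw [Finset.mul_sum]
  exact Finset.sum_congr rfl fun A _ => by ring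

lemma Ex_sub (s : Finset ℤ) (p : ℝ) (f g : Finset ℤ → ℝ) :
    Ex s p (fun A => f A - g A) = Ex s p f - Ex s p g := by
  unfold Ex
  rw [← Finset.sum_sub_distrib]
  exact Finset.sum_congr rfl fun A _ => by ring

lemma Ex_sum {ι : Type} (t : Finset ι) (s : Finset ℤ) (p : ℝ) (f : ι → Finset ℤ → ℝ) :
    Ex s p (fun A => ∑ i ∈ t, f i A) = ∑ i ∈ t, Ex s p (f i) := by
  unfold Ex
  rw [Finset.sum_comm]
  exact Finset.sum_congr rfl fun A _ => by rw [Finset.mul_sum]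

lemma Ex_insert {s : Finset ℤ} {a : ℤ} (ha : a ∉ s) (p : ℝ) (f : Finset ℤ → ℝ) :
    Ex (insert a s) p f = (1 - p) * Ex s p f + p * Ex s p (fun A => f (insert a A)) := by
  unfold Ex
  rw [Finset.sum_powerset_insert ha, Finset.mul_sum, Finset.mul_sum]
  congr 1
  · refine Finset.sum_congr rfl fun A hA => ?_
    have hc := Finset.card_le_card (Finset.mem_powerset.1 hA)
    rw [Finset.card_insert_of_notMem ha, Nat.sub_add_comm hc, pow_succ]
    ring
  · refine Finset.sum_congr rfl fun A hA => ?_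
    have hA' := Finset.mem_powerset.1 hA
    rw [Finset.card_insert_of_notMem ha, Finset.card_insert_of_notMem (fun h => ha (hA' h)),
      Nat.add_sub_add_right, pow_succ]
    ring

lemma Ex_const (s : Finset ℤ) (p c : ℝ) : Ex s p (fun _ => c) = c := by
  induction s using Finset.induction_on with
  | empty => simp [Ex]
  | insert a s ha ih => rw [Ex_insert ha, ih]; ring

lemma Ex_nonneg {s : Finset ℤ} {p : ℝ} (h0 : 0 ≤ p) (h1 : p ≤ 1) {f : Finset ℤ → ℝ}
    (h : ∀ A, A ⊆ s → 0 ≤ f A) : 0 ≤ Ex s p f := by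
  have := Ex_mono h0 h1 (f := fun _ => 0) h
  rwa [Ex_const] at this

lemma Ex_erase {s : Finset ℤ} {a : ℤ} (ha : a ∈ s) (p : ℝ) (f : Finset ℤ → ℝ) :
    Ex s p f = (1 - p) * Ex (s.erase a) p f + p * Ex (s.erase a) p (fun A => f (insert a A)) := by
  conv_lhs => rw [← Finset.insert_erase ha]
  exact Ex_insert (Finset.notMem_erase a s) p f

lemma Ex_mem {s : Finset ℤ} {a : ℤ} (ha : a ∈ s) (p : ℝ) (f : Finset ℤ → ℝ) :
    Ex s p (fun A => if a ∈ A then f A else 0) = p * Ex s p (fun A => f (insert a A)) := by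
  rw [Ex_erase ha, Ex_erase ha p (fun A => f (insert a A))]
  have h1 : Ex (s.erase a) p (fun A => if a ∈ A then f A else 0) = 0 := by
    refine (Ex_congr fun A hA => ?_).trans (Ex_const (s.erase a) p 0)
    rw [if_neg (fun h => Finset.notMem_erase a s (hA h))]
  rw [h1]
  simp only [Finset.mem_insert_self, if_true, Finset.insert_idem]
  ring

/-- for antitone nonnegative `f` -/
lemma Ex_notMem {s : Finset ℤ} {p : ℝ} (h0 : 0 ≤ p) (h1 : p ≤ 1) (a : ℤ) {f : Finset ℤ → ℝ}
    (hf : ∀ A, 0 ≤ f A) (hanti : ∀ A B : Finset ℤ, A ⊆ B → f B ≤ f A) :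
    (1 - p) * Ex s p f ≤ Ex s p (fun A => if a ∈ A then 0 else f A) := by
  have key : Ex s p (fun A => if a ∈ A then f A else 0) ≤ p * Ex s p f := by
    by_cases ha : a ∈ s
    · rw [Ex_mem ha]
      exact mul_le_mul_of_nonneg_left
        (Ex_mono h0 h1 fun A _ => hanti _ _ (Finset.subset_insert a A)) h0
    · have : Ex s p (fun A => if a ∈ A then f A else 0) = 0 := by
        refine (Ex_congr fun A hA => ?_).trans (Ex_const s p 0)
        rw [if_neg (fun h => ha (hA h))]
      rw [this]
      exact mul_nonneg h0 (Ex_nonneg h0 h1 fun A _ => hf A)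
  have : Ex s p (fun A => if a ∈ A then 0 else f A)
      = Ex s p f - Ex s p (fun A => if a ∈ A then f A else 0) := by
    rw [← Ex_sub]
    refine Ex_congr fun A _ => ?_
    split_ifs <;> simp
  rw [this]; linarith

lemma Ex_sq_le {s : Finset ℤ} {p : ℝ} (h0 : 0 ≤ p) (h1 : p ≤ 1) (f : Finset ℤ → ℝ) :
    (Ex s p f) ^ 2 ≤ Ex s p (fun A => f A ^ 2) := by
  have h : 0 ≤ Ex s p (fun A => (f A - Ex s p f) ^ 2) := Ex_nonneg h0 h1 fun A _ => sq_nonneg _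
  have e : Ex s p (fun A => (f A - Ex s p f) ^ 2) = Ex s p (fun A => f A ^ 2) - (Ex s p f) ^ 2 := by
    have : (fun A => (f A - Ex s p f) ^ 2)
      = fun A => (f A ^ 2 - (2 * Ex s p f) * f A) + (Ex s p f) ^ 2 := by
      funext A; ring
    rw [this, Ex_add, Ex_sub, Ex_mul, Ex_const]; ring
  linarith

lemma Ex_var (s : Finset ℤ) (p : ℝ) (f : Finset ℤ → ℝ) :
    Ex s p (fun A => (f A - Ex s p f) ^ 2) = Ex s p (fun A => f A ^ 2) - (Ex s p f) ^ 2 := by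
  have : (fun A => (f A - Ex s p f) ^ 2)
      = fun A => (f A ^ 2 - (2 * Ex s p f) * f A) + (Ex s p f) ^ 2 := by
    funext A; ring
  rw [this, Ex_add, Ex_sub, Ex_mul, Ex_const]; ring

/-- Efron–Stein -/
lemma efron_stein {p : ℝ} (h0 : 0 ≤ p) (h1 : p ≤ 1) (s : Finset ℤ) : ∀ f : Finset ℤ → ℝ,
    Ex s p (fun A => f A ^ 2) - (Ex s p f) ^ 2 ≤
      p * (1 - p) * ∑ i ∈ s, Ex s p (fun A => (f (insert i A) - f (A.erase i)) ^ 2) := by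
  induction s using Finset.induction_on with
  | empty => intro f; simp [Ex]
  | insert a s ha ih =>
    intro f
    rw [Finset.sum_insert ha]
    have e1 : Ex (insert a s) p (fun A => (f (insert a A) - f (A.erase a)) ^ 2)
        = Ex s p (fun A => (f (insert a A) - f A) ^ 2) := by
      rw [Ex_insert ha]
      have x1 : Ex s p (fun A => (f (insert a A) - f (A.erase a)) ^ 2)
        = Ex s p (fun A => (f (insert a A) - f A) ^ 2) := by
        refine Ex_congr fun A hA => ?_
        rw [Finset.erase_eq_of_notMem (fun h => ha (hA h))]
      have x2 : Ex s p (fun A => (f (insert a (insert a A)) - f ((insert a A).erase a)) ^ 2)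
        = Ex s p (fun A => (f (insert a A) - f A) ^ 2) := by
        refine Ex_congr fun A hA => ?_
        rw [Finset.erase_insert (fun h => ha (hA h)), Finset.insert_idem]
      rw [x1, x2]; ring
    have e2 : ∑ i ∈ s, Ex (insert a s) p (fun A => (f (insert i A) - f (A.erase i)) ^ 2)
        = (1 - p) * ∑ i ∈ s, Ex s p (fun A => (f (insert i A) - f (A.erase i)) ^ 2)
          + p * ∑ i ∈ s, Ex s p (fun A => ((fun B => f (insert a B)) (insert i A)
              - (fun B => f (insert a B)) (A.erase i)) ^ 2) := by
      rw [Finset.mul_sum, Finset.mul_sum, ← Finset.sum_add_distrib]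
      refine Finset.sum_congr rfl fun i hi => ?_
      rw [Ex_insert ha]
      congr 2
      refine Ex_congr fun A hA => ?_
      have hne : a ≠ i := fun h => ha (h ▸ hi)
      rw [Finset.insert_comm, Finset.erase_insert_of_ne hne]
    rw [e1, e2, Ex_insert ha, Ex_insert ha]
    have i0 := ih f
    have i1 := ih (fun B => f (insert a B))
    have i2 := Ex_sq_le (s := s) h0 h1 (fun A => f (insert a A) - f A)
    rw [Ex_sub] at i2
    have hq : 0 ≤ 1 - p := by linarith
    have hpq : 0 ≤ p * (1 - p) := mul_nonneg h0 hq
    have j0 := mul_le_mul_of_nonneg_left i0 hq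
    have j1 := mul_le_mul_of_nonneg_left i1 h0
    have j2 := mul_le_mul_of_nonneg_left i2 hpq
    nlinarith [j0, j1, j2]
lemma Ex_mem2 {s : Finset ℤ} {a b : ℤ} (ha : a ∈ s) (hb : b ∈ s) (hab : a ≠ b) (p : ℝ)
    (f : Finset ℤ → ℝ) :
    Ex s p (fun A => if a ∈ A ∧ b ∈ A then f A else 0)
      = p ^ 2 * Ex s p (fun A => f (insert a (insert b A))) := by
  have e1 : Ex s p (fun A => if a ∈ A ∧ b ∈ A then f A else 0)
      = Ex s p (fun A => if a ∈ A then (fun B => if b ∈ B then f B else 0) A else 0) := by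
    refine Ex_congr fun A _ => ?_
    by_cases h1 : a ∈ A <;> by_cases h2 : b ∈ A <;> simp [h1, h2]
  have e2 : Ex s p (fun A => (fun B => if b ∈ B then f B else 0) (insert a A))
      = Ex s p (fun A => if b ∈ A then (fun B => f (insert a B)) A else 0) := by
    refine Ex_congr fun A _ => ?_
    simp [Finset.mem_insert, hab.symm]
  rw [e1, Ex_mem ha, e2, Ex_mem hb]
  ring

/-- indicator that none of the first `r` pairs lies in `A` -/
noncomputable def np (x y : ℕ → ℤ) (r : ℕ) (A : Finset ℤ) : ℝ :=
  if ∀ i < r, ¬ (x i ∈ A ∧ y i ∈ A) then 1 else 0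

lemma np_nonneg (x y : ℕ → ℤ) (r : ℕ) (A : Finset ℤ) : 0 ≤ np x y r A := by
  unfold np; split_ifs <;> norm_num

lemma np_anti (x y : ℕ → ℤ) (r : ℕ) (A B : Finset ℤ) (h : A ⊆ B) :
    np x y r B ≤ np x y r A := by
  unfold np
  split_ifs with h1 h2
  · exact le_refl _
  · exact absurd (fun i hi hh => h1 i hi ⟨h hh.1, h hh.2⟩) h2
  · norm_num
  · exact le_refl _

lemma np_succ (x y : ℕ → ℤ) (r : ℕ) (s : Finset ℤ) (p : ℝ) (hx : x r ∈ s) (hy : y r ∈ s)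
    (hxy : x r ≠ y r) :
    Ex s p (np x y (r + 1)) = Ex s p (np x y r)
      - p ^ 2 * Ex s p (fun A => np x y r (insert (x r) (insert (y r) A))) := by
  rw [← Ex_mem2 hx hy hxy, ← Ex_sub]
  refine Ex_congr fun A _ => ?_
  unfold np
  simp only [Nat.lt_succ_iff_lt_or_eq, or_imp, forall_and, forall_eq]
  by_cases h1 : ∀ i < r, ¬ (x i ∈ A ∧ y i ∈ A) <;> by_cases h2 : x r ∈ A ∧ y r ∈ A <;>
    simp only [h1, h2] <;> simp

lemma np_lower {s : Finset ℤ} {p : ℝ} (h0 : 0 ≤ p) (h1 : p ≤ 1) (x y : ℕ → ℤ) (r : ℕ)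
    (h : ∀ i < r, x i ∈ s ∧ y i ∈ s ∧ x i ≠ y i) :
    (1 - p ^ 2) ^ r ≤ Ex s p (np x y r) := by
  induction r with
  | zero => 
    have : Ex s p (np x y 0) = 1 := by
      refine (Ex_congr fun A _ => ?_).trans (Ex_const s p 1)
      simp [np]
    rw [this]; simp
  | succ r ih =>
    obtain ⟨a, b, c⟩ := h r (by omega)
    rw [np_succ x y r s p a b c]
    have ih' := ih fun i hi => h i (by omega)
    have hm : Ex s p (fun A => np x y r (insert (x r) (insert (y r) A))) ≤ Ex s p (np x y r) :=
      Ex_mono h0 h1 fun A _ => np_anti _ _ _ _ _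
        ((Finset.subset_insert _ _).trans (Finset.subset_insert _ _))
    have hp2 : 0 ≤ 1 - p ^ 2 := by nlinarith
    have := mul_le_mul_of_nonneg_left hm (sq_nonneg p)
    have := mul_le_mul_of_nonneg_left ih' hp2
    rw [pow_succ (1 - p ^ 2) r]; nlinarith

noncomputable def ms (A : Finset ℤ) (k : ℤ) : ℝ := if k ∈ A + A then 0 else 1
noncomputable def md (A : Finset ℤ) (k : ℤ) : ℝ := if k ∈ A - A then 0 else 1

lemma ms_lower_aux {s : Finset ℤ} {p : ℝ} (h0 : 0 ≤ p) (h1 : p ≤ 1) (x y : ℕ → ℤ) (r : ℕ)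
    (h : ∀ i < r, x i ∈ s ∧ y i ∈ s ∧ x i ≠ y i) (c k : ℤ)
    (H : ∀ A, A ⊆ s → c ∉ A → (∀ i < r, ¬ (x i ∈ A ∧ y i ∈ A)) → k ∉ A + A) :
    (1 - p) * (1 - p ^ 2) ^ r ≤ Ex s p (fun A => ms A k) := by
  have hq : 0 ≤ 1 - p := by linarith
  refine (mul_le_mul_of_nonneg_left (np_lower h0 h1 x y r h) hq).trans ?_
  refine (Ex_notMem h0 h1 c (np_nonneg x y r) (np_anti x y r)).trans ?_
  refine Ex_mono h0 h1 fun A hA => ?_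
  unfold np ms
  by_cases h1 : c ∈ A
  · simp only [h1, if_true]; split_ifs <;> norm_num
  · by_cases h2 : ∀ i < r, ¬ (x i ∈ A ∧ y i ∈ A)
    · rw [if_neg (H A hA h1 h2)]
      split_ifs <;> norm_num
    · rw [if_neg h1, if_neg h2]; split_ifs <;> norm_num

lemma ms_lower {N j : ℕ} (hj : j ≤ N) {p : ℝ} (h0 : 0 ≤ p) (h1 : p ≤ 1) :
    (1 - p) * (1 - p ^ 2) ^ ((j + 1) / 2) ≤ Ex (Finset.Icc 0 (N : ℤ)) p (fun A => ms A j) := by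
  refine ms_lower_aux h0 h1 (fun i => (i : ℤ)) (fun i => (j : ℤ) - i) _ ?_ ((j : ℤ) / 2) _ ?_
  · intro i hi
    simp only [Finset.mem_Icc]
    omega
  · intro A hA hc hi hmem
    obtain ⟨a, ha, b, hb, hab⟩ := Finset.mem_add.1 hmem
    have ha' := Finset.mem_Icc.1 (hA ha)
    have hb' := Finset.mem_Icc.1 (hA hb)
    rcases lt_trichotomy a b with h | h | h
    · refine hi a.toNat (by omega) ⟨?_, ?_⟩
      · have : ((a.toNat : ℕ) : ℤ) = a := by omega
        simpa only [this] using ha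
      · have : (j : ℤ) - ((a.toNat : ℕ) : ℤ) = b := by omega
        simpa only [this] using hb
    · apply hc
      have : (j : ℤ) / 2 = a := by omega
      rwa [this]
    · refine hi b.toNat (by omega) ⟨?_, ?_⟩
      · have : ((b.toNat : ℕ) : ℤ) = b := by omega
        simpa only [this] using hb
      · have : (j : ℤ) - ((b.toNat : ℕ) : ℤ) = a := by omega
        simpa only [this] using ha

lemma ms_lower' {N j : ℕ} (hj : j ≤ N) {p : ℝ} (h0 : 0 ≤ p) (h1 : p ≤ 1) :
    (1 - p) * (1 - p ^ 2) ^ ((j + 1) / 2) ≤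
      Ex (Finset.Icc 0 (N : ℤ)) p (fun A => ms A (2 * N - j)) := by
  refine ms_lower_aux h0 h1 (fun i => (N : ℤ) - i) (fun i => (N : ℤ) - j + i) _ ?_
    ((N : ℤ) - (j : ℤ) / 2) _ ?_
  · intro i hi
    simp only [Finset.mem_Icc]
    omega
  · intro A hA hc hi hmem
    obtain ⟨a, ha, b, hb, hab⟩ := Finset.mem_add.1 hmem
    have ha' := Finset.mem_Icc.1 (hA ha)
    have hb' := Finset.mem_Icc.1 (hA hb)
    rcases lt_trichotomy b a with h | h | h
    · refine hi (N - a).toNat (by omega) ⟨?_, ?_⟩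
      · have : (N : ℤ) - (((N - a).toNat : ℕ) : ℤ) = a := by omega
        simpa only [this] using ha
      · have : (N : ℤ) - j + (((N - a).toNat : ℕ) : ℤ) = b := by omega
        simpa only [this] using hb
    · apply hc
      have : (N : ℤ) - (j : ℤ) / 2 = a := by omega
      rwa [this]
    · refine hi (N - b).toNat (by omega) ⟨?_, ?_⟩
      · have : (N : ℤ) - (((N - b).toNat : ℕ) : ℤ) = b := by omega
        simpa only [this] using hb
      · have : (N : ℤ) - j + (((N - b).toNat : ℕ) : ℤ) = a := by omega
        simpa only [this] using ha

lemma md_upper_aux {N d : ℕ} (hd : 0 < d) {p : ℝ} (h0 : 0 ≤ p) (h1 : p ≤ 1) (r : ℕ)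
    (hr : r + d ≤ N + 1) :
    Ex (Finset.Icc 0 (N : ℤ)) p (np (fun i => (i : ℤ)) (fun i => (i : ℤ) + d) r)
      ≤ (1 - p ^ 2 * (1 - p)) ^ r := by
  induction r with
  | zero =>
    have : Ex (Finset.Icc 0 (N : ℤ)) p (np (fun i => (i : ℤ)) (fun i => (i : ℤ) + d) 0) = 1 := by
      refine (Ex_congr fun A _ => ?_).trans (Ex_const _ p 1)
      simp [np]
    rw [this]; simp
  | succ r ih =>
    have ih' := ih (by omega)
    rw [np_succ _ _ r _ p (by simp only [Finset.mem_Icc]; omega)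
      (by simp only [Finset.mem_Icc]; omega) (by simp only [ne_eq]; omega)]
    set f := np (fun i => (i : ℤ)) (fun i => (i : ℤ) + d) r with hf
    have key : (1 - p) * Ex (Finset.Icc 0 (N : ℤ)) p f ≤
        Ex (Finset.Icc 0 (N : ℤ)) p
          (fun A => f (insert ((r : ℕ) : ℤ) (insert (((r : ℕ) : ℤ) + d) A))) := by
      refine (Ex_notMem h0 h1 ((r : ℤ) - d) (np_nonneg _ _ r) (np_anti _ _ r)).trans ?_
      refine Ex_mono h0 h1 fun A hA => ?_
      by_cases h1 : (r : ℤ) - d ∈ A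
      · rw [if_pos h1]; exact np_nonneg _ _ _ _
      · rw [if_neg h1]
        by_cases h2 : ∀ i < r, ¬ ((i : ℤ) ∈ A ∧ (i : ℤ) + d ∈ A)
        · have h3 : ∀ i < r, ¬ ((i : ℤ) ∈ insert ((r : ℕ) : ℤ) (insert (((r : ℕ) : ℤ) + d) A)
              ∧ (i : ℤ) + d ∈ insert ((r : ℕ) : ℤ) (insert (((r : ℕ) : ℤ) + d) A)) := by
            rintro i hi ⟨u, v⟩
            simp only [Finset.mem_insert] at u v
            have u' : (i : ℤ) ∈ A := by
              rcases u with u | u | u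
              · omega
              · omega
              · exact u
            rcases v with v | v | v
            · apply h1
              have : (r : ℤ) - d = i := by omega
              rwa [this]
            · omega
            · exact h2 i hi ⟨u', v⟩
          rw [hf]; unfold np
          rw [if_pos h3, if_pos h2]
        · have : f A = 0 := by rw [hf]; unfold np; rw [if_neg h2]
          rw [hf] at this
          rw [this]; exact np_nonneg _ _ _ _
    have hq : 0 ≤ 1 - p := by linarith
    have hp2 : 0 ≤ 1 - p ^ 2 * (1 - p) := by nlinarith [sq_nonneg p, mul_nonneg (sq_nonneg p) h0]
    have := mul_le_mul_of_nonneg_left key (sq_nonneg p)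
    have := mul_le_mul_of_nonneg_left ih' hp2
    rw [pow_succ (1 - p ^ 2 * (1 - p)) r]; nlinarith

lemma md_upper {N j : ℕ} (hj : j < N) {p : ℝ} (h0 : 0 ≤ p) (h1 : p ≤ 1) :
    Ex (Finset.Icc 0 (N : ℤ)) p (fun A => md A (N - j)) ≤ (1 - p ^ 2 * (1 - p)) ^ (j + 1) := by
  refine le_trans ?_ (md_upper_aux (N := N) (d := N - j) (by omega) h0 h1 (j + 1) (by omega))
  refine Ex_mono h0 h1 fun A hA => ?_
  unfold md np
  by_cases h : (N : ℤ) - j ∈ A - A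
  · rw [if_pos h]; split_ifs <;> norm_num
  · rw [if_neg h, if_pos]
    rintro i hi ⟨u, v⟩
    apply h
    refine Finset.mem_sub.2 ⟨_, v, _, u, ?_⟩
    have : ((N - j : ℕ) : ℤ) = N - j := by omega
    rw [this]; ring
noncomputable def FF (N M : ℕ) (A : Finset ℤ) : ℝ :=
  ∑ j ∈ Finset.range M, (ms A (j : ℤ) + ms A (2 * N - j) - 2 * md A (N - j))

lemma ms_anti {A B : Finset ℤ} (h : A ⊆ B) (k : ℤ) : ms B k ≤ ms A k := by
  unfold ms
  split_ifs with h1 h2 h2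
  · exact le_refl _
  · norm_num
  · exact absurd (Finset.add_subset_add h h h2) h1
  · exact le_refl _

lemma md_anti {A B : Finset ℤ} (h : A ⊆ B) (k : ℤ) : md B k ≤ md A k := by
  unfold md
  split_ifs with h1 h2 h2
  · exact le_refl _
  · norm_num
  · exact absurd (Finset.sub_subset_sub h h h2) h1
  · exact le_refl _

lemma ms_diff {A B : Finset ℤ} {k : ℤ} {Q : Prop} [Decidable Q] (h : k ∈ B + B → k ∉ A + A → Q) :
    ms A k - ms B k ≤ if Q then 1 else 0 := by
  unfold ms
  by_cases h1 : k ∈ B + B <;> by_cases h2 : k ∈ A + A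
  · rw [if_pos h1, if_pos h2]; split_ifs <;> norm_num
  · rw [if_pos (h h1 h2), if_pos h1, if_neg h2]; norm_num
  · rw [if_neg h1, if_pos h2]; split_ifs <;> norm_num
  · rw [if_neg h1, if_neg h2]; split_ifs <;> norm_num

lemma md_diff {A B : Finset ℤ} {k : ℤ} {Q R : Prop} [Decidable Q] [Decidable R] (h : k ∈ B - B → k ∉ A - A → Q ∨ R) :
    md A k - md B k ≤ (if Q then 1 else 0) + (if R then 1 else 0) := by
  unfold md
  by_cases h1 : k ∈ B - B <;> by_cases h2 : k ∈ A - A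
  · rw [if_pos h1, if_pos h2]; split_ifs <;> norm_num
  · rw [if_pos h1, if_neg h2]
    rcases h h1 h2 with h | h
    · rw [if_pos h]; split_ifs <;> norm_num
    · rw [if_pos h]; split_ifs <;> norm_num
  · rw [if_neg h1, if_pos h2]; split_ifs <;> norm_num
  · rw [if_neg h1, if_neg h2]; split_ifs <;> norm_num

lemma cnt_le (M : ℕ) (φ : ℕ → ℤ) (hφ : Function.Injective φ) (T : Finset ℤ) :
    ∑ j ∈ Finset.range M, (if φ j ∈ T then (1 : ℝ) else 0) ≤ T.card := by
  rw [Finset.sum_boole]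
  exact_mod_cast Finset.card_le_card_of_injOn φ (fun j hj => (Finset.mem_filter.1 hj).2)
    (fun a _ b _ h => hφ h)

def lo (M : ℕ) (A : Finset ℤ) : Finset ℤ := A.filter (fun x => x < M)
def hi (N M : ℕ) (A : Finset ℤ) : Finset ℤ := A.filter (fun x => (N : ℤ) < x + M)
def U (N M : ℕ) (i : ℤ) : Prop := i < M ∨ (N : ℤ) < i + M

lemma FF_diff {N M : ℕ} {B : Finset ℤ} {i : ℤ} (hC : insert i B ⊆ Finset.Icc 0 (N : ℤ)) :
    (FF N M (insert i B) - FF N M B) ^ 2 ≤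
      if U N M i then
        4 * (((lo M (insert i B)).card : ℝ) + ((hi N M (insert i B)).card : ℝ)) ^ 2 else 0 := by
  set C := insert i B with hCdef
  have hBC : B ⊆ C := Finset.subset_insert i B
  have hmem : ∀ x ∈ C, 0 ≤ x ∧ x ≤ N := fun x hx => Finset.mem_Icc.1 (hC hx)
  have hiC : i ∈ C := Finset.mem_insert_self i B
  have hi0 := hmem i hiC
  have hcase : ∀ x ∈ C, x = i ∨ x ∈ B := fun x hx => Finset.mem_insert.1 hx
  set Tl : Finset ℤ := if U N M i then lo M C else ∅ with hTl
  set Th : Finset ℤ := if U N M i then hi N M C else ∅ with hTh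
  have mTl : ∀ x, x ∈ C → x < M → U N M i → x ∈ Tl := by
    intro x h1 h2 h3
    rw [hTl, if_pos h3]; exact Finset.mem_filter.2 ⟨h1, h2⟩
  have mTh : ∀ x, x ∈ C → (N : ℤ) < x + M → U N M i → x ∈ Th := by
    intro x h1 h2 h3
    rw [hTh, if_pos h3]; exact Finset.mem_filter.2 ⟨h1, h2⟩
  have s1 : ∑ j ∈ Finset.range M, (ms B (j : ℤ) - ms C j) ≤ Tl.card := by
    refine le_trans (Finset.sum_le_sum fun j hj => ?_)
      (cnt_le M (fun j => (j : ℤ) - i) (fun a b h => by simpa using h) Tl)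
    have hj' := Finset.mem_range.1 hj
    refine ms_diff fun h1 h2 => ?_
    obtain ⟨a, ha, b, hb, hab⟩ := Finset.mem_add.1 h1
    have ha0 := hmem a ha
    have hb0 := hmem b hb
    rcases hcase a ha with e | e
    · have : (j : ℤ) - i = b := by omega
      simp only [this]
      exact mTl b hb (by omega) (Or.inl (by omega))
    · rcases hcase b hb with e' | e'
      · have : (j : ℤ) - i = a := by omega
        simp only [this]
        exact mTl a ha (by omega) (Or.inl (by omega))
      · exact absurd (Finset.mem_add.2 ⟨a, e, b, e', hab⟩) h2
  have s2 : ∑ j ∈ Finset.range M, (ms B (2 * N - j : ℤ) - ms C (2 * N - j)) ≤ Th.card := by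
    refine le_trans (Finset.sum_le_sum fun j hj => ?_)
      (cnt_le M (fun j => 2 * (N : ℤ) - j - i) (fun a b h => by simpa using h) Th)
    have hj' := Finset.mem_range.1 hj
    refine ms_diff fun h1 h2 => ?_
    obtain ⟨a, ha, b, hb, hab⟩ := Finset.mem_add.1 h1
    have ha0 := hmem a ha
    have hb0 := hmem b hb
    rcases hcase a ha with e | e
    · have : 2 * (N : ℤ) - (j : ℤ) - i = b := by omega
      simp only [this]
      exact mTh b hb (by omega) (Or.inr (by omega))
    · rcases hcase b hb with e' | e'
      · have : 2 * (N : ℤ) - (j : ℤ) - i = a := by omega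
        simp only [this]
        exact mTh a ha (by omega) (Or.inr (by omega))
      · exact absurd (Finset.mem_add.2 ⟨a, e, b, e', hab⟩) h2
  have s3 : ∑ j ∈ Finset.range M, (md B (N - j : ℤ) - md C (N - j)) ≤ Tl.card + Th.card := by
    refine le_trans ?_ (add_le_add
      (cnt_le M (fun j => i - ((N : ℤ) - j)) (fun a b h => by simpa using h) Tl)
      (cnt_le M (fun j => i + ((N : ℤ) - j)) (fun a b h => by simpa using h) Th))
    rw [← Finset.sum_add_distrib]
    refine Finset.sum_le_sum fun j hj => ?_
    have hj' := Finset.mem_range.1 hj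
    refine md_diff fun h1 h2 => ?_
    obtain ⟨a, ha, b, hb, hab⟩ := Finset.mem_sub.1 h1
    have ha0 := hmem a ha
    have hb0 := hmem b hb
    rcases hcase a ha with e | e
    · left
      have : i - ((N : ℤ) - (j : ℤ)) = b := by omega
      simp only [this]
      exact mTl b hb (by omega) (Or.inr (by omega))
    · rcases hcase b hb with e' | e'
      · right
        have : i + ((N : ℤ) - (j : ℤ)) = a := by omega
        simp only [this]
        exact mTh a ha (by omega) (Or.inl (by omega))
      · exact absurd (Finset.mem_sub.2 ⟨a, e, b, e', hab⟩) h2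
  have p1 : 0 ≤ ∑ j ∈ Finset.range M, (ms B (j : ℤ) - ms C j) :=
    Finset.sum_nonneg fun j _ => sub_nonneg.2 (ms_anti hBC _)
  have p2 : 0 ≤ ∑ j ∈ Finset.range M, (ms B (2 * N - j : ℤ) - ms C (2 * N - j)) :=
    Finset.sum_nonneg fun j _ => sub_nonneg.2 (ms_anti hBC _)
  have p3 : 0 ≤ ∑ j ∈ Finset.range M, (md B (N - j : ℤ) - md C (N - j)) :=
    Finset.sum_nonneg fun j _ => sub_nonneg.2 (md_anti hBC _)
  have e : FF N M C - FF N M B =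
      2 * ∑ j ∈ Finset.range M, (md B (N - j : ℤ) - md C (N - j))
      - ∑ j ∈ Finset.range M, (ms B (j : ℤ) - ms C j)
      - ∑ j ∈ Finset.range M, (ms B (2 * N - j : ℤ) - ms C (2 * N - j)) := by
    unfold FF
    rw [Finset.mul_sum, ← Finset.sum_sub_distrib, ← Finset.sum_sub_distrib,
      ← Finset.sum_sub_distrib]
    exact Finset.sum_congr rfl fun j _ => by ring
  have bd : (FF N M C - FF N M B) ^ 2 ≤ (2 * ((Tl.card : ℝ) + Th.card)) ^ 2 := by
    apply sq_le_sq'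
    · rw [e]; linarith
    · rw [e]; linarith
  refine bd.trans ?_
  by_cases hU : U N M i
  · rw [hTl, hTh, if_pos hU, if_pos hU, if_pos hU]
    apply le_of_eq; ring
  · rw [hTl, hTh, if_neg hU, if_neg hU, if_neg hU]
    simp

lemma Ex_card_sq {s : Finset ℤ} {p : ℝ} (h0 : 0 ≤ p) (P : ℤ → Prop) [DecidablePred P]
    (M : ℕ) (hM : (s.filter P).card ≤ M) :
    Ex s p (fun A => ((A.filter P).card : ℝ) ^ 2) ≤ M * p + (M * p) ^ 2 := by
  set T := s.filter P with hT
  have e1 : Ex s p (fun A => ((A.filter P).card : ℝ) ^ 2)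
      = Ex s p (fun A => ∑ a ∈ T, ∑ b ∈ T, if a ∈ A ∧ b ∈ A then 1 else 0) := by
    refine Ex_congr fun A hA => ?_
    have : ((A.filter P).card : ℝ) = ∑ a ∈ T, if a ∈ A then 1 else 0 := by
      rw [Finset.sum_boole]
      congr 2
      ext x
      simp only [hT, Finset.mem_filter]
      exact ⟨fun h => ⟨⟨hA h.1, h.2⟩, h.1⟩, fun h => ⟨h.2, h.1.2⟩⟩
    rw [this, sq, Finset.sum_mul_sum]
    refine Finset.sum_congr rfl fun a _ => Finset.sum_congr rfl fun b _ => ?_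
    by_cases h1 : a ∈ A <;> by_cases h2 : b ∈ A <;> simp [h1, h2]
  rw [e1, Ex_sum]
  have e2 : ∀ a ∈ T, Ex s p (fun A => ∑ b ∈ T, if a ∈ A ∧ b ∈ A then (1 : ℝ) else 0)
      ≤ T.card * p ^ 2 + p := by
    intro a ha
    rw [Ex_sum]
    have : ∀ b ∈ T, Ex s p (fun A => if a ∈ A ∧ b ∈ A then (1 : ℝ) else 0)
        ≤ p ^ 2 + if a = b then p else 0 := by
      intro b hb
      have has : a ∈ s := (Finset.mem_filter.1 ha).1
      have hbs : b ∈ s := (Finset.mem_filter.1 hb).1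
      by_cases hab : a = b
      · subst hab
        simp only [and_self, if_true]
        rw [Ex_mem has p (fun _ => 1), Ex_const]
        nlinarith [sq_nonneg p]
      · rw [Ex_mem2 has hbs hab p (fun _ => 1), Ex_const, if_neg hab]; simp
    refine (Finset.sum_le_sum this).trans ?_
    rw [Finset.sum_add_distrib, Finset.sum_const, Finset.sum_ite_eq, if_pos ha, nsmul_eq_mul]
  refine (Finset.sum_le_sum e2).trans ?_
  rw [Finset.sum_const, nsmul_eq_mul]
  have hM' : (T.card : ℝ) ≤ M := by exact_mod_cast hM
  have h3 : (0 : ℝ) ≤ T.card := by positivity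
  have h4 : (T.card : ℝ) ^ 2 ≤ (M : ℝ) ^ 2 := by gcongr
  nlinarith [mul_le_mul_of_nonneg_right hM' h0, mul_le_mul_of_nonneg_right h4 (sq_nonneg p)]

lemma card_lo (N M : ℕ) : ((Finset.Icc 0 (N : ℤ)).filter (fun x : ℤ => x < M)).card ≤ M := by
  have : (Finset.Icc 0 (N : ℤ)).filter (fun x : ℤ => x < M) ⊆ Finset.Ico 0 (M : ℤ) := by
    intro x hx
    simp only [Finset.mem_filter, Finset.mem_Icc, Finset.mem_Ico] at *
    omega
  simpa using Finset.card_le_card this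

lemma card_hi (N M : ℕ) :
    ((Finset.Icc 0 (N : ℤ)).filter (fun x => (N : ℤ) < x + M)).card ≤ M := by
  have : (Finset.Icc 0 (N : ℤ)).filter (fun x => (N : ℤ) < x + M)
      ⊆ Finset.Ioc ((N : ℤ) - M) N := by
    intro x hx
    simp only [Finset.mem_filter, Finset.mem_Icc, Finset.mem_Ioc] at *
    omega
  simpa using Finset.card_le_card this

lemma card_U (N M : ℕ) : ((Finset.Icc 0 (N : ℤ)).filter (fun x => U N M x)).card ≤ 2 * M := by
  have : (Finset.Icc 0 (N : ℤ)).filter (fun x => U N M x) ⊆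
      (Finset.Icc 0 (N : ℤ)).filter (fun x : ℤ => x < M) ∪
      (Finset.Icc 0 (N : ℤ)).filter (fun x => (N : ℤ) < x + M) := by
    intro x hx
    obtain ⟨a, b⟩ := Finset.mem_filter.1 hx
    rcases b with b | b
    · exact Finset.mem_union_left _ (Finset.mem_filter.2 ⟨a, b⟩)
    · exact Finset.mem_union_right _ (Finset.mem_filter.2 ⟨a, b⟩)
  have h := (Finset.card_le_card this).trans (Finset.card_union_le _ _)
  have := card_lo N M
  have := card_hi N M
  omega

lemma FF_var {N M : ℕ} {p : ℝ} (h0 : 0 ≤ p) (h1 : p ≤ 1) (hMp : 1 ≤ M * p) :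
    Ex (Finset.Icc 0 (N : ℤ)) p
      (fun A => (FF N M A - Ex (Finset.Icc 0 (N : ℤ)) p (FF N M)) ^ 2) ≤ 192 * (M * p) ^ 3 := by
  set s := Finset.Icc 0 (N : ℤ) with hs
  rw [Ex_var]
  refine (efron_stein h0 h1 s _).trans ?_
  set V : ℝ := 4 * (24 * (M * p) ^ 2) with hV
  have hV0 : 0 ≤ V := by positivity
  have key : ∀ i ∈ s, Ex s p (fun A => (FF N M (insert i A) - FF N M (A.erase i)) ^ 2)
      ≤ if U N M i then V else 0 := by
    intro i hi'
    have step : ∀ A, A ⊆ s → (FF N M (insert i A) - FF N M (A.erase i)) ^ 2 ≤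
        if U N M i then
          4 * (4 * ((lo M A).card : ℝ) ^ 2 + 4 * ((hi N M A).card : ℝ) ^ 2 + 8) else 0 := by
      intro A hA
      have hins : insert i (A.erase i) = insert i A := by
        ext x; simp only [Finset.mem_insert, Finset.mem_erase]; tauto
      have hsub : insert i (A.erase i) ⊆ s := by
        rw [hins]; exact Finset.insert_subset hi' hA
      have hd := FF_diff (M := M) hsub
      rw [hins] at hd
      refine hd.trans ?_
      by_cases hU : U N M i
      · rw [if_pos hU, if_pos hU]
        have c1 : ((lo M (insert i A)).card : ℝ) ≤ (lo M A).card + 1 := by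
          have : lo M (insert i A) ⊆ insert i (lo M A) := by
            intro x hx
            simp only [lo, Finset.mem_filter, Finset.mem_insert] at *
            tauto
          exact_mod_cast (Finset.card_le_card this).trans (Finset.card_insert_le _ _)
        have c2 : ((hi N M (insert i A)).card : ℝ) ≤ (hi N M A).card + 1 := by
          have : hi N M (insert i A) ⊆ insert i (hi N M A) := by
            intro x hx
            simp only [hi, Finset.mem_filter, Finset.mem_insert] at *
            tauto
          exact_mod_cast (Finset.card_le_card this).trans (Finset.card_insert_le _ _)
        have c3 : (0 : ℝ) ≤ ((lo M (insert i A)).card : ℝ) + ((hi N M (insert i A)).card : ℝ) := by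
          positivity
        have c4 : (((lo M (insert i A)).card : ℝ) + ((hi N M (insert i A)).card : ℝ)) ^ 2
            ≤ (((lo M A).card : ℝ) + ((hi N M A).card : ℝ) + 2) ^ 2 :=
          pow_le_pow_left₀ c3 (by linarith) 2
        nlinarith [sq_nonneg (((lo M A).card : ℝ) - ((hi N M A).card : ℝ)),
          sq_nonneg (((lo M A).card : ℝ) + ((hi N M A).card : ℝ) - 2)]
      · rw [if_neg hU, if_neg hU]
    refine (Ex_mono h0 h1 step).trans ?_
    by_cases hU : U N M i
    · simp only [if_pos hU]
      rw [Ex_mul, Ex_add, Ex_add, Ex_mul, Ex_mul, Ex_const]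
      have a1 := Ex_card_sq (s := s) h0 (fun x : ℤ => x < M) M (card_lo N M)
      have a2 := Ex_card_sq (s := s) h0 (fun x : ℤ => (N : ℤ) < x + M) M (card_hi N M)
      have a1' : Ex s p (fun A => ((lo M A).card : ℝ) ^ 2) ≤ M * p + (M * p) ^ 2 := a1
      have a2' : Ex s p (fun A => ((hi N M A).card : ℝ) ^ 2) ≤ M * p + (M * p) ^ 2 := a2
      rw [hV]
      nlinarith
    · simp only [if_neg hU]
      rw [Ex_const]
  have h2 := Finset.sum_le_sum key
  rw [← Finset.sum_filter, Finset.sum_const, nsmul_eq_mul] at h2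
  have h3 : (((s.filter (fun x => U N M x)).card : ℕ) : ℝ) ≤ 2 * M := by
    exact_mod_cast card_U N M
  have h4 := h2.trans (mul_le_mul_of_nonneg_right h3 hV0)
  have h5 : 0 ≤ ∑ i ∈ s, Ex s p (fun A => (FF N M (insert i A) - FF N M (A.erase i)) ^ 2) :=
    Finset.sum_nonneg fun i _ => Ex_nonneg h0 h1 fun A _ => sq_nonneg _
  calc p * (1 - p) * _ ≤ p * ∑ i ∈ s, Ex s p
        (fun A => (FF N M (insert i A) - FF N M (A.erase i)) ^ 2) := by
        apply mul_le_mul_of_nonneg_right _ h5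
        nlinarith
    _ ≤ p * (2 * M * V) := mul_le_mul_of_nonneg_left h4 h0
    _ = 192 * (M * p) ^ 3 := by rw [hV]; ring
lemma bern_le {x : ℝ} (h0 : 0 ≤ x) (h1 : x ≤ 1) (m : ℕ) : (1 - x) ^ m * (1 + m * x) ≤ 1 := by
  have a : 1 + m * x ≤ (1 + x) ^ m := one_add_mul_le_pow (by linarith) m
  have b : (0 : ℝ) ≤ (1 - x) ^ m := pow_nonneg (by linarith) m
  calc (1 - x) ^ m * (1 + m * x) ≤ (1 - x) ^ m * (1 + x) ^ m := mul_le_mul_of_nonneg_left a b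
    _ = (1 - x ^ 2) ^ m := by rw [← mul_pow]; ring
    _ ≤ 1 := pow_le_one₀ (by nlinarith) (by nlinarith)

lemma ms_w {p : ℝ} (h0 : 0 ≤ p) (h1 : p ≤ 1 / 10) (j : ℕ) :
    (1 - p) * (1 - 3 / 10 * p ^ 2) ^ (2 * (j + 1)) ≤ (1 - p) * (1 - p ^ 2) ^ ((j + 1) / 2) := by
  have hp2 : p ^ 2 ≤ 1 / 100 := by nlinarith
  have hp0 := sq_nonneg p
  set t := p ^ 2 with ht
  refine mul_le_mul_of_nonneg_left ?_ (by linarith)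
  have hw : (1 - 3 / 10 * t) ^ 4 ≤ 1 - t := by nlinarith [mul_nonneg hp0 hp0, mul_nonneg hp0 (mul_nonneg hp0 hp0), mul_nonneg (mul_nonneg hp0 (mul_nonneg hp0 hp0)) (sub_nonneg.2 hp2)]
  calc (1 - 3 / 10 * t) ^ (2 * (j + 1)) ≤ (1 - 3 / 10 * t) ^ (4 * ((j + 1) / 2)) :=
        pow_le_pow_of_le_one (by linarith) (by linarith) (by omega)
    _ = ((1 - 3 / 10 * t) ^ 4) ^ ((j + 1) / 2) := by rw [pow_mul]
    _ ≤ _ := pow_le_pow_left₀ (by positivity) hw _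

lemma md_w {p : ℝ} (h0 : 0 ≤ p) (h1 : p ≤ 1 / 10) (j : ℕ) :
    (1 - p ^ 2 * (1 - p)) ^ (j + 1) ≤ (1 - 3 / 10 * p ^ 2) ^ (3 * (j + 1)) := by
  have hp2 : p ^ 2 ≤ 1 / 100 := by nlinarith
  have hp0 := sq_nonneg p
  rw [pow_mul]
  refine pow_le_pow_left₀ (by nlinarith [mul_nonneg hp0 h0]) ?_ _
  have : p ^ 2 * p ≤ p ^ 2 * (1 / 10) := mul_le_mul_of_nonneg_left h1 hp0
  have e : (1 - 3 / 10 * p ^ 2) ^ 3 = 1 - 9 / 10 * p ^ 2 + 27 / 100 * (p ^ 2) ^ 2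
    - 27 / 1000 * (p ^ 2) ^ 3 := by ring
  rw [e]
  nlinarith [mul_nonneg hp0 hp0, mul_nonneg (mul_nonneg hp0 hp0) (sub_nonneg.2 hp2)]

lemma term_small {p : ℝ} (h0 : 0 ≤ p) (h1 : p ≤ 1 / 10) (m : ℕ) (hm : m * p ^ 2 ≤ 1) :
    2 / 25 * p ^ 2 * m - p ≤
      (1 - p) * (1 - 3 / 10 * p ^ 2) ^ (2 * m) - (1 - 3 / 10 * p ^ 2) ^ (3 * m) := by
  have hp2 : p ^ 2 ≤ 1 / 100 := by nlinarith
  have hp0 := sq_nonneg p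
  have hb := bern_le (x := 3 / 10 * p ^ 2) (by positivity) (by linarith) m
  have ha : 1 + (2 * m : ℕ) * (-(3 / 10 * p ^ 2)) ≤ (1 + -(3 / 10 * p ^ 2)) ^ (2 * m) :=
    one_add_mul_le_pow (by linarith) _
  push_cast at ha
  rw [← sub_eq_add_neg (1 : ℝ)] at ha
  set w := (1 - 3 / 10 * p ^ 2) with hw
  have hw0 : 0 ≤ w := by rw [hw]; linarith
  have hw1 : w ≤ 1 := by rw [hw]; linarith
  have e2 : w ^ (3 * m) = w ^ (2 * m) * w ^ m := by rw [← pow_add]; congr 1; ring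
  rw [e2]
  have x0 : 0 ≤ w ^ m := pow_nonneg hw0 m
  have x1 : w ^ m ≤ 1 := pow_le_one₀ hw0 hw1
  have y0 : 0 ≤ w ^ (2 * m) := pow_nonneg hw0 _
  have y1 : w ^ (2 * m) ≤ 1 := pow_le_one₀ hw0 hw1
  have y2 : 2 / 5 ≤ w ^ (2 * m) := by nlinarith
  set X := w ^ m
  set Y := w ^ (2 * m)
  have hm0 : 0 ≤ m * p ^ 2 := by positivity
  have z : 1 / 5 * (m * p ^ 2) ≤ 1 - X := by nlinarith
  have : 2 / 5 * (1 / 5 * (m * p ^ 2)) ≤ Y * (1 - X) :=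
    mul_le_mul y2 z (by positivity) y0
  nlinarith [mul_le_mul_of_nonneg_left y1 h0]

lemma term_big {p : ℝ} (h0 : 0 ≤ p) (h1 : p ≤ 1 / 10) (m : ℕ) (hm : 1 ≤ m * p ^ 2) :
    0 ≤ (1 - p) * (1 - 3 / 10 * p ^ 2) ^ (2 * m) - (1 - 3 / 10 * p ^ 2) ^ (3 * m) := by
  have hp2 : p ^ 2 ≤ 1 / 100 := by nlinarith
  have hp0 := sq_nonneg p
  have hb := bern_le (x := 3 / 10 * p ^ 2) (by positivity) (by linarith) m
  set w := (1 - 3 / 10 * p ^ 2) with hw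
  have hw0 : 0 ≤ w := by rw [hw]; linarith
  have e2 : w ^ (3 * m) = w ^ (2 * m) * w ^ m := by rw [← pow_add]; congr 1; ring
  rw [e2]
  have x0 : 0 ≤ w ^ m := pow_nonneg hw0 m
  have y0 : 0 ≤ w ^ (2 * m) := pow_nonneg hw0 _
  have z : w ^ m ≤ 1 - p := by nlinarith
  nlinarith [mul_le_mul_of_nonneg_left z y0]

lemma sum_lin (a b : ℝ) (ha : 0 ≤ a) (n : ℕ) :
    a / 2 * n ^ 2 - b * n ≤ ∑ j ∈ Finset.range n, (a * (j + 1 : ℕ) - b) := by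
  induction n with
  | zero => simp
  | succ n ih =>
    rw [Finset.sum_range_succ]
    push_cast at *
    nlinarith

lemma FF_mean {N M M0 : ℕ} {p : ℝ} (h0 : 0 ≤ p) (h1 : p ≤ 1 / 10) (hM0 : M0 ≤ M) (hM : M ≤ N)
    (hs : M0 * p ^ 2 ≤ 1) (hb : M0 < M → 1 ≤ (M0 + 1 : ℕ) * p ^ 2) :
    2 * (1 / 25 * (p * M0) ^ 2 - p * M0) ≤ Ex (Finset.Icc 0 (N : ℤ)) p (FF N M) := by
  have h1' : p ≤ 1 := by linarith
  set s := Finset.Icc 0 (N : ℤ)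
  set w := (1 - 3 / 10 * p ^ 2) with hw
  have e : Ex s p (FF N M) = ∑ j ∈ Finset.range M, (Ex s p (fun A => ms A (j : ℤ))
      + Ex s p (fun A => ms A (2 * N - j)) - 2 * Ex s p (fun A => md A (N - j))) := by
    unfold FF
    rw [Ex_sum]
    refine Finset.sum_congr rfl fun j _ => ?_
    rw [Ex_sub, Ex_add, Ex_mul]
  rw [e]
  have l1 : ∑ j ∈ Finset.range M, 2 * ((1 - p) * w ^ (2 * (j + 1)) - w ^ (3 * (j + 1))) ≤
      ∑ j ∈ Finset.range M, (Ex s p (fun A => ms A (j : ℤ))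
      + Ex s p (fun A => ms A (2 * N - j)) - 2 * Ex s p (fun A => md A (N - j))) := by
    refine Finset.sum_le_sum fun j hj => ?_
    have hj' := Finset.mem_range.1 hj
    have a1 := (ms_w h0 h1 j).trans (ms_lower (N := N) (j := j) (by omega) h0 h1')
    have a2 := (ms_w h0 h1 j).trans (ms_lower' (N := N) (j := j) (by omega) h0 h1')
    have a3 := (md_upper (N := N) (j := j) (by omega) h0 h1').trans (md_w h0 h1 j)
    linarith
  refine le_trans ?_ l1
  rw [← Finset.mul_sum]
  refine mul_le_mul_of_nonneg_left ?_ (by norm_num)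
  rw [← Finset.sum_range_add_sum_Ico _ hM0]
  have l2 : 0 ≤ ∑ j ∈ Finset.Ico M0 M, ((1 - p) * w ^ (2 * (j + 1)) - w ^ (3 * (j + 1))) := by
    refine Finset.sum_nonneg fun j hj => ?_
    have hj' := Finset.mem_Ico.1 hj
    refine term_big h0 h1 (j + 1) ((hb (by omega)).trans ?_)
    have : ((M0 + 1 : ℕ) : ℝ) ≤ ((j + 1 : ℕ) : ℝ) := by exact_mod_cast (by omega)
    exact mul_le_mul_of_nonneg_right this (sq_nonneg p)
  have l3 : ∑ j ∈ Finset.range M0, (2 / 25 * p ^ 2 * (j + 1 : ℕ) - p) ≤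
      ∑ j ∈ Finset.range M0, ((1 - p) * w ^ (2 * (j + 1)) - w ^ (3 * (j + 1))) := by
    refine Finset.sum_le_sum fun j hj => ?_
    have hj' := Finset.mem_range.1 hj
    refine term_small h0 h1 (j + 1) (le_trans ?_ hs)
    have : ((j + 1 : ℕ) : ℝ) ≤ (M0 : ℝ) := by exact_mod_cast (by omega)
    exact mul_le_mul_of_nonneg_right this (sq_nonneg p)
  have l4 := sum_lin (2 / 25 * p ^ 2) p (by positivity) M0
  nlinarith

noncomputable def RR (N M : ℕ) (A : Finset ℤ) : ℝ :=
  ∑ j ∈ Finset.Ico M N, 2 * md A ((N : ℤ) - j)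

lemma md_nonneg (A : Finset ℤ) (k : ℤ) : 0 ≤ md A k := by
  unfold md; split_ifs <;> norm_num

lemma ms_nonneg (A : Finset ℤ) (k : ℤ) : 0 ≤ ms A k := by
  unfold ms; split_ifs <;> norm_num

lemma RR_nonneg (N M : ℕ) (A : Finset ℤ) : 0 ≤ RR N M A :=
  Finset.sum_nonneg fun j _ => mul_nonneg (by norm_num) (md_nonneg _ _)

lemma RR_mean {N M : ℕ} {p : ℝ} (h0 : 0 < p) (h1 : p ≤ 1 / 10) (hM : 0 < M) :
    Ex (Finset.Icc 0 (N : ℤ)) p (RR N M) ≤ 200 / 9 / (p ^ 4 * M) := by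
  have h1' : p ≤ 1 := by linarith
  have hp2 : p ^ 2 ≤ 1 / 100 := by nlinarith
  have hp0 : 0 < p ^ 2 := by positivity
  have hMr : (0 : ℝ) < M := by exact_mod_cast hM
  unfold RR
  rw [Ex_sum]
  have hb := bern_le (x := 3 / 10 * p ^ 2) (by positivity) (by linarith) M
  set w := (1 - 3 / 10 * p ^ 2) with hw
  have hw0 : 0 ≤ w := by rw [hw]; linarith
  have hw1 : w < 1 := by rw [hw]; linarith
  have l1 : ∀ j ∈ Finset.Ico M N,
      Ex (Finset.Icc 0 (N : ℤ)) p (fun A => 2 * md A ((N : ℤ) - j)) ≤ 2 * w ^ j := by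
    intro j hj
    have hj' := Finset.mem_Ico.1 hj
    rw [Ex_mul]
    have a3 := (md_upper (N := N) (j := j) (by omega) h0.le h1').trans (md_w h0.le h1 j)
    have a4 : w ^ (3 * (j + 1)) ≤ w ^ j := pow_le_pow_of_le_one hw0 hw1.le (by omega)
    linarith
  refine (Finset.sum_le_sum l1).trans ?_
  rw [← Finset.mul_sum]
  have g := geom_sum_Ico_le_of_lt_one (m := M) (n := N) hw0 hw1
  have e : 1 - w = 3 / 10 * p ^ 2 := by rw [hw]; ring
  rw [e] at g
  have hwM : w ^ M ≤ 1 / (M * (3 / 10 * p ^ 2)) := by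
    rw [le_div_iff₀ (by positivity)]
    nlinarith [pow_nonneg hw0 M]
  have : w ^ M / (3 / 10 * p ^ 2) ≤ 1 / (M * (3 / 10 * p ^ 2)) / (3 / 10 * p ^ 2) := by gcongr
  have e3 : 2 * (1 / (M * (3 / 10 * p ^ 2)) / (3 / 10 * p ^ 2)) = 200 / 9 / (p ^ 4 * M) := by
    field_simp
    norm_num
  linarith

lemma det {N M : ℕ} (hM : M ≤ N) {A : Finset ℤ} (hA : A ⊆ Finset.Icc 0 (N : ℤ))
    (h : RR N M A < FF N M A) : (A + A).card < (A - A).card := by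
  have hmem : ∀ x ∈ A, 0 ≤ x ∧ x ≤ N := fun x hx => Finset.mem_Icc.1 (hA hx)
  have hne : A.Nonempty := by
    by_contra hcon
    rw [Finset.not_nonempty_iff_eq_empty] at hcon
    have h1 : FF N M A = 0 := by
      subst hcon
      unfold FF
      refine Finset.sum_eq_zero fun j _ => ?_
      simp [ms, md]; norm_num
    have := RR_nonneg N M A
    linarith
  set c1 := (Finset.range N).filter (fun j : ℕ => (j : ℤ) ∈ A + A) with hc1
  set c2 := (Finset.range N).filter (fun j : ℕ => (2 * N - j : ℤ) ∈ A + A) with hc2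
  set c3 := (Finset.range N).filter (fun j : ℕ => (N - j : ℤ) ∈ A - A) with hc3
  have u1 : (A + A).card ≤ 1 + c1.card + c2.card := by
    have hsub : A + A ⊆ ({(N : ℤ)} ∪ c1.image (fun j : ℕ => (j : ℤ)))
        ∪ c2.image (fun j : ℕ => (2 * N - j : ℤ)) := by
      intro k hk
      obtain ⟨a, ha, b, hb, hab⟩ := Finset.mem_add.1 hk
      have ha0 := hmem a ha
      have hb0 := hmem b hb
      rcases lt_trichotomy k N with h | h | h
      · refine Finset.mem_union_left _ (Finset.mem_union_right _ (Finset.mem_image.2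
          ⟨k.toNat, Finset.mem_filter.2 ⟨Finset.mem_range.2 (by omega), ?_⟩, by omega⟩))
        have : ((k.toNat : ℕ) : ℤ) = k := by omega
        rwa [this]
      · exact Finset.mem_union_left _ (Finset.mem_union_left _ (by simp [h]))
      · refine Finset.mem_union_right _ (Finset.mem_image.2
          ⟨(2 * N - k).toNat, Finset.mem_filter.2 ⟨Finset.mem_range.2 (by omega), ?_⟩, by omega⟩)
        have : (2 * N : ℤ) - (((2 * N - k).toNat : ℕ) : ℤ) = k := by omega
        rwa [this]
    refine (Finset.card_le_card hsub).trans ((Finset.card_union_le _ _).trans ?_)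
    have a1 := Finset.card_union_le {(N : ℤ)} (c1.image (fun j : ℕ => (j : ℤ)))
    have a2 := Finset.card_image_le (s := c1) (f := fun j : ℕ => (j : ℤ))
    have a3 := Finset.card_image_le (s := c2) (f := fun j : ℕ => (2 * N - j : ℤ))
    rw [Finset.card_singleton] at a1
    omega
  have u2 : 1 + c3.card + c3.card ≤ (A - A).card := by
    have hsub : ({(0 : ℤ)} ∪ c3.image (fun j : ℕ => (N - j : ℤ)))
        ∪ c3.image (fun j : ℕ => (j - N : ℤ)) ⊆ A - A := by
      intro k hk
      rcases Finset.mem_union.1 hk with hk | hk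
      · rcases Finset.mem_union.1 hk with hk | hk
        · obtain ⟨a, ha⟩ := hne
          rw [Finset.mem_singleton.1 hk]
          exact Finset.mem_sub.2 ⟨a, ha, a, ha, by ring⟩
        · obtain ⟨j, hj, rfl⟩ := Finset.mem_image.1 hk
          exact (Finset.mem_filter.1 hj).2
      · obtain ⟨j, hj, rfl⟩ := Finset.mem_image.1 hk
        obtain ⟨a, ha, b, hb, hab⟩ := Finset.mem_sub.1 (Finset.mem_filter.1 hj).2
        exact Finset.mem_sub.2 ⟨b, hb, a, ha, by omega⟩
    refine le_trans ?_ (Finset.card_le_card hsub)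
    rw [Finset.card_union_of_disjoint, Finset.card_union_of_disjoint,
      Finset.card_image_of_injective, Finset.card_image_of_injective, Finset.card_singleton]
    · intro a b hab; simpa using hab
    · intro a b hab; simpa using hab
    · rw [Finset.disjoint_left]
      intro k hk hk'
      obtain ⟨j, hj, e⟩ := Finset.mem_image.1 hk'
      have := Finset.mem_range.1 (Finset.mem_filter.1 hj).1
      have := Finset.mem_singleton.1 hk
      omega
    · rw [Finset.disjoint_left]
      intro k hk hk'
      obtain ⟨j, hj, e⟩ := Finset.mem_image.1 hk'
      have := Finset.mem_range.1 (Finset.mem_filter.1 hj).1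
      rcases Finset.mem_union.1 hk with hk | hk
      · have := Finset.mem_singleton.1 hk
        omega
      · obtain ⟨j', hj', e'⟩ := Finset.mem_image.1 hk
        have := Finset.mem_range.1 (Finset.mem_filter.1 hj').1
        omega
  have cnt : ∀ Q : ℕ → Prop, ∑ j ∈ Finset.range N, (if Q j then (0 : ℝ) else 1)
      = N - ((Finset.range N).filter Q).card := by
    intro Q
    have e : ∑ j ∈ Finset.range N, (if Q j then (0 : ℝ) else 1)
        = ∑ j ∈ Finset.range N, (1 - if Q j then (1 : ℝ) else 0) :=
      Finset.sum_congr rfl fun j _ => by split_ifs <;> norm_num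
    rw [e, Finset.sum_sub_distrib, Finset.sum_boole]; simp
  have v1 : ∑ j ∈ Finset.range N, ms A (j : ℤ) = N - c1.card := by
    rw [hc1]; unfold ms; convert cnt _
  have v2 : ∑ j ∈ Finset.range N, ms A (2 * N - j : ℤ) = N - c2.card := by
    rw [hc2]; unfold ms; convert cnt _
  have v3 : ∑ j ∈ Finset.range N, md A (N - j : ℤ) = N - c3.card := by
    rw [hc3]; unfold md; convert cnt _
  have w1 : FF N M A - RR N M A ≤ FF N N A := by
    unfold FF RR
    rw [← Finset.sum_range_add_sum_Ico _ hM]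
    have : -∑ j ∈ Finset.Ico M N, 2 * md A ((N : ℤ) - j) ≤
      ∑ j ∈ Finset.Ico M N, (ms A (j : ℤ) + ms A (2 * N - j) - 2 * md A (N - j)) := by
      rw [← Finset.sum_neg_distrib]
      refine Finset.sum_le_sum fun j _ => ?_
      have := ms_nonneg A j
      have := ms_nonneg A (2 * N - j)
      linarith
    linarith
  have w2 : FF N N A = 2 * (c3.card : ℝ) - c1.card - c2.card := by
    unfold FF
    rw [Finset.sum_sub_distrib, Finset.sum_add_distrib, ← Finset.mul_sum, v1, v2, v3]
    ring
  have w3 : (c1.card : ℝ) + c2.card < 2 * c3.card := by linarith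
  have w4 : c1.card + c2.card < 2 * c3.card := by exact_mod_cast w3
  omega
lemma binom_eq (N : ℕ) (p : ℝ) (P : Finset ℤ → Prop) [DecidablePred P] :
    binomProb (N + 1) p P = Ex (Finset.Icc 0 (N : ℤ)) p (fun A => if P A then 1 else 0) := by
  unfold binomProb Ex
  have e : (((N + 1 : ℕ) : ℤ) - 1) = N := by push_cast; ring
  rw [e]
  refine Finset.sum_congr rfl fun A _ => ?_
  have c : (Finset.Icc 0 (N : ℤ)).card = N + 1 := by simp
  rw [c]
  by_cases h : P A <;> simp [h]

set_option maxHeartbeats 1000000 in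
lemma main_bound {N K : ℕ} {p : ℝ} (h0 : 0 < p) (h1 : p ≤ 1 / 10) (hK : 1 ≤ K)
    (hL : 50 ≤ p * (min N ⌊1 / p ^ 2⌋₊ : ℕ)) :
    1 - (480000 * K ^ 3 / (p * (min N ⌊1 / p ^ 2⌋₊ : ℕ)) + 8900 / K) ≤
      binomProb (N + 1) p (fun A => (A + A).card < (A - A).card) := by
  have h1' : p ≤ 1 := by linarith
  have hp0 : 0 < p ^ 2 := by positivity
  have hp2 : p ^ 2 ≤ 1 / 100 := by nlinarith
  have hKr : (1 : ℝ) ≤ K := by exact_mod_cast hK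
  rw [binom_eq]
  set a := ⌊1 / p ^ 2⌋₊ with ha
  set M0 := min N a with hM0
  set M := min N (K * a) with hM
  set L := p * (M0 : ℝ) with hLdef
  have aK : a ≤ K * a := Nat.le_mul_of_pos_left a hK
  have fa : (a : ℝ) * p ^ 2 ≤ 1 := by
    have : (a : ℝ) ≤ 1 / p ^ 2 := Nat.floor_le (by positivity)
    rwa [le_div_iff₀ hp0] at this
  have fb : 1 ≤ ((a + 1 : ℕ) : ℝ) * p ^ 2 := by
    have : 1 / p ^ 2 < (a : ℝ) + 1 := Nat.lt_floor_add_one _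
    rw [div_lt_iff₀ hp0] at this
    push_cast; linarith
  have hM0M : M0 ≤ M := by omega
  have hMN : M ≤ N := by omega
  have hMK : M ≤ K * M0 := by
    rcases le_total N a with h | h
    · have : M0 = N := by omega
      rw [this]; exact hMN.trans (Nat.le_mul_of_pos_left N hK)
    · have : M0 = a := by omega
      rw [this]; omega
  have hs : M0 * p ^ 2 ≤ 1 := by
    have : (M0 : ℝ) ≤ a := by exact_mod_cast (by omega)
    exact (mul_le_mul_of_nonneg_right this hp0.le).trans fa
  have hb : M0 < M → 1 ≤ (M0 + 1 : ℕ) * p ^ 2 := by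
    intro h
    have : M0 = a := by omega
    rw [this]; exact fb
  have hmean := FF_mean (N := N) h0.le h1 hM0M hMN hs hb
  set s := Finset.Icc 0 (N : ℤ) with hsdef
  set μ := Ex s p (FF N M) with hμ
  have hμ1 : 1 / 25 * L ^ 2 ≤ μ := by
    refine le_trans ?_ hmean
    rw [← hLdef]; nlinarith
  have hL0 : 0 < L := by linarith
  have hμ0 : 0 < μ := lt_of_lt_of_le (by positivity) hμ1
  have hM0r : (M0 : ℝ) ≤ M := by exact_mod_cast hM0M
  have hMp : 1 ≤ M * p := by
    have : L ≤ M * p := by rw [hLdef, mul_comm]; exact mul_le_mul_of_nonneg_right hM0r h0.le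
    linarith
  have hMpos : 0 < M := by
    rcases Nat.eq_zero_or_pos M with h | h
    · rw [h] at hMp; norm_num at hMp
    · exact h
  have hMKL : M * p ≤ K * L := by
    have : (M : ℝ) ≤ K * M0 := by exact_mod_cast hMK
    calc (M : ℝ) * p ≤ K * M0 * p := mul_le_mul_of_nonneg_right this h0.le
      _ = K * L := by rw [hLdef]; ring
  have hvar := FF_var (N := N) h0.le h1' hMp
  rw [← hsdef, ← hμ] at hvar
  have hvar2 : Ex s p (fun A => (FF N M A - μ) ^ 2) ≤ 192 * (K * L) ^ 3 := by
    refine hvar.trans ?_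
    gcongr
  have hR : Ex s p (RR N M) ≤ 178 * L ^ 2 / K := by
    rcases le_or_gt N (K * a) with h | h
    · have hMe : M = N := by omega
      have : Ex s p (RR N M) = 0 := by
        refine (Ex_congr fun A _ => ?_).trans (Ex_const s p 0)
        simp [RR, hMe]
      rw [this]; positivity
    · have hMe : M = K * a := by omega
      have hM0e : M0 = a := by omega
      refine (RR_mean (N := N) h0 h1 hMpos).trans ?_
      have ha2 : 1 / 2 ≤ (a : ℝ) * p ^ 2 := by push_cast at fb; nlinarith
      have ha0 : (0 : ℝ) < a := by nlinarith
      have hK0 : (0 : ℝ) < K := by linarith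
      rw [hLdef, hM0e, hMe]
      push_cast
      rw [div_le_div_iff₀ (by positivity) (by positivity)]
      have c3 : (1 / 2 : ℝ) ^ 3 ≤ ((a : ℝ) * p ^ 2) ^ 3 := by gcongr
      have e : 178 * (p * (a : ℝ)) ^ 2 * (p ^ 4 * (K * a)) = 178 * K * ((a : ℝ) * p ^ 2) ^ 3 := by
        ring
      rw [e]
      nlinarith
  -- pointwise bound
  have hpt : 1 - (4 / μ ^ 2 * Ex s p (fun A => (FF N M A - μ) ^ 2) + 2 / μ * Ex s p (RR N M))
      ≤ Ex s p (fun A => if (A + A).card < (A - A).card then 1 else 0) := by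
    rw [← Ex_mul, ← Ex_mul, ← Ex_add]
    have : (1 : ℝ) = Ex s p (fun _ => 1) := (Ex_const s p 1).symm
    rw [this, ← Ex_sub]
    rw [← this]
    refine Ex_mono h0.le h1' fun A hA => ?_
    have n1 : 0 ≤ 4 / μ ^ 2 * (FF N M A - μ) ^ 2 := by positivity
    have n2 : 0 ≤ 2 / μ * RR N M A := mul_nonneg (by positivity) (RR_nonneg _ _ _)
    by_cases hg : (A + A).card < (A - A).card
    · rw [if_pos hg]; linarith
    · rw [if_neg hg]
      have hle : FF N M A ≤ RR N M A := by
        by_contra hc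
        exact hg (det hMN hA (not_le.1 hc))
      rcases le_total (μ / 2) (RR N M A) with hr | hr
      · have : 1 ≤ 2 / μ * RR N M A := by
          rw [div_mul_eq_mul_div, le_div_iff₀ hμ0]; linarith
        linarith
      · have : 1 ≤ 4 / μ ^ 2 * (FF N M A - μ) ^ 2 := by
          rw [div_mul_eq_mul_div, le_div_iff₀ (pow_pos hμ0 2)]
          nlinarith
        linarith
  refine le_trans ?_ hpt
  have q1 : 4 / μ ^ 2 * Ex s p (fun A => (FF N M A - μ) ^ 2) ≤ 480000 * K ^ 3 / L := by
    calc 4 / μ ^ 2 * Ex s p (fun A => (FF N M A - μ) ^ 2)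
        ≤ 4 / (1 / 25 * L ^ 2) ^ 2 * (192 * (K * L) ^ 3) := by
          apply mul_le_mul _ hvar2 (Ex_nonneg h0.le h1' fun A _ => sq_nonneg _) (by positivity)
          gcongr
      _ = 480000 * K ^ 3 / L := by field_simp; norm_num
  have q2 : 2 / μ * Ex s p (RR N M) ≤ 8900 / K := by
    calc 2 / μ * Ex s p (RR N M) ≤ 2 / (1 / 25 * L ^ 2) * (178 * L ^ 2 / K) := by
          apply mul_le_mul _ hR (Ex_nonneg h0.le h1' fun A _ => RR_nonneg _ _ _) (by positivity)
          gcongr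
      _ = 8900 / K := by field_simp; norm_num
  linarith

lemma binom_le_one {N : ℕ} {p : ℝ} (h0 : 0 ≤ p) (h1 : p ≤ 1) (P : Finset ℤ → Prop) :
    binomProb (N + 1) p P ≤ 1 := by
  rw [binom_eq, ← Ex_const (Finset.Icc 0 (N : ℤ)) p 1]
  refine Ex_mono h0 h1 fun A _ => ?_
  rw [Ex_const]
  split_ifs <;> norm_num

/-- Hegarty–Miller: if `n⁻¹ = o(p(n))` and `p(n) = o(1)`, then the probability that a
binomial random subset of `{0,…,n-1}` is difference-dominated tends to 1. -/
theorem difference_dominated_whp (p : ℕ → ℝ) (hp : ∀ n, 0 < p n ∧ p n < 1)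
    (hlower : (fun n : ℕ => ((n : ℝ))⁻¹) =o[Filter.atTop] p)
    (hupper : p =o[Filter.atTop] (fun _ : ℕ => (1 : ℝ))) :
    Filter.Tendsto
      (fun n : ℕ => binomProb n (p n) (fun A => (A + A).card < (A - A).card))
      Filter.atTop (nhds 1) := by
  rw [Metric.tendsto_atTop']
  intro ε hε
  obtain ⟨K, hK⟩ := exists_nat_gt (max 1 (2 * 8900 / ε))
  have hK1 : (1 : ℝ) < K := lt_of_le_of_lt (le_max_left _ _) hK
  have hK2 : 2 * 8900 / ε < K := lt_of_le_of_lt (le_max_right _ _) hK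
  have hKn : 1 ≤ K := by exact_mod_cast hK1.le
  set L0 : ℝ := max 50 (2 * (480000 * K ^ 3) / ε + 1) with hL0
  have hL50 : 50 ≤ L0 := le_max_left _ _
  have hLε : 2 * (480000 * K ^ 3) / ε + 1 ≤ L0 := le_max_right _ _
  have ev1 := hlower.def (c := 1 / (L0 + 1)) (by positivity)
  have ev2 := hupper.def (c := 1 / (L0 + 1)) (by positivity)
  obtain ⟨n0, hn0⟩ := Filter.eventually_atTop.1 (ev1.and ev2)
  refine ⟨n0 + 1, fun n hn => ?_⟩
  obtain ⟨e1, e2⟩ := hn0 n (by omega)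
  obtain ⟨hp0, hp1⟩ := hp n
  obtain ⟨N, rfl⟩ : ∃ N, n = N + 1 := ⟨n - 1, by omega⟩
  set q := p (N + 1) with hq
  simp only [Real.norm_eq_abs, abs_one, mul_one, abs_of_pos hp0] at e1 e2
  have hc : (0 : ℝ) < L0 + 1 := by linarith
  rw [le_div_iff₀ hc] at e2
  have hn1 : (0 : ℝ) < ((N + 1 : ℕ) : ℝ) := by positivity
  rw [abs_of_pos (inv_pos.2 hn1), inv_le_iff_one_le_mul₀ hn1, div_mul_eq_mul_div,
    div_mul_eq_mul_div, le_div_iff₀ hc] at e1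
  have hq10 : q ≤ 1 / 10 := by nlinarith
  have hq2 : 0 < q ^ 2 := by positivity
  have hLL : L0 ≤ q * (min N ⌊1 / q ^ 2⌋₊ : ℕ) := by
    rcases min_choice N ⌊1 / q ^ 2⌋₊ with h | h
    · rw [h]; push_cast at e1; nlinarith
    · rw [h]
      have : 1 / q ^ 2 < (⌊1 / q ^ 2⌋₊ : ℝ) + 1 := Nat.lt_floor_add_one _
      rw [div_lt_iff₀ hq2] at this
      have h3 : 1 < q * (q * (⌊1 / q ^ 2⌋₊ : ℝ) + q) := by nlinarith
      by_contra hcon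
      push Not at hcon
      nlinarith
  have mb := main_bound (N := N) hp0 hq10 hKn (hL50.trans hLL)
  have ub := binom_le_one (N := N) hp0.le hp1.le (fun A => (A + A).card < (A - A).card)
  have b2 : (8900 : ℝ) / K < ε / 2 := by
    rw [div_lt_iff₀ hε] at hK2
    rw [div_lt_iff₀ (by linarith)]; linarith
  have b1 : 480000 * (K : ℝ) ^ 3 / (q * (min N ⌊1 / q ^ 2⌋₊ : ℕ)) < ε / 2 := by
    have hl : 2 * (480000 * (K : ℝ) ^ 3) / ε < q * (min N ⌊1 / q ^ 2⌋₊ : ℕ) := by linarith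
    rw [div_lt_iff₀ hε] at hl
    rw [div_lt_iff₀ (by linarith)]; linarith
  rw [Real.dist_eq, abs_lt]
  constructor <;> linarith
end

section
/- Let p : ℕ → (0,1) satisfy n^{−1} = o(p(n)) and p(n) = o(n^{−1/2}). For each n, let A be a random subset of {0,1,…,n−1} in the binomial model with parameter p(n), and let S = |A+A| and D = |A−A|. Then S ∼ (n·p(n))²/2 and D ∼ (n·p(n))² with probability tending to 1; that is, for every ε > 0, the probability that |S/((n·p(n))²/2) − 1| < ε and |D/(n·p(n))² − 1| < ε tends to 1 as n → ∞. In particular D/S → 2 in probability. -/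
open Finset Filter Asymptotics
open scoped Pointwise Classical

noncomputable def bw (n : ℕ) (p : ℝ) (A : Finset ℤ) : ℝ := p ^ A.card * (1 - p) ^ (n - A.card)

noncomputable def bI (n : ℕ) : Finset ℤ := Finset.Icc (0 : ℤ) ((n : ℤ) - 1)

lemma bI_card (n : ℕ) : (bI n).card = n := by
  simp [bI]

lemma bw_nonneg (n : ℕ) (p : ℝ) (h0 : 0 ≤ p) (h1 : p ≤ 1) (A : Finset ℤ) : 0 ≤ bw n p A := by
  unfold bw
  have : 0 ≤ 1 - p := by linarith
  positivity

lemma prob_superset (n : ℕ) (p : ℝ) (T : Finset ℤ) (hT : T ⊆ bI n) :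
    ∑ A ∈ (bI n).powerset, bw n p A * (if T ⊆ A then 1 else 0) = p ^ T.card := by
  have h := Finset.prod_add (fun _ : ℤ => p) (fun i : ℤ => if i ∈ T then 0 else 1 - p) (bI n)
  have h2 : ∏ i ∈ bI n, (p + if i ∈ T then 0 else 1 - p) = p ^ T.card := by
    rw [← Finset.prod_sdiff hT]
    rw [Finset.prod_eq_one (s := bI n \ T), one_mul]
    · rw [Finset.prod_congr rfl (g := fun _ => p)]
      · simp
      · intro x hx; simp [hx]
    · intro x hx
      simp [(Finset.mem_sdiff.1 hx).2]
  rw [← h2, h]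
  refine Finset.sum_congr rfl fun A hA => ?_
  have hA' := Finset.mem_powerset.1 hA
  rw [Finset.prod_const, bw]
  split_ifs with hTA
  · rw [mul_one]
    congr 1
    rw [Finset.prod_congr rfl (g := fun _ => 1 - p)]
    · rw [Finset.prod_const, Finset.card_sdiff_of_subset hA', bI_card]
    · intro x hx
      have := (Finset.mem_sdiff.1 hx).2
      rw [if_neg (fun h => this (hTA h))]
  · obtain ⟨x, hx, hxA⟩ := Finset.not_subset.1 hTA
    rw [Finset.prod_eq_zero (i := x) (Finset.mem_sdiff.2 ⟨hT hx, hxA⟩) (by simp [hx]),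
      mul_zero, mul_zero]

lemma prob_superset_le (n : ℕ) (p : ℝ) (h0 : 0 ≤ p) (T : Finset ℤ) :
    ∑ A ∈ (bI n).powerset, bw n p A * (if T ⊆ A then 1 else 0) ≤ p ^ T.card := by
  by_cases hT : T ⊆ bI n
  · exact (prob_superset n p T hT).le
  · rw [Finset.sum_eq_zero]
    · positivity
    · intro A hA
      rw [if_neg (fun h => hT (h.trans (Finset.mem_powerset.1 hA))), mul_zero]

lemma sum_bw (n : ℕ) (p : ℝ) : ∑ A ∈ (bI n).powerset, bw n p A = 1 := by
  simpa using prob_superset n p ∅ (by simp)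

lemma card_eq (n : ℕ) (A : Finset ℤ) (hA : A ⊆ bI n) :
    (A.card : ℝ) = ∑ i ∈ bI n, if ({i} : Finset ℤ) ⊆ A then (1 : ℝ) else 0 := by
  simp only [Finset.singleton_subset_iff]
  rw [Finset.sum_boole, Finset.filter_mem_eq_inter, Finset.inter_eq_right.2 hA]

lemma exp_card (n : ℕ) (p : ℝ) : ∑ A ∈ (bI n).powerset, bw n p A * (A.card : ℝ) = n * p := by
  have : ∀ A ∈ (bI n).powerset, bw n p A * (A.card : ℝ)
      = ∑ i ∈ bI n, bw n p A * if ({i} : Finset ℤ) ⊆ A then (1 : ℝ) else 0 := by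
    intro A hA
    rw [card_eq n A (Finset.mem_powerset.1 hA), Finset.mul_sum]
  rw [Finset.sum_congr rfl this, Finset.sum_comm]
  rw [Finset.sum_congr rfl (g := fun _ => p)]
  · simp [bI_card]
  · intro i hi
    rw [prob_superset n p {i} (by simpa using hi)]; simp

lemma exp_card_sq (n : ℕ) (p : ℝ) (h0 : 0 ≤ p) :
    ∑ A ∈ (bI n).powerset, bw n p A * (A.card : ℝ) ^ 2 ≤ (n * p) ^ 2 + n * p := by
  have : ∀ A ∈ (bI n).powerset, bw n p A * (A.card : ℝ) ^ 2
      = ∑ i ∈ bI n, ∑ j ∈ bI n, bw n p A * if ({i, j} : Finset ℤ) ⊆ A then (1 : ℝ) else 0 := by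
    intro A hA
    rw [sq, card_eq n A (Finset.mem_powerset.1 hA), Finset.sum_mul_sum, Finset.mul_sum]
    refine Finset.sum_congr rfl fun i _ => ?_
    rw [Finset.mul_sum]
    refine Finset.sum_congr rfl fun j _ => ?_
    congr 1
    simp only [Finset.singleton_subset_iff, Finset.insert_subset_iff]
    by_cases h1 : i ∈ A <;> by_cases h2 : j ∈ A <;> simp [h1, h2]
  rw [Finset.sum_congr rfl this, Finset.sum_comm]
  have key : ∀ i ∈ bI n, ∑ A ∈ (bI n).powerset, ∑ j ∈ bI n,
      bw n p A * (if ({i, j} : Finset ℤ) ⊆ A then (1 : ℝ) else 0) ≤ n * p ^ 2 + p := by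
    intro i hi
    rw [Finset.sum_comm]
    calc _ ≤ ∑ j ∈ bI n, (p ^ 2 + if i = j then p else 0) := by
          refine Finset.sum_le_sum fun j _ => (prob_superset_le n p h0 _).trans ?_
          by_cases h : i = j
          · subst h; simp; positivity
          · simp [h, Finset.card_pair h]
      _ = _ := by
          rw [Finset.sum_add_distrib]
          simp [bI_card, hi]
  refine (Finset.sum_le_sum key).trans ?_
  simp [bI_card]
  apply le_of_eq; ring

lemma exp_var (n : ℕ) (p : ℝ) (h0 : 0 ≤ p) :
    ∑ A ∈ (bI n).powerset, bw n p A * ((A.card : ℝ) - n * p) ^ 2 ≤ n * p := by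
  have : ∀ A ∈ (bI n).powerset, bw n p A * ((A.card : ℝ) - n * p) ^ 2
      = bw n p A * (A.card : ℝ) ^ 2 - 2 * (n * p) * (bw n p A * A.card)
        + (n * p) ^ 2 * bw n p A := by
    intro A _; ring
  rw [Finset.sum_congr rfl this, Finset.sum_add_distrib, Finset.sum_sub_distrib,
    ← Finset.mul_sum, ← Finset.mul_sum, sum_bw, exp_card]
  have := exp_card_sq n p h0
  nlinarith

/-- collisions -/
noncomputable def bQ (A : Finset ℤ) : Finset (ℤ × ℤ × ℤ) :=
  (A ×ˢ A ×ˢ A).filter fun x => x.1 ≠ x.2.1 ∧ x.1 ≠ x.2.2 ∧ x.2.2 - x.1 + x.2.1 ∈ A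

lemma bQ_card_le (n : ℕ) (A : Finset ℤ) (hA : A ⊆ bI n) :
    ((bQ A).card : ℝ) ≤ ∑ a ∈ bI n, ∑ b ∈ bI n, ∑ c ∈ bI n,
      if a ≠ b ∧ a ≠ c then
        (if ({a, b, c, c - a + b} : Finset ℤ) ⊆ A then (1 : ℝ) else 0) else 0 := by
  have h : bQ A ⊆ (bI n ×ˢ bI n ×ˢ bI n).filter fun x =>
      (x.1 ≠ x.2.1 ∧ x.1 ≠ x.2.2) ∧ ({x.1, x.2.1, x.2.2, x.2.2 - x.1 + x.2.1} : Finset ℤ) ⊆ A := by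
    intro x hx
    simp only [bQ, Finset.mem_filter, Finset.mem_product] at hx
    obtain ⟨⟨h1, h2, h3⟩, h4, h5, h6⟩ := hx
    simp only [Finset.mem_filter, Finset.mem_product, Finset.insert_subset_iff,
      Finset.singleton_subset_iff]
    exact ⟨⟨hA h1, hA h2, hA h3⟩, ⟨h4, h5⟩, h1, h2, h3, h6⟩
  have h2 : ((bQ A).card : ℝ) ≤ _ := Nat.cast_le.2 (Finset.card_le_card h)
  refine h2.trans (le_of_eq ?_)
  rw [← Finset.sum_boole, Finset.sum_product]
  refine Finset.sum_congr rfl fun a _ => ?_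
  rw [Finset.sum_product]
  refine Finset.sum_congr rfl fun b _ => Finset.sum_congr rfl fun c _ => ?_
  simp only [ite_and]

lemma pow_T (p : ℝ) (h0 : 0 ≤ p) (a b c : ℤ) (hab : a ≠ b) (hac : a ≠ c) :
    p ^ ({a, b, c, c - a + b} : Finset ℤ).card ≤
      p ^ 4 + (if b = c then p ^ 3 else 0) + (if 2 * a - b = c then p ^ 3 else 0) := by
  have e3 : 0 ≤ p ^ 3 := by positivity
  have e4 : 0 ≤ p ^ 4 := by positivity
  by_cases hbc : b = c
  · have : ({a, b, c, c - a + b} : Finset ℤ).card = 3 := by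
      subst hbc
      have : ({a, b, b, b - a + b} : Finset ℤ) = {a, b, b - a + b} := by ext; simp
      rw [this, Finset.card_eq_three]
      exact ⟨_, _, _, hab, by omega, by omega, rfl⟩
    rw [this, if_pos hbc]
    split_ifs <;> linarith
  · by_cases h2 : 2 * a - b = c
    · have : ({a, b, c, c - a + b} : Finset ℤ).card = 3 := by
        have : ({a, b, c, c - a + b} : Finset ℤ) = {a, b, c} := by
          have : c - a + b = a := by omega
          rw [this]; ext; simp; tauto
        rw [this, Finset.card_eq_three]
        exact ⟨_, _, _, hab, hac, hbc, rfl⟩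
      rw [this, if_pos h2]
      split_ifs <;> linarith
    · have : ({a, b, c, c - a + b} : Finset ℤ).card = 4 := by
        rw [Finset.card_insert_of_notMem, Finset.card_insert_of_notMem, Finset.card_pair]
        · omega
        · simp; omega
        · simp; omega
      rw [this, if_neg hbc, if_neg h2]; linarith

lemma exp_bQ (n : ℕ) (p : ℝ) (h0 : 0 ≤ p) (h1 : p ≤ 1) :
    ∑ A ∈ (bI n).powerset, bw n p A * ((bQ A).card : ℝ) ≤ n ^ 3 * p ^ 4 + 2 * (n ^ 2 * p ^ 3) := by
  have e3 : 0 ≤ p ^ 3 := by positivity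
  have e4 : 0 ≤ p ^ 4 := by positivity
  calc _ ≤ ∑ A ∈ (bI n).powerset, ∑ a ∈ bI n, ∑ b ∈ bI n, ∑ c ∈ bI n, bw n p A *
      (if a ≠ b ∧ a ≠ c then
        (if ({a, b, c, c - a + b} : Finset ℤ) ⊆ A then (1 : ℝ) else 0) else 0) := by
        refine Finset.sum_le_sum fun A hA => ?_
        have := mul_le_mul_of_nonneg_left (bQ_card_le n A (Finset.mem_powerset.1 hA))
          (bw_nonneg n p h0 h1 A)
        simpa only [Finset.mul_sum] using this
    _ = ∑ a ∈ bI n, ∑ b ∈ bI n, ∑ c ∈ bI n, ∑ A ∈ (bI n).powerset, bw n p A *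
      (if a ≠ b ∧ a ≠ c then
        (if ({a, b, c, c - a + b} : Finset ℤ) ⊆ A then (1 : ℝ) else 0) else 0) := by
        rw [Finset.sum_comm]
        refine Finset.sum_congr rfl fun a _ => ?_
        rw [Finset.sum_comm]
        refine Finset.sum_congr rfl fun b _ => ?_
        rw [Finset.sum_comm]
    _ ≤ ∑ a ∈ bI n, ∑ b ∈ bI n, ∑ c ∈ bI n,
        (p ^ 4 + (if b = c then p ^ 3 else 0) + (if 2 * a - b = c then p ^ 3 else 0)) := by
        refine Finset.sum_le_sum fun a _ => Finset.sum_le_sum fun b _ =>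
          Finset.sum_le_sum fun c _ => ?_
        by_cases h : a ≠ b ∧ a ≠ c
        · simp only [if_pos h]
          exact (prob_superset_le n p h0 _).trans (pow_T p h0 a b c h.1 h.2)
        · simp only [if_neg h, mul_zero, Finset.sum_const_zero]
          positivity
    _ ≤ ∑ a ∈ bI n, ∑ b ∈ bI n, (n * p ^ 4 + p ^ 3 + p ^ 3) := by
        refine Finset.sum_le_sum fun a _ => Finset.sum_le_sum fun b _ => ?_
        rw [Finset.sum_add_distrib, Finset.sum_add_distrib, Finset.sum_ite_eq, Finset.sum_ite_eq]
        simp only [Finset.sum_const, bI_card, nsmul_eq_mul]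
        gcongr <;> split_ifs <;> linarith
    _ = _ := by
        simp only [Finset.sum_const, bI_card, nsmul_eq_mul]; ring

lemma card_le_image_add {α β : Type} [DecidableEq β] (s : Finset α) (f : α → β)
    [DecidablePred fun x : α × α => x.1 ≠ x.2 ∧ f x.1 = f x.2] :
    s.card ≤ (s.image f).card +
      ((s ×ˢ s).filter fun x => x.1 ≠ x.2 ∧ f x.1 = f x.2).card := by
  have hg : ∀ y : s.image f, ∃ x ∈ s, f x = y := fun y => Finset.mem_image.1 y.2
  choose g hg1 hg2 using hg
  let G : s → α := fun x => g ⟨f x, Finset.mem_image_of_mem f x.2⟩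
  have hG1 : ∀ x, G x ∈ s := fun x => hg1 _
  have hG2 : ∀ x, f (G x) = f x := fun x => hg2 _
  have hGe : ∀ x y : s, f x = f y → G x = G y := by
    intro x y h
    simp only [G, h]
  have h1 : (s.attach.filter fun x => G x = x).card ≤ (s.image f).card := by
    refine Finset.card_le_card_of_injOn (fun x => f x) ?_ ?_
    · intro x _
      exact Finset.mem_coe.2 (Finset.mem_image_of_mem f x.2)
    · intro x hx y hy h
      simp only [Finset.coe_filter, Set.mem_ofPred_eq] at hx hy
      apply Subtype.ext
      rw [← hx.2, ← hy.2, hGe x y h]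
  have h2 : (s.attach.filter fun x => ¬ G x = x).card ≤
      ((s ×ˢ s).filter fun x => x.1 ≠ x.2 ∧ f x.1 = f x.2).card := by
    refine Finset.card_le_card_of_injOn (fun x => (G x, (x : α))) ?_ ?_
    · intro x hx
      simp only [Finset.coe_filter, Set.mem_ofPred_eq] at hx
      simp only [Finset.coe_filter, Set.mem_ofPred_eq, Finset.mem_product]
      exact ⟨⟨hG1 x, x.2⟩, hx.2, hG2 x⟩
    · intro x hx y hy h
      exact Subtype.ext (Prod.mk.inj h).2
  have h3 := Finset.card_filter_add_card_filter_not (s := s.attach) (fun x => G x = x)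
  rw [Finset.card_attach] at h3
  omega

lemma diff_lower (A : Finset ℤ) : A.card * A.card ≤ (A - A).card + A.card + (bQ A).card := by
  have h := card_le_image_add A.offDiag (fun x => x.1 - x.2)
  have h1 : (A.offDiag.image (fun x : ℤ × ℤ => x.1 - x.2)).card ≤ (A - A).card := by
    refine Finset.card_le_card fun y hy => ?_
    obtain ⟨x, hx, rfl⟩ := Finset.mem_image.1 hy
    rw [Finset.mem_offDiag] at hx
    exact Finset.sub_mem_sub hx.1 hx.2.1
  have h2 : ((A.offDiag ×ˢ A.offDiag).filter fun x : (ℤ × ℤ) × (ℤ × ℤ) =>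
      x.1 ≠ x.2 ∧ x.1.1 - x.1.2 = x.2.1 - x.2.2).card ≤ (bQ A).card := by
    refine Finset.card_le_card_of_injOn (fun x => (x.1.1, x.1.2, x.2.1)) ?_ ?_
    · rintro ⟨⟨a, b⟩, ⟨c, d⟩⟩ hx
      simp only [Finset.coe_filter, Finset.mem_product, Finset.mem_offDiag, Set.mem_ofPred_eq,
        ne_eq, Prod.mk.injEq, not_and] at hx
      obtain ⟨⟨⟨ha, hb, hab⟩, hc, hd, hcd⟩, hne, he⟩ := hx
      simp only [bQ, Finset.coe_filter, Finset.mem_product, Set.mem_ofPred_eq]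
      refine ⟨⟨ha, hb, hc⟩, hab, by omega, ?_⟩
      have : c - a + b = d := by omega
      rwa [this]
    · rintro ⟨⟨a, b⟩, ⟨c, d⟩⟩ hx ⟨⟨a', b'⟩, ⟨c', d'⟩⟩ hx' heq
      simp only [Finset.coe_filter, Set.mem_ofPred_eq] at hx hx'
      simp only [Prod.mk.injEq] at heq ⊢
      omega
  rw [Finset.offDiag_card] at h
  omega

lemma diff_upper (A : Finset ℤ) : (A - A).card ≤ A.card * A.card := Finset.card_sub_le

lemma lt_card (A : Finset ℤ) :
    A.card * A.card = 2 * ((A ×ˢ A).filter fun x => x.1 < x.2).card + A.card := by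
  have h1 := A.offDiag_card
  have h2 : A.offDiag.card = ((A ×ˢ A).filter fun x => x.1 < x.2).card
      + ((A ×ˢ A).filter fun x => x.2 < x.1).card := by
    rw [← Finset.card_union_of_disjoint]
    · congr 1
      ext ⟨a, b⟩
      simp only [Finset.mem_offDiag, Finset.mem_union, Finset.mem_filter, Finset.mem_product]
      grind
    · rw [Finset.disjoint_left]
      intro x hx hx'
      simp only [Finset.mem_filter] at hx hx'
      omega
  have h3 : ((A ×ˢ A).filter fun x => x.2 < x.1).card
      = ((A ×ˢ A).filter fun x => x.1 < x.2).card := by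
    refine Finset.card_bij (fun x _ => (x.2, x.1)) ?_ ?_ ?_
    · simp; tauto
    · simp; tauto
    · simp; tauto
  have : A.card ≤ A.card * A.card := Nat.le_mul_self _
  omega

lemma sum_upper (A : Finset ℤ) : 2 * (A + A).card ≤ A.card * A.card + A.card := by
  have h : A + A ⊆ (((A ×ˢ A).filter fun x => x.1 < x.2).image fun x => x.1 + x.2)
      ∪ A.image (fun x => x + x) := by
    intro y hy
    obtain ⟨a, ha, b, hb, rfl⟩ := Finset.mem_add.1 hy
    simp only [Finset.mem_union, Finset.mem_image, Finset.mem_filter, Finset.mem_product]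
    rcases lt_trichotomy a b with h | h | h
    · exact Or.inl ⟨(a, b), ⟨⟨ha, hb⟩, h⟩, rfl⟩
    · exact Or.inr ⟨a, ha, by rw [h]⟩
    · exact Or.inl ⟨(b, a), ⟨⟨hb, ha⟩, h⟩, by simp [add_comm]⟩
  have h1 := (Finset.card_le_card h).trans (Finset.card_union_le _ _)
  have h2 := Finset.card_image_le (s := (A ×ˢ A).filter fun x => x.1 < x.2)
    (f := fun x => x.1 + x.2)
  have h3 := Finset.card_image_le (s := A) (f := fun x => x + x)
  have := lt_card A
  omega

lemma sum_lower (A : Finset ℤ) :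
    A.card * A.card ≤ 2 * (A + A).card + A.card + 2 * (bQ A).card := by
  have h := card_le_image_add ((A ×ˢ A).filter fun x => x.1 < x.2) (fun x => x.1 + x.2)
  have h1 : (((A ×ˢ A).filter fun x => x.1 < x.2).image
      (fun x : ℤ × ℤ => x.1 + x.2)).card ≤ (A + A).card := by
    refine Finset.card_le_card fun y hy => ?_
    obtain ⟨x, hx, rfl⟩ := Finset.mem_image.1 hy
    rw [Finset.mem_filter, Finset.mem_product] at hx
    exact Finset.add_mem_add hx.1.1 hx.1.2
  have h2 : ((((A ×ˢ A).filter fun x => x.1 < x.2) ×ˢ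
      ((A ×ˢ A).filter fun x => x.1 < x.2)).filter fun x : (ℤ × ℤ) × (ℤ × ℤ) =>
      x.1 ≠ x.2 ∧ x.1.1 + x.1.2 = x.2.1 + x.2.2).card ≤ (bQ A).card := by
    refine Finset.card_le_card_of_injOn (fun x => (x.1.1, x.2.1, x.2.2)) ?_ ?_
    · rintro ⟨⟨a, b⟩, ⟨c, d⟩⟩ hx
      simp only [Finset.coe_filter, Finset.mem_product, Finset.mem_filter, Set.mem_ofPred_eq,
        ne_eq, Prod.mk.injEq, not_and] at hx
      obtain ⟨⟨⟨⟨ha, hb⟩, hab⟩, ⟨hc, hd⟩, hcd⟩, hne, he⟩ := hx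
      simp only [bQ, Finset.coe_filter, Finset.mem_product, Set.mem_ofPred_eq]
      refine ⟨⟨ha, hc, hd⟩, by omega, by omega, ?_⟩
      have : d - a + c = b := by omega
      rwa [this]
    · rintro ⟨⟨a, b⟩, ⟨c, d⟩⟩ hx ⟨⟨a', b'⟩, ⟨c', d'⟩⟩ hx' heq
      simp only [Finset.coe_filter, Set.mem_ofPred_eq] at hx hx'
      simp only [Prod.mk.injEq] at heq ⊢
      omega
  have := lt_card A
  omega

lemma binomProb_eq (n : ℕ) (p : ℝ) (P : Finset ℤ → Prop) :
    binomProb n p P = ∑ A ∈ (bI n).powerset, if P A then bw n p A else 0 := rfl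

lemma binomProb_le_one (n : ℕ) (p : ℝ) (h0 : 0 ≤ p) (h1 : p ≤ 1) (P : Finset ℤ → Prop) :
    binomProb n p P ≤ 1 := by
  rw [binomProb_eq, ← sum_bw n p]
  refine Finset.sum_le_sum fun A _ => ?_
  split_ifs
  · rfl
  · exact bw_nonneg n p h0 h1 A

lemma binomProb_mono (n : ℕ) (p : ℝ) (h0 : 0 ≤ p) (h1 : p ≤ 1) (P R : Finset ℤ → Prop)
    (h : ∀ A, P A → R A) : binomProb n p P ≤ binomProb n p R := by
  rw [binomProb_eq, binomProb_eq]
  refine Finset.sum_le_sum fun A _ => ?_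
  have := bw_nonneg n p h0 h1 A
  by_cases hP : P A
  · simp [hP, h A hP]
  · rw [if_neg hP]; split_ifs <;> linarith

lemma binomProb_lower (n : ℕ) (p : ℝ) (h0 : 0 < p) (h1 : p ≤ 1) (hn : 0 < n) (δ : ℝ) (hδ : 0 < δ)
    (P : Finset ℤ → Prop)
    (h : ∀ A : Finset ℤ, |(A.card : ℝ) - n * p| < δ * (n * p) →
      ((bQ A).card : ℝ) < δ * (n * p) ^ 2 → P A) :
    1 - (1 / (n * p) / δ ^ 2 + (n * p ^ 2 + 2 * p) / δ) ≤ binomProb n p P := by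
  have hn' : (0 : ℝ) < n := by exact_mod_cast hn
  have hm : 0 < n * p := by positivity
  have key : ∀ A ∈ (bI n).powerset, bw n p A ≤ (if P A then bw n p A else 0)
      + (1 / (δ * (n * p)) ^ 2 * (bw n p A * ((A.card : ℝ) - n * p) ^ 2)
        + 1 / (δ * (n * p) ^ 2) * (bw n p A * ((bQ A).card : ℝ))) := by
    intro A _
    have hw := bw_nonneg n p h0.le h1 A
    by_cases hP : P A
    · rw [if_pos hP]
      have : 0 ≤ (1 / (δ * (n * p)) ^ 2 * (bw n p A * ((A.card : ℝ) - n * p) ^ 2)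
        + 1 / (δ * (n * p) ^ 2) * (bw n p A * ((bQ A).card : ℝ))) := by positivity
      linarith
    · rw [if_neg hP, zero_add]
      have a1 : 0 ≤ 1 / (δ * (n * p)) ^ 2 * (bw n p A * ((A.card : ℝ) - n * p) ^ 2) := by positivity
      have a2 : 0 ≤ 1 / (δ * (n * p) ^ 2) * (bw n p A * ((bQ A).card : ℝ)) := by positivity
      by_cases hX : |(A.card : ℝ) - n * p| < δ * (n * p)
      · have hQ : δ * (n * p) ^ 2 ≤ ((bQ A).card : ℝ) := by
          by_contra hh; exact hP (h A hX (not_le.1 hh))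
        have : bw n p A ≤ 1 / (δ * (n * p) ^ 2) * (bw n p A * ((bQ A).card : ℝ)) := by
          rw [one_div, ← div_eq_inv_mul, le_div_iff₀ (by positivity)]
          gcongr
        linarith
      · have hX' : (δ * (n * p)) ^ 2 ≤ ((A.card : ℝ) - n * p) ^ 2 := by
          rw [← sq_abs ((A.card : ℝ) - n * p)]
          gcongr
          exact not_lt.1 hX
        have : bw n p A ≤ 1 / (δ * (n * p)) ^ 2 * (bw n p A * ((A.card : ℝ) - n * p) ^ 2) := by
          rw [one_div, ← div_eq_inv_mul, le_div_iff₀ (by positivity)]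
          gcongr
        linarith
  have hs := Finset.sum_le_sum key
  rw [sum_bw, Finset.sum_add_distrib, Finset.sum_add_distrib, ← Finset.mul_sum,
    ← Finset.mul_sum, ← binomProb_eq] at hs
  have b1 := mul_le_mul_of_nonneg_left (exp_var n p h0.le)
    (show 0 ≤ 1 / (δ * (n * p)) ^ 2 by positivity)
  have b2 := mul_le_mul_of_nonneg_left (exp_bQ n p h0.le h1)
    (show 0 ≤ 1 / (δ * (n * p) ^ 2) by positivity)
  have c1 : 1 / (δ * (n * p)) ^ 2 * (n * p) = 1 / (n * p) / δ ^ 2 := by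
    field_simp
  have c2 : 1 / (δ * (n * p) ^ 2) * (n ^ 3 * p ^ 4 + 2 * (n ^ 2 * p ^ 3))
      = (n * p ^ 2 + 2 * p) / δ := by
    field_simp
  linarith

lemma det_bound (A : Finset ℤ) (m δ ε : ℝ) (hδ : 0 < δ) (hδ1 : δ ≤ 1) (hε : 7 * δ ≤ ε)
    (hm : 1 ≤ δ * m) (hX : |(A.card : ℝ) - m| < δ * m) (hQ : ((bQ A).card : ℝ) < δ * m ^ 2) :
    |((A + A).card : ℝ) / (m ^ 2 / 2) - 1| < ε ∧ |((A - A).card : ℝ) / (m ^ 2) - 1| < ε := by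
  have hm0 : 0 < m := by
    by_contra hh; nlinarith
  have hm2 : 0 < m ^ 2 := by positivity
  have s1 : (2 : ℝ) * ((A + A).card : ℝ) ≤ (A.card : ℝ) * A.card + A.card := by
    exact_mod_cast sum_upper A
  have s2 : (A.card : ℝ) * A.card ≤ 2 * ((A + A).card : ℝ) + A.card + 2 * (bQ A).card := by
    exact_mod_cast sum_lower A
  have d1 : ((A - A).card : ℝ) ≤ (A.card : ℝ) * A.card := by
    exact_mod_cast diff_upper A
  have d2 : (A.card : ℝ) * A.card ≤ ((A - A).card : ℝ) + A.card + (bQ A).card := by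
    exact_mod_cast diff_lower A
  generalize (A.card : ℝ) = X at *
  generalize ((bQ A).card : ℝ) = Q at *
  generalize ((A + A).card : ℝ) = S at *
  generalize ((A - A).card : ℝ) = D at *
  rw [abs_lt] at hX
  have hmm : m ≤ δ * m ^ 2 := by nlinarith
  have hX0 : 0 ≤ X := by nlinarith
  have hXu : X ≤ 2 * (δ * m ^ 2) := by nlinarith
  have hXX : X * X ≤ m ^ 2 + 3 * (δ * m ^ 2) := by
    have : X * X ≤ (m + δ * m) * (m + δ * m) := by
      apply mul_self_le_mul_self hX0; linarith
    nlinarith [mul_le_mul_of_nonneg_right hδ1 (mul_pos hδ hm2).le]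
  have hXl : m ^ 2 - 2 * (δ * m ^ 2) ≤ X * X := by
    have : (m - δ * m) * (m - δ * m) ≤ X * X := by
      apply mul_self_le_mul_self
      · nlinarith
      · linarith
    nlinarith [sq_nonneg (δ * m)]
  have hεm : 7 * (δ * m ^ 2) ≤ ε * m ^ 2 := by nlinarith
  have hδm : 0 < δ * m ^ 2 := by positivity
  have e1 : S / (m ^ 2 / 2) - 1 = (2 * S - m ^ 2) / m ^ 2 := by field_simp
  have e2 : D / (m ^ 2) - 1 = (D - m ^ 2) / m ^ 2 := by field_simp
  rw [e1, e2, abs_div, abs_div, abs_of_pos hm2, div_lt_iff₀ hm2, div_lt_iff₀ hm2, abs_lt, abs_lt]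
  refine ⟨⟨?_, ?_⟩, ?_, ?_⟩ <;> linarith

lemma ratio_bound (S D M η ε : ℝ) (hM : 0 < M) (hη : η ≤ 1 / 2) (hε : 8 * η ≤ ε)
    (h1 : |S / (M / 2) - 1| < η) (h2 : |D / M - 1| < η) : |D / S - 2| < ε := by
  obtain ⟨u, hu⟩ : ∃ u, u = S / (M / 2) := ⟨_, rfl⟩
  obtain ⟨v, hv⟩ : ∃ v, v = D / M := ⟨_, rfl⟩
  rw [← hu] at h1
  rw [← hv] at h2
  have hS : S = u * M / 2 := by rw [hu]; field_simp
  have hD : D = v * M := by rw [hv]; field_simp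
  rw [abs_lt] at h1 h2
  have hu0 : 0 < u := by linarith
  have : D / S - 2 = 2 * (v - u) / u := by rw [hS, hD]; field_simp
  rw [this, abs_div, abs_of_pos hu0, div_lt_iff₀ hu0, abs_lt]
  constructor <;> nlinarith

/-- Hegarty–Miller, case (i): if `n⁻¹ = o(p(n))` and `p(n) = o(n^{-1/2})`, then with
probability tending to 1, `|A+A| ∼ (np(n))²/2` and `|A-A| ∼ (np(n))²`; in particular
`|A-A|/|A+A| → 2` in probability. -/
theorem sum_diff_asymptotics_sparse (p : ℕ → ℝ) (hp : ∀ n, 0 < p n ∧ p n < 1)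
    (hlower : (fun n : ℕ => ((n : ℝ))⁻¹) =o[Filter.atTop] p)
    (hupper : p =o[Filter.atTop] (fun n : ℕ => ((n : ℝ)) ^ (-(1 / 2) : ℝ))) :
    (∀ ε : ℝ, 0 < ε →
      Filter.Tendsto
        (fun n : ℕ => binomProb n (p n) (fun A =>
          |((A + A).card : ℝ) / (((n : ℝ) * p n) ^ 2 / 2) - 1| < ε ∧
          |((A - A).card : ℝ) / (((n : ℝ) * p n) ^ 2) - 1| < ε))
        Filter.atTop (nhds 1)) ∧
    (∀ ε : ℝ, 0 < ε →
      Filter.Tendsto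
        (fun n : ℕ => binomProb n (p n) (fun A =>
          |((A - A).card : ℝ) / ((A + A).card : ℝ) - 2| < ε))
        Filter.atTop (nhds 1)) := by
  have hp0 := fun n => (hp n).1
  have hr : Tendsto (fun n : ℕ => 1 / ((n : ℝ) * p n)) atTop (nhds 0) := by
    refine hlower.tendsto_div_nhds_zero.congr fun n => ?_
    rw [div_eq_mul_inv, one_div, mul_inv]
  have ht : Tendsto (fun n : ℕ => (n : ℝ) * p n ^ 2) atTop (nhds 0) := by
    have h := hupper.tendsto_div_nhds_zero.pow 2
    rw [zero_pow two_ne_zero] at h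
    refine h.congr fun n => ?_
    rw [div_pow, ← Real.rpow_natCast ((n : ℝ) ^ (-(1 / 2) : ℝ)) 2, ← Real.rpow_mul (by positivity)]
    norm_num
    rw [Real.rpow_neg_one, div_inv_eq_mul, mul_comm]
  have hpz : Tendsto p atTop (nhds 0) := by
    have h := hr.mul ht
    rw [zero_mul] at h
    refine h.congr' ?_
    filter_upwards [eventually_gt_atTop 0] with n hn
    have : (0 : ℝ) < n := by exact_mod_cast hn
    have := hp0 n
    field_simp
  have main : ∀ ε : ℝ, 0 < ε →
      Filter.Tendsto
        (fun n : ℕ => binomProb n (p n) (fun A =>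
          |((A + A).card : ℝ) / (((n : ℝ) * p n) ^ 2 / 2) - 1| < ε ∧
          |((A - A).card : ℝ) / (((n : ℝ) * p n) ^ 2) - 1| < ε))
        Filter.atTop (nhds 1) := by
    intro ε hε
    obtain ⟨δ, hδ, hδ1, hδε⟩ : ∃ δ : ℝ, 0 < δ ∧ δ ≤ 1 ∧ 7 * δ ≤ ε :=
      ⟨min 1 (ε / 7), by positivity, min_le_left _ _, by
        have := min_le_right 1 (ε / 7); linarith⟩
    have hlim : Tendsto (fun n : ℕ => 1 - (1 / ((n : ℝ) * p n) / δ ^ 2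
        + ((n : ℝ) * p n ^ 2 + 2 * p n) / δ)) atTop (nhds 1) := by
      have := ((hr.div_const (δ ^ 2)).add ((ht.add (hpz.const_mul 2)).div_const δ)).const_sub 1
      simpa using this
    refine tendsto_of_tendsto_of_tendsto_of_le_of_le' hlim tendsto_const_nhds ?_
      (Eventually.of_forall fun n => binomProb_le_one n (p n) (hp0 n).le (hp n).2.le _)
    filter_upwards [eventually_gt_atTop 0, hr.eventually (gt_mem_nhds hδ)] with n hn hrn
    refine binomProb_lower n (p n) (hp0 n) (hp n).2.le hn δ hδ _ fun A hX hQ => ?_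
    refine det_bound A _ δ ε hδ hδ1 hδε ?_ hX hQ
    have h1 : (0 : ℝ) < n := by exact_mod_cast hn
    have h2 : 0 < (n : ℝ) * p n := mul_pos h1 (hp0 n)
    rw [div_lt_iff₀ h2] at hrn
    exact hrn.le
  refine ⟨main, fun ε hε => ?_⟩
  have hη : 0 < min (1 / 2) (ε / 8) := by positivity
  refine tendsto_of_tendsto_of_tendsto_of_le_of_le' (main _ hη) tendsto_const_nhds ?_
      (Eventually.of_forall fun n => binomProb_le_one n (p n) (hp0 n).le (hp n).2.le _)
  filter_upwards [eventually_gt_atTop 0] with n hn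
  refine binomProb_mono n (p n) (hp0 n).le (hp n).2.le _ _ fun A hA => ?_
  have h1 : (0 : ℝ) < n := by exact_mod_cast hn
  have h2 : 0 < (n : ℝ) * p n := mul_pos h1 (hp0 n)
  refine ratio_bound _ _ _ _ ε (pow_pos h2 2) (min_le_left _ _) ?_ hA.1 hA.2
  have := min_le_right (1 / 2) (ε / 8)
  linarith
end
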